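/- There exist ε₁ > 0 and, for each η > 0, a constant C₅ > 0, depending only on μ, κ, γ₀, γ̄, C₀ (and C₅ in addition on η) but not on ε, ñ or M̄, such that if ε ∈ (0,ε₁) then every solution as in the hypotheses satisfies |ñ|^{1/2}·‖Z^{1/2}Ŵ‖_{L²} ≤ C₅·|ñ|^{-1/2}·|log ε|^{1+η/3}·‖Z^{1/2}R‖_{L²} + C₅·ε^{1/4}·M̄^{1/2}·‖R‖_{L²}^{1/2}‖Ŵ‖_{L²}^{1/2} + C₅·ε^{1/4}·(1+M̄^{1/2})·‖R‖_{L²}^{1/4}‖Ŵ‖_{L²}^{3/4} + C₅·ε^{1/4}·M̄^{1/4}(1+M̄^{5/4})·‖Ŵ‖_{L²}. -/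

import Mathlib

open MeasureTheory Set Filter

noncomputable section

/-- Squared L² integral on the half line `(0,∞)`. -/
def nsq (f : ℝ → ℂ) : ℝ := ∫ y in Set.Ioi (0:ℝ), ‖f y‖ ^ 2

/-- L² norm of a quadruple of functions on `(0,∞)`. -/
def nrm4 (a b c d : ℝ → ℂ) : ℝ := Real.sqrt (nsq a + nsq b + nsq c + nsq d)

/-- Membership in `L²((0,∞))` (square integrability). -/
def ML2 (f : ℝ → ℂ) : Prop := MeasureTheory.IntegrableOn (fun y => ‖f y‖ ^ 2) (Set.Ioi 0)

/-- Multiplication by the square root of a weight. -/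
def wt (Z : ℝ → ℝ) (f : ℝ → ℂ) : ℝ → ℂ := fun y => (Real.sqrt (Z y) : ℂ) * f y

local notation "cj" => (starRingEnd ℂ)



/-- derivative of the flux of the weighted energy identity -/
def dW (k ε μ κ c Us Us1 G G1 Z Z1 Z2 : ℝ) (a0 a1 a2 a3 b0 b1 b2 b3 p p1 : ℂ) : ℂ :=
  (μ*ε) * (Z1*(a2 * cj a1 + k^2 * a1 * cj a0)
     + Z*(a3 * cj a1 + a2 * cj a2 + k^2 * a2 * cj a0 + k^2 * a1 * cj a1)
     + Z2 * a2 * cj a0 + Z1 * a3 * cj a0 + Z1 * a2 * cj a1)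
  - Complex.I * k * (p1 * Z * cj a0 + p * Z1 * cj a0 + p * Z * cj a1)
  + (κ*ε) * ((Z1*G+Z*G1)*(b2 * cj b1 + k^2 * b1 * cj b0)
     + Z*G*(b3 * cj b1 + b2 * cj b2 + k^2 * b2 * cj b0 + k^2 * b1 * cj b1)
     - (G1*Z1+G*Z2)*b2* cj b0 - G*Z1*(b3* cj b0 + b2 * cj b1)
     + c*(Us1*Z1+Us*Z2)*b2* cj a0 + c*Us*Z1*(b3* cj a0+b2* cj a1))
  + Complex.I * k * ((G1*Z1+G*Z2)*b0* cj a0 + G*Z1*(b1* cj a0 + b0 * cj a1))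

/-- derivative of the flux of the identity giving the sign of the boundary weight -/
def dV (s k ε κ G G1 Z1 Z2 : ℝ) (a0 a1 b2 b3 : ℂ) : ℂ :=
  Complex.I * s * (κ*ε) * ((G1*Z1+G*Z2)*b2* cj a0 + G*Z1*(b3* cj a0+b2* cj a1))
  - (s*k/2) * ((G1*Z1+G*Z2)*a0* cj a0 + G*Z1*(a1* cj a0+a0* cj a1))

def dU (s k ε κ Z Z1 : ℝ) (a0 a1 a2 b1 b2 b3 : ℂ) : ℂ :=
  Complex.I * s * (κ*ε) * (Z1*(b2* cj a1 + k^2*b1* cj a0)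
    + Z*(b3* cj a1 + b2* cj a2 + k^2*b2* cj a0 + k^2*b1* cj a1))

def dH (s k ε μ κ c Us Us1 G G1 Z Z1 Z2 : ℝ) (a1 a2 a3 b0 b1 b2 b3 p p1 : ℂ) : ℂ :=
  Complex.I * s * ((μ*ε) * (Z1*(a2 * cj b1 + k^2 * a1 * cj b0)
     + Z*(a3 * cj b1 + a2 * cj b2 + k^2 * a2 * cj b0 + k^2 * a1 * cj b1)
     + Z2 * a2 * cj b0 + Z1 * a3 * cj b0 + Z1 * a2 * cj b1)
   - Complex.I * k * (p1 * Z * cj b0 + p * Z1 * cj b0 + p * Z * cj b1)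
   + (κ*ε) * (c*(Us1*Z1+Us*Z2)*b2* cj b0 + c*Us*Z1*(b3* cj b0+b2* cj b1)))
  - (s*k/2) * ((G1*Z1+G*Z2)*b0* cj b0 + G*Z1*(b1* cj b0+b0* cj b1))

def d0 (k ε μ κ G G1 : ℝ) (a0 a1 a2 a3 b0 b1 b2 b3 p p1 : ℂ) : ℂ :=
  (μ*ε) * (a3 * cj a1 + a2 * cj a2 + k^2 * a2 * cj a0 + k^2 * a1 * cj a1)
  - Complex.I * k * (p1 * cj a0 + p * cj a1)
  + (κ*ε) * (G1*(b2 * cj b1 + k^2 * b1 * cj b0)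
     + G*(b3 * cj b1 + b2 * cj b2 + k^2 * b2 * cj b0 + k^2 * b1 * cj b1))

lemma eb {t T d a : ℝ} {x z : ℂ} (ht : |t| ≤ T) (hx : ‖x‖ ≤ d) (hz : ‖z‖ ≤ a) :
    ‖(t:ℂ) * (x * cj z)‖ ≤ T * (d * a) := by
  rw [norm_mul, norm_mul, Complex.norm_real, Real.norm_eq_abs, RCLike.norm_conj]
  have := norm_nonneg x
  have := norm_nonneg z
  have := abs_nonneg t
  have hT : 0 ≤ T := by linarith
  have hd : 0 ≤ d := by linarith
  gcongr

lemma eb' {F T : ℝ} {x z : ℂ} (hf : ‖x‖ ≤ F) (hz : ‖z‖ ≤ T) :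
    ‖x * z‖ ≤ F * T := by
  rw [norm_mul]
  have := norm_nonneg x
  have := norm_nonneg z
  have hT : 0 ≤ F := by linarith
  gcongr

lemma mulcj (z : ℂ) : z * cj z = ((‖z‖^2 : ℝ) : ℂ) := by
  rw [Complex.mul_conj, Complex.normSq_eq_norm_sq]

lemma addcj (x z : ℂ) : x * cj z + z * cj x = ((2 * (x * cj z).re : ℝ) : ℂ) := by
  have := Complex.add_conj (x * cj z)
  simp only [map_mul, Complex.conj_conj] at this
  rw [← this]; ring

lemma subcj (x z : ℂ) : x * cj z - z * cj x = Complex.I * ((2 * (x * cj z).im : ℝ) : ℂ) := by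
  have := Complex.sub_conj (x * cj z)
  simp only [map_mul, Complex.conj_conj] at this
  rw [mul_comm Complex.I, ← this]; ring

/-- extraction of the real part -/
lemma re_extract {D E : ℂ} {P Q B : ℝ} (h : D = (P:ℂ) + Complex.I * (Q:ℂ) + E) (hE : ‖E‖ ≤ B) :
    P ≤ D.re + B := by
  have h1 : D.re = P + E.re := by rw [h]; simp
  have h2 := Complex.abs_re_le_norm E
  have h3 := neg_abs_le E.re
  linarith

section pw
variable {k ε μ κ c Us Us1 G G1 Z Z1 Z2 : ℝ} {a0 a1 a2 a3 b0 b1 b2 b3 p p1 F1 F2 F3 F4 : ℂ}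

lemma id_W (α β : ℂ) (y : ℝ) (hα : a0 = y * α) (hβ : b0 = y * β)
  (e1 : Complex.I*k*(c*Us*a1 - G*b1) + Complex.I*k*p - (μ*ε)*(a3 - k^2*a1) = F1)
  (e2 : Complex.I*k*(c*Us*(-Complex.I*k*a0) - G*(-Complex.I*k*b0)) + p1
      - (μ*ε)*(-Complex.I*k*a2 - k^2*(-Complex.I*k*a0)) = F2)
  (e3 : -Complex.I*k*a1 - (κ*ε)*(b3 - k^2*b1) = F3)
  (e4 : -Complex.I*k*(-Complex.I*k*a0) - (κ*ε)*(-Complex.I*k*b2 - k^2*(-Complex.I*k*b0)) = F4) :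
  dW k ε μ κ c Us Us1 G G1 Z Z1 Z2 a0 a1 a2 a3 b0 b1 b2 b3 p p1 =
   ((ε*Z*(μ*(‖a2‖^2+2*k^2*‖a1‖^2+k^4*‖a0‖^2) + κ*G*(‖b2‖^2+2*k^2*‖b1‖^2+k^4*‖b0‖^2)) : ℝ):ℂ)
   + Complex.I * ((k*c*Us*Z*(‖a1‖^2+k^2*‖a0‖^2) - k*G*Z*(2*(b1 * cj a1).re + k^2*(2*(b0* cj a0).re))
       + k*G*Z1*(2*(a1* cj b0).re) : ℝ):ℂ)
   + ((2*(μ*ε*Z1) : ℝ) * (a2 * cj a1) + (2*(μ*ε*Z1) : ℝ) * ((k*a1) * cj (k*a0))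
     + (μ*ε*(y*Z2) : ℝ) * (a2 * cj α)
     + (κ*ε*(Z1*G+Z*G1) : ℝ) * (b2 * cj b1) + (κ*ε*(Z1*G+Z*G1) : ℝ) * ((k*b1) * cj (k*b0))
     + (-(κ*ε*(y*(G1*Z1+G*Z2))) : ℝ) * (b2 * cj β) + (-(κ*ε*(G*Z1)) : ℝ) * (b2 * cj b1)
     + (-(κ*ε*(G*Z1)) : ℝ) * ((k*b1) * cj (k*b0))
     + (κ*ε*c*(y*(Us1*Z1+Us*Z2)) : ℝ) * (b2 * cj α)
     + (κ*ε*c*Us*Z1 : ℝ) * (b2 * cj a1) + (κ*ε*c*Us*Z1 : ℝ) * ((k*b1) * cj (k*a0))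
     + (k*(G1*Z1+G*Z2) : ℝ) * ((Complex.I * b0) * cj a0)
     - F1 * (Z * cj a1 + Z1 * cj a0) - F2 * (Z * (Complex.I * k * cj a0))
     - F3 * (Z*G* cj b1 - G*Z1* cj b0 + c*Us*Z1* cj a0) - F4 * (Z*G*(Complex.I*k* cj b0))) := by
  have hα' : cj a0 = y * cj α := by rw [hα]; simp
  have hβ' : cj b0 = y * cj β := by rw [hβ]; simp
  have m0 := mulcj a0
  have m1 := mulcj a1
  have m2 := mulcj a2
  have n0 := mulcj b0
  have n1 := mulcj b1
  have n2 := mulcj b2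
  have q1 := addcj b1 a1
  have q0 := addcj b0 a0
  have q2 := addcj a1 b0
  simp only [dW, map_mul, Complex.conj_ofReal]
  push_cast at *
  have hI : Complex.I^2 = -1 := Complex.I_sq
  linear_combination (-1)*(Z * cj a1 + Z1 * cj a0) * e1
    - (Z * (Complex.I * k * cj a0)) * e2
    - (Z*G* cj b1 - G*Z1* cj b0 + c*Us*Z1* cj a0) * e3 - (Z*G*(Complex.I*k* cj b0))*e4
    + ε*Z*μ*(m2 + 2*k^2*m1+k^4*m0) + ε*Z*κ*G*(n2+2*k^2*n1+k^4*n0)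
    + Complex.I*(k*c*Us*Z*(m1+k^2*m0)) - Complex.I*k*G*Z*(q1+k^2*q0) + Complex.I*k*G*Z1*q2
    + (μ*ε*Z2*a2 + κ*ε*c*(Us1*Z1+Us*Z2)*b2)*hα' - κ*ε*(G1*Z1+G*Z2)*b2*hβ'
    + (μ*ε*a2*k^2* cj a0*Z - μ*ε*k^4* cj a0*Z*a0 + ε*k^2*Z*κ*G*b2* cj b0 - ε*k^4*Z*κ*G* cj b0*b0
       + k^3* cj a0*Z*Complex.I*G*b0 - k^3* cj a0*Z*Complex.I*c*Us*a0
       + k^3*Z*Complex.I*G* cj b0*a0) * hI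

lemma id_V (s : ℝ) (α : ℂ) (y : ℝ) (hα : a0 = y * α)
  (e3 : -Complex.I*k*a1 - (κ*ε)*(b3 - k^2*b1) = F3) :
  dV s k ε κ G G1 Z1 Z2 a0 a1 b2 b3 =
   ((s*k/2 * (-(G1*Z1+G*Z2)) * ‖a0‖^2 : ℝ):ℂ)
   + Complex.I * ((s*k*G*Z1*(a1 * cj a0).im : ℝ):ℂ)
   + ((s*(κ*ε*(y*(G1*Z1+G*Z2))) : ℝ) * ((Complex.I*b2) * cj α)
     + (s*(κ*ε*(G*Z1)) : ℝ) * ((Complex.I*b2) * cj a1)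
     + (s*(κ*ε*(G*Z1)) : ℝ) * ((Complex.I*(k*b1)) * cj (k*a0))
     - F3 * (Complex.I * (s*G*Z1* cj a0))) := by
  have hα' : cj a0 = y * cj α := by rw [hα]; simp
  have m0 := mulcj a0
  have q := subcj a1 a0
  simp only [dV, map_mul, Complex.conj_ofReal]
  push_cast at *
  have hI : Complex.I^2 = -1 := Complex.I_sq
  linear_combination (-1)*(Complex.I * (s*G*Z1* cj a0)) * e3
    - s*k/2*(G1*Z1+G*Z2)*m0 + s*k*G*Z1/2*q + Complex.I*s*κ*ε*(G1*Z1+G*Z2)*b2*hα' 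
    - s*k*G*Z1*a1* cj a0 * hI

lemma id_U (s : ℝ)
  (e3 : -Complex.I*k*a1 - (κ*ε)*(b3 - k^2*b1) = F3)
  (e4 : -Complex.I*k*(-Complex.I*k*a0) - (κ*ε)*(-Complex.I*k*b2 - k^2*(-Complex.I*k*b0)) = F4) :
  dU s k ε κ Z Z1 a0 a1 a2 b1 b2 b3 =
   ((s*k*Z*(‖a1‖^2+k^2*‖a0‖^2) : ℝ):ℂ) + Complex.I * ((0:ℝ):ℂ)
   + ((s*(κ*ε*Z1) : ℝ) * ((Complex.I*b2) * cj a1)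
     + (s*(κ*ε*Z1) : ℝ) * ((Complex.I*(k*b1)) * cj (k*a0))
     + (s*(κ*ε*Z) : ℝ) * ((Complex.I*b2) * cj a2)
     + (2*(s*(κ*ε*Z)) : ℝ) * ((Complex.I*(k*b1)) * cj (k*a1))
     + (s*(κ*ε*Z) : ℝ) * ((Complex.I*(k^2*b0)) * cj (k^2*a0))
     - F3 * (Complex.I * (s*Z* cj a1)) - F4 * (Complex.I * (s*Z*(Complex.I*k* cj a0)))) := by
  have m0 := mulcj a0
  have m1 := mulcj a1
  simp only [dU, map_mul, map_pow, Complex.conj_ofReal]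
  push_cast at *
  have hI : Complex.I^2 = -1 := Complex.I_sq
  linear_combination (-1)*(Complex.I * (s*Z* cj a1)) * e3
    - (Complex.I * (s*Z*(Complex.I*k* cj a0))) * e4 + s*k*Z*(m1+k^2*m0)
    + (Complex.I*s*κ*ε*b2*k^2* cj a0*Z - Complex.I*s*κ*ε*k^4* cj a0*Z*b0 - s* cj a1*k*Z*a1
      + s*k^3* cj a0*Z*a0*(Complex.I^2-1)) * hI

lemma id_H (s : ℝ) (β : ℂ) (y : ℝ) (hβ : b0 = y * β)
  (e1 : Complex.I*k*(c*Us*a1 - G*b1) + Complex.I*k*p - (μ*ε)*(a3 - k^2*a1) = F1)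
  (e2 : Complex.I*k*(c*Us*(-Complex.I*k*a0) - G*(-Complex.I*k*b0)) + p1
      - (μ*ε)*(-Complex.I*k*a2 - k^2*(-Complex.I*k*a0)) = F2)
  (e3 : -Complex.I*k*a1 - (κ*ε)*(b3 - k^2*b1) = F3) :
  dH s k ε μ κ c Us Us1 G G1 Z Z1 Z2 a1 a2 a3 b0 b1 b2 b3 p p1 =
   ((s*k*G*Z*(‖b1‖^2+k^2*‖b0‖^2) + s*k/2 * (-(G1*Z1+G*Z2)) * ‖b0‖^2 : ℝ):ℂ)
   + Complex.I * ((s*k*G*Z1*(b1 * cj b0).im : ℝ):ℂ)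
   + ((2*(s*(μ*ε*Z1)) : ℝ) * ((Complex.I*a2) * cj b1)
     + (2*(s*(μ*ε*Z1)) : ℝ) * ((Complex.I*(k*a1)) * cj (k*b0))
     + (s*(μ*ε*(y*Z2)) : ℝ) * ((Complex.I*a2) * cj β)
     + (s*(κ*ε*c*(y*(Us1*Z1+Us*Z2))) : ℝ) * ((Complex.I*b2) * cj β)
     + (s*(κ*ε*c*Us*Z1) : ℝ) * ((Complex.I*b2) * cj b1)
     + (s*(κ*ε*c*Us*Z1) : ℝ) * ((Complex.I*(k*b1)) * cj (k*b0))
     + (s*(μ*ε*Z) : ℝ) * ((Complex.I*a2) * cj b2)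
     + (2*(s*(μ*ε*Z)) : ℝ) * ((Complex.I*(k*a1)) * cj (k*b1))
     + (s*(μ*ε*Z) : ℝ) * ((Complex.I*(k^2*a0)) * cj (k^2*b0))
     + (-(s*k*(c*Us*Z)) : ℝ) * (a1 * cj b1)
     + (-(s*k*(c*Us*Z)) : ℝ) * ((k*a0) * cj (k*b0))
     - F1 * (Complex.I*(s*(Z * cj b1 + Z1 * cj b0))) - F2 * (Complex.I*(s*(Z * (Complex.I * k * cj b0))))
     - F3 * (Complex.I*(s*(c*Us*Z1* cj b0)))) := by
  have hβ' : cj b0 = y * cj β := by rw [hβ]; simp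
  have n0 := mulcj b0
  have n1 := mulcj b1
  have q := subcj b1 b0
  simp only [dH, map_mul, map_pow, Complex.conj_ofReal]
  push_cast at *
  have hI : Complex.I^2 = -1 := Complex.I_sq
  linear_combination (-1)*(Complex.I*(s*(Z * cj b1 + Z1 * cj b0))) * e1
    - (Complex.I*(s*(Z * (Complex.I * k * cj b0)))) * e2 - (Complex.I*(s*(c*Us*Z1* cj b0)))*e3
    + s*k*G*Z*(n1+k^2*n0)
    - s*k/2*(G1*Z1+G*Z2)*n0 + s*k*G*Z1/2*q 
    + (Complex.I*s*μ*ε*Z2*a2 + Complex.I*s*κ*ε*c*(Us1*Z1+Us*Z2)*b2)*hβ'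
    + (Complex.I*s*μ*ε*a2*k^2* cj b0*Z - Complex.I*s*μ*ε*k^4* cj b0*Z*a0 - s*Z1*k* cj b0*G*b1
      + s* cj b1*k*a1*Z*c*Us - s* cj b1*k*Z*G*b1
      + (Complex.I^2-1)*(s*k^3* cj b0*Z*G*b0 - s*k^3* cj b0*Z*c*Us*a0)) * hI

lemma id_0 
  (e1 : Complex.I*k*(c*Us*a1 - G*b1) + Complex.I*k*p - (μ*ε)*(a3 - k^2*a1) = F1)
  (e2 : Complex.I*k*(c*Us*(-Complex.I*k*a0) - G*(-Complex.I*k*b0)) + p1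
      - (μ*ε)*(-Complex.I*k*a2 - k^2*(-Complex.I*k*a0)) = F2)
  (e3 : -Complex.I*k*a1 - (κ*ε)*(b3 - k^2*b1) = F3)
  (e4 : -Complex.I*k*(-Complex.I*k*a0) - (κ*ε)*(-Complex.I*k*b2 - k^2*(-Complex.I*k*b0)) = F4) :
  d0 k ε μ κ G G1 a0 a1 a2 a3 b0 b1 b2 b3 p p1 =
   ((ε*(μ*(‖a2‖^2+2*k^2*‖a1‖^2+k^4*‖a0‖^2) + κ*G*(‖b2‖^2+2*k^2*‖b1‖^2+k^4*‖b0‖^2)) : ℝ):ℂ)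
   + Complex.I * ((k*c*Us*(‖a1‖^2+k^2*‖a0‖^2) - k*G*(2*(b1 * cj a1).re + k^2*(2*(b0* cj a0).re))
       : ℝ):ℂ)
   + ((κ*ε*G1 : ℝ) * (b2 * cj b1) + (κ*ε*G1 : ℝ) * ((k*b1) * cj (k*b0))
     - F1 * (cj a1) - F2 * (Complex.I * k * cj a0)
     - F3 * (G* cj b1) - F4 * (G*(Complex.I*k* cj b0))) := by
  have m0 := mulcj a0
  have m1 := mulcj a1
  have m2 := mulcj a2
  have n0 := mulcj b0
  have n1 := mulcj b1
  have n2 := mulcj b2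
  have q1 := addcj b1 a1
  have q0 := addcj b0 a0
  simp only [d0, map_mul, Complex.conj_ofReal]
  push_cast at *
  have hI : Complex.I^2 = -1 := Complex.I_sq
  linear_combination (-1)*(cj a1) * e1
    - ((Complex.I * k * cj a0)) * e2
    - (G* cj b1) * e3 - (G*(Complex.I*k* cj b0))*e4
    + ε*μ*(m2 + 2*k^2*m1+k^4*m0) + ε*κ*G*(n2+2*k^2*n1+k^4*n0)
    + Complex.I*(k*c*Us*(m1+k^2*m0)) - Complex.I*k*G*(q1+k^2*q0) 
    + (μ*ε*a2*k^2* cj a0 - μ*ε*k^4* cj a0*a0 + ε*k^2*κ*G*b2* cj b0 - ε*k^4*κ*G* cj b0*b0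
       + k^3* cj a0*Complex.I*G*b0 - k^3* cj a0*Complex.I*c*Us*a0
       + k^3*Complex.I*G* cj b0*a0) * hI

end pw

/-- pointwise bounds on the coefficients -/
structure Pt (ε μ κ c Us Us1 G G1 Z Z1 Z2 y M K : ℝ) : Prop where
  hε : 0 ≤ ε
  hM : 0 ≤ M
  hK : 1 ≤ K
  hy : 0 < y
  hμ : |μ| ≤ K
  hκ : |κ| ≤ K
  hc : |c| ≤ K
  hUs : |Us| ≤ K
  hG : |G| ≤ K
  hZ0 : 0 ≤ Z
  hZ : Z ≤ K * y
  hZ10 : 0 ≤ Z1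
  hZ1 : Z1 ≤ K
  hZ2 : y * |Z2| ≤ K * (1 + M)
  hG1 : y * |G1| ≤ K * M
  hUs1 : y * |Us1| ≤ K * M

lemma abm {x y X Y : ℝ} (hx : |x| ≤ X) (hy : |y| ≤ Y) : |x * y| ≤ X * Y := by
  rw [abs_mul]
  have := abs_nonneg x
  have : 0 ≤ X := by linarith
  gcongr

lemma abad {x y X Y : ℝ} (hx : |x| ≤ X) (hy : |y| ≤ Y) : |x + y| ≤ X + Y :=
  (abs_add_le x y).trans (add_le_add hx hy)

section bounds
variable {k ε μ κ c Us Us1 G G1 Z Z1 Z2 y M K : ℝ}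

lemma Pt.coef (H : Pt ε μ κ c Us Us1 G G1 Z Z1 Z2 y M K) :
    |μ*ε*Z1| ≤ K^4*(ε*(1+M)) ∧ |μ*ε*(y*Z2)| ≤ K^4*(ε*(1+M)) ∧
    |κ*ε*(Z1*G+Z*G1)| ≤ K^4*(ε*(1+M)) ∧
    |κ*ε*(y*(G1*Z1+G*Z2))| ≤ 2*(K^4*(ε*(1+M))) ∧
    |κ*ε*(G*Z1)| ≤ K^4*(ε*(1+M)) ∧
    |κ*ε*c*(y*(Us1*Z1+Us*Z2))| ≤ 2*(K^4*(ε*(1+M))) ∧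
    |κ*ε*c*Us*Z1| ≤ K^4*(ε*(1+M)) ∧ |κ*ε*Z1| ≤ K^4*(ε*(1+M)) := by
  obtain ⟨hε, hM, hK, hy, hμ, hκ, hc, hUs, hG, hZ0, hZ, hZ10, hZ1, hZ2, hG1, hUs1⟩ := H
  have aε : |ε| ≤ ε := by rw [abs_of_nonneg hε]
  have aZ1 : |Z1| ≤ K := by rwa [abs_of_nonneg hZ10]
  have aZ2 : |y*Z2| ≤ K*(1+M) := by rwa [abs_mul, abs_of_pos hy]
  have aG1 : |y*G1| ≤ K*M := by rwa [abs_mul, abs_of_pos hy]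
  have aUs1 : |y*Us1| ≤ K*M := by rwa [abs_mul, abs_of_pos hy]
  have aZG1 : |Z*G1| ≤ K*(K*M) := by
    rw [abs_mul, abs_of_nonneg hZ0]
    calc Z*|G1| ≤ (K*y)*|G1| := by gcongr
      _ = K*(y*|G1|) := by ring
      _ ≤ _ := by gcongr
  have e2 : K^2 ≤ K^4 := pow_le_pow_right₀ hK (by norm_num)
  have e3 : K^3 ≤ K^4 := pow_le_pow_right₀ hK (by norm_num)
  have hK0 : 0 ≤ K := by linarith
  have eM : ε ≤ ε*(1+M) := by nlinarith
  have hεM : 0 ≤ ε*(1+M) := by positivity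
  have hεM' : ε*M ≤ ε*(1+M) := by nlinarith
  have g2 : K^2*ε ≤ K^4*(ε*(1+M)) := by gcongr
  have g3 : K^3*ε ≤ K^4*(ε*(1+M)) := by gcongr
  have g4 : K^4*ε ≤ K^4*(ε*(1+M)) := by gcongr
  have g2' : K^2*(ε*(1+M)) ≤ K^4*(ε*(1+M)) := by gcongr
  have g3' : K^3*(ε*(1+M)) ≤ K^4*(ε*(1+M)) := by gcongr
  have g3'' : K^3*(ε*M) ≤ K^4*(ε*(1+M)) := by gcongr
  have g4'' : K^4*(ε*M) ≤ K^4*(ε*(1+M)) := by gcongr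
  refine ⟨?_, ?_, ?_, ?_, ?_, ?_, ?_, ?_⟩
  · refine (abm (abm hμ aε) aZ1).trans ?_; linarith
  · refine (abm (abm hμ aε) aZ2).trans ?_; linarith
  · refine (abm (abm hκ aε) (abad (abm aZ1 hG) aZG1)).trans ?_; linarith
  · have : y*(G1*Z1+G*Z2) = (y*G1)*Z1+G*(y*Z2) := by ring
    rw [this]
    refine (abm (abm hκ aε) (abad (abm aG1 aZ1) (abm hG aZ2))).trans ?_; linarith
  · refine (abm (abm hκ aε) (abm hG aZ1)).trans ?_; linarith
  · have : y*(Us1*Z1+Us*Z2) = (y*Us1)*Z1+Us*(y*Z2) := by ring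
    rw [this]
    refine (abm (abm (abm hκ aε) hc) (abad (abm aUs1 aZ1) (abm hUs aZ2))).trans ?_; linarith
  · refine (abm (abm (abm (abm hκ aε) hc) hUs) aZ1).trans ?_; linarith
  · refine (abm (abm hκ aε) aZ1).trans ?_; linarith

variable {a0 a1 a2 a3 b0 b1 b2 b3 p p1 F1 F2 F3 F4 : ℂ} {w X d a m Fm : ℝ}

/-- pointwise sizes of the unknowns -/
structure Sz (k y Z Z1 : ℝ) (a0 a1 a2 b0 b1 b2 : ℂ) (w X d a m : ℝ) : Prop where
  hw : w = ‖a1‖+‖b1‖+|k| * (‖a0‖+‖b0‖)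
  hX : X = ‖a0‖+‖b0‖
  hd : d = ‖a2‖+‖b2‖+|k| * w
  ha : a = w + X/y
  hm : m = Z*w+Z1*X

lemma Sz.facts (S : Sz k y Z Z1 a0 a1 a2 b0 b1 b2 w X d a m) (hy : 0 < y) :
    (‖a2‖ ≤ d ∧ ‖b2‖ ≤ d ∧ ‖(k:ℂ)*a1‖ ≤ d ∧ ‖(k:ℂ)*b1‖ ≤ d) ∧
    (‖a1‖ ≤ a ∧ ‖b1‖ ≤ a ∧ ‖(k:ℂ)*a0‖ ≤ a ∧ ‖(k:ℂ)*b0‖ ≤ a ∧ ‖a0/(y:ℂ)‖ ≤ a ∧ ‖b0/(y:ℂ)‖ ≤ a) ∧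
    0 ≤ w ∧ 0 ≤ X ∧ 0 ≤ d ∧ 0 ≤ a := by
  obtain ⟨hw, hX, hd, ha, hm⟩ := S
  have hkw : |k| * w = |k| * ‖a1‖+|k| * ‖b1‖+|k| * (|k| * (‖a0‖+‖b0‖)) := by rw [hw]; ring
  have hXy : X/y = ‖a0‖/y+‖b0‖/y := by rw [hX]; ring
  have hkX : |k| * (‖a0‖+‖b0‖) = |k| * ‖a0‖+|k| * ‖b0‖ := by ring
  have p1 := norm_nonneg a1
  have p2 := norm_nonneg b1
  have p3 := norm_nonneg a2
  have p4 := norm_nonneg b2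
  have p5 : 0 ≤ |k| * ‖a0‖ := by positivity
  have p6 : 0 ≤ |k| * ‖b0‖ := by positivity
  have p7 : 0 ≤ ‖a0‖/y := by positivity
  have p8 : 0 ≤ ‖b0‖/y := by positivity
  have p9 : 0 ≤ |k| * ‖a1‖ := by positivity
  have p10 : 0 ≤ |k| * ‖b1‖ := by positivity
  have p11 : 0 ≤ |k| * (|k| * (‖a0‖+‖b0‖)) := by positivity
  have p12 := norm_nonneg a0
  have p13 := norm_nonneg b0
  simp only [norm_mul, norm_div, Complex.norm_real, Real.norm_eq_abs, abs_of_pos hy]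
  refine ⟨⟨?_, ?_, ?_, ?_⟩, ⟨?_, ?_, ?_, ?_, ?_, ?_⟩, ?_, ?_, ?_, ?_⟩ <;> linarith

/-- sizes of the weighted test functions -/
lemma Sz.tests (S : Sz k y Z Z1 a0 a1 a2 b0 b1 b2 w X d a m) (hZ0 : 0 ≤ Z) (hZ10 : 0 ≤ Z1) :
    Z*‖a1‖+Z1*‖a0‖ ≤ m ∧ Z*(|k| * ‖a0‖) ≤ m ∧ Z*‖b1‖+Z1*(‖b0‖+‖a0‖) ≤ m ∧ Z*(|k| * ‖b0‖) ≤ m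
      ∧ 0 ≤ m := by
  obtain ⟨hw, hX, hd, ha, hm⟩ := S
  have hm' : m = Z*‖a1‖+Z*‖b1‖+Z*(|k| * ‖a0‖)+Z*(|k| * ‖b0‖)+Z1*‖a0‖+Z1*‖b0‖ := by
    rw [hm, hw, hX]; ring
  have q1 : 0 ≤ Z*‖a1‖ := by positivity
  have q2 : 0 ≤ Z*‖b1‖ := by positivity
  have q3 : 0 ≤ Z*(|k| * ‖a0‖) := by positivity
  have q4 : 0 ≤ Z*(|k| * ‖b0‖) := by positivity
  have q5 : 0 ≤ Z1*‖a0‖ := by positivity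
  have q6 : 0 ≤ Z1*‖b0‖ := by positivity
  refine ⟨?_, ?_, ?_, ?_, ?_⟩ <;> linarith

end bounds


lemma na {x z : ℂ} {A B : ℝ} (hx : ‖x‖ ≤ A) (hz : ‖z‖ ≤ B) : ‖x + z‖ ≤ A + B :=
  (norm_add_le x z).trans (add_le_add hx hz)
lemma ns {x z : ℂ} {A B : ℝ} (hx : ‖x‖ ≤ A) (hz : ‖z‖ ≤ B) : ‖x - z‖ ≤ A + B :=
  (norm_sub_le x z).trans (add_le_add hx hz)

section bounds
variable {s k ε μ κ c Us Us1 G G1 Z Z1 Z2 y M K : ℝ}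
variable {a0 a1 a2 a3 b0 b1 b2 b3 p p1 F1 F2 F3 F4 : ℂ} {w X d a m Fm : ℝ}

lemma ab2 {t T : ℝ} (h : |t| ≤ T) : |2*t| ≤ 2*T := by
  rw [abs_mul, abs_two]; linarith
lemma abn {t T : ℝ} (h : |t| ≤ T) : |-t| ≤ T := by rwa [abs_neg]
lemma abs1 {t T : ℝ} (hs : |s| = 1) (h : |t| ≤ T) : |s*t| ≤ T := by
  rw [abs_mul, hs]; linarith
lemma nI {x : ℂ} {T : ℝ} (h : ‖x‖ ≤ T) : ‖Complex.I * x‖ ≤ T := by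
  rw [norm_mul, Complex.norm_I]; linarith

lemma bd_W (H : Pt ε μ κ c Us Us1 G G1 Z Z1 Z2 y M K)
  (S : Sz k y Z Z1 a0 a1 a2 b0 b1 b2 w X d a m)
  (hF1 : ‖F1‖ ≤ Fm) (hF2 : ‖F2‖ ≤ Fm) (hF3 : ‖F3‖ ≤ Fm) (hF4 : ‖F4‖ ≤ Fm)
  (e1 : Complex.I*k*(c*Us*a1 - G*b1) + Complex.I*k*p - (μ*ε)*(a3 - k^2*a1) = F1)
  (e2 : Complex.I*k*(c*Us*(-Complex.I*k*a0) - G*(-Complex.I*k*b0)) + p1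
      - (μ*ε)*(-Complex.I*k*a2 - k^2*(-Complex.I*k*a0)) = F2)
  (e3 : -Complex.I*k*a1 - (κ*ε)*(b3 - k^2*b1) = F3)
  (e4 : -Complex.I*k*(-Complex.I*k*a0) - (κ*ε)*(-Complex.I*k*b2 - k^2*(-Complex.I*k*b0)) = F4) :
  ε*Z*(μ*(‖a2‖^2+2*k^2*‖a1‖^2+k^4*‖a0‖^2) + κ*G*(‖b2‖^2+2*k^2*‖b1‖^2+k^4*‖b0‖^2))
   ≤ (dW k ε μ κ c Us Us1 G G1 Z Z1 Z2 a0 a1 a2 a3 b0 b1 b2 b3 p p1).re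
     + (20*K^4*(ε*(1+M)*(d*a) + Fm*m) + |k| * |G1*Z1+G*Z2| * (‖a0‖*‖b0‖)) := by
  have hy := H.hy
  have hyC : (y:ℂ) ≠ 0 := by exact_mod_cast hy.ne'
  obtain ⟨c1, c2, c3, c4, c5, c6, c7, c8⟩ := H.coef
  obtain ⟨⟨f1, f2, f3, f4⟩, ⟨g1, g2, g3, g4, g5, g6⟩, hw0, hX0, hd0, ha0⟩ := S.facts hy
  obtain ⟨t1, t2, t3, t4, hm0⟩ := S.tests H.hZ0 H.hZ10
  have hK := H.hK
  have hFm : 0 ≤ Fm := (norm_nonneg _).trans hF1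
  have hT1 : ‖(Z * cj a1 + Z1 * cj a0 : ℂ)‖ ≤ m := by
    refine (norm_add_le _ _).trans ?_
    simpa [abs_of_nonneg H.hZ0, abs_of_nonneg H.hZ10] using t1
  have hT2 : ‖(Z * (Complex.I * k * cj a0) : ℂ)‖ ≤ m := by
    simpa [abs_of_nonneg H.hZ0, abs_of_nonneg H.hZ10] using t2
  have hT4 : ‖(Z*G*(Complex.I*k* cj b0) : ℂ)‖ ≤ K*m := by
    have : (Z*G*(Complex.I*k* cj b0) : ℂ) = G * (Z * (Complex.I * k * cj b0)) := by ring
    rw [this]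
    refine eb' (by simpa using H.hG) ?_
    simpa [abs_of_nonneg H.hZ0] using t4
  have hT3 : ‖(Z*G* cj b1 - G*Z1* cj b0 + c*Us*Z1* cj a0 : ℂ)‖ ≤ K^2*m := by
    refine (na (ns (A := K^2*(Z*‖b1‖)) (B := K^2*(Z1*‖b0‖)) ?_ ?_)
      (B := K^2*(Z1*‖a0‖)) ?_).trans ?_
    · simp only [norm_mul, Complex.norm_real, Real.norm_eq_abs, abs_of_nonneg H.hZ0, RCLike.norm_conj]
      have : |G| ≤ K^2 := H.hG.trans (by nlinarith)
      have h0 := H.hZ0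
      calc Z * |G| * ‖b1‖ = |G| * (Z*‖b1‖) := by ring
        _ ≤ _ := by gcongr
    · simp only [norm_mul, Complex.norm_real, Real.norm_eq_abs, abs_of_nonneg H.hZ10, RCLike.norm_conj]
      have : |G| ≤ K^2 := H.hG.trans (by nlinarith)
      have h0 := H.hZ10
      calc |G| * Z1 * ‖b0‖ = |G| * (Z1*‖b0‖) := by ring
        _ ≤ _ := by gcongr
    · simp only [norm_mul, Complex.norm_real, Real.norm_eq_abs, abs_of_nonneg H.hZ10, RCLike.norm_conj]
      have : |c| * |Us| ≤ K^2 := by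
        rw [← abs_mul, sq]; exact abm H.hc H.hUs
      have h0 := H.hZ10
      calc |c| * |Us| * Z1 * ‖a0‖ = (|c| * |Us|) * (Z1*‖a0‖) := by ring
        _ ≤ _ := by gcongr
    · have : K^2*(Z*‖b1‖+Z1*(‖b0‖+‖a0‖)) ≤ K^2*m := by gcongr
      linarith
  have hL : ‖((k*(G1*Z1+G*Z2) : ℝ) : ℂ) * ((Complex.I * b0) * cj a0)‖
      ≤ |k| * |G1*Z1+G*Z2| * (‖a0‖*‖b0‖) := by
    refine (eb (T := |k| * |G1*Z1+G*Z2|) (by rw [abs_mul]) (nI le_rfl) le_rfl).trans ?_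
    rw [mul_comm ‖a0‖]
  refine re_extract (id_W (a0/y) (b0/y) y (by field_simp) (by field_simp) e1 e2 e3 e4) ?_
  refine (ns (ns (ns (ns (na (na (na (na (na (na (na (na (na (na (na
    (eb (ab2 c1) f1 g1) (eb (ab2 c1) f3 g3)) (eb c2 f1 g5))
    (eb c3 f2 g2)) (eb c3 f4 g4))
    (eb (abn c4) f2 g6)) (eb (abn c5) f2 g2))
    (eb (abn c5) f4 g4)) (eb c6 f2 g5)) (eb c7 f2 g1)) (eb c7 f4 g3)) hL)
    (eb' hF1 hT1)) (eb' hF2 hT2)) (eb' hF3 hT3)) (eb' hF4 hT4)).trans ?_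
  have k1 : K ≤ K^4 := le_self_pow₀ hK (by norm_num)
  have k0 : 1 ≤ K^4 := one_le_pow₀ hK
  have k2 : K^2 ≤ K^4 := pow_le_pow_right₀ hK (by norm_num)
  have r : 0 ≤ Fm * m := by positivity
  have r1 : Fm*m ≤ K^4*(Fm*m) := le_mul_of_one_le_left r k0
  have r2 : K*(Fm*m) ≤ K^4*(Fm*m) := by gcongr
  have r3 : K^2*(Fm*m) ≤ K^4*(Fm*m) := by gcongr
  have r4 : 0 ≤ K^4*(ε*(1+M))*(d*a) := by have := H.hε; have := H.hM; positivity
  linarith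

lemma bd_V (hs : |s| = 1) (hsk : s*k = |k|) (H : Pt ε μ κ c Us Us1 G G1 Z Z1 Z2 y M K)
  (S : Sz k y Z Z1 a0 a1 a2 b0 b1 b2 w X d a m)
  (hF3 : ‖F3‖ ≤ Fm)
  (e3 : -Complex.I*k*a1 - (κ*ε)*(b3 - k^2*b1) = F3) :
  |k|/2 * (-(G1*Z1+G*Z2)) * ‖a0‖^2
   ≤ (dV s k ε κ G G1 Z1 Z2 a0 a1 b2 b3).re
     + 20*K^4*(ε*(1+M)*(d*a) + Fm*m) := by
  have hy := H.hy
  have hyC : (y:ℂ) ≠ 0 := by exact_mod_cast hy.ne'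
  obtain ⟨c1, c2, c3, c4, c5, c6, c7, c8⟩ := H.coef
  obtain ⟨⟨f1, f2, f3, f4⟩, ⟨g1, g2, g3, g4, g5, g6⟩, hw0, hX0, hd0, ha0⟩ := S.facts hy
  obtain ⟨t1, t2, t3, t4, hm0⟩ := S.tests H.hZ0 H.hZ10
  have hK := H.hK
  have hFm : 0 ≤ Fm := (norm_nonneg _).trans hF3
  have hT3 : ‖(Complex.I * (s*G*Z1* cj a0) : ℂ)‖ ≤ K*m := by
    have h1 : Z1*‖a0‖ ≤ m := by have := mul_nonneg H.hZ0 (norm_nonneg a1); linarith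
    simp only [norm_mul, Complex.norm_real, Real.norm_eq_abs, abs_of_nonneg H.hZ10,
      RCLike.norm_conj, Complex.norm_I, hs, one_mul]
    have h0 := H.hZ10
    have := H.hG
    calc |G| * Z1 * ‖a0‖ = |G| * (Z1*‖a0‖) := by ring
        _ ≤ _ := by gcongr
  rw [← hsk]
  refine re_extract (id_V s (a0/y) y (by field_simp) e3) ?_
  refine (ns (na (na (eb (abs1 hs c4) (nI f2) g5) (eb (abs1 hs c5) (nI f2) g1))
    (eb (abs1 hs c5) (nI f4) g3)) (eb' hF3 hT3)).trans ?_
  have k1 : K ≤ K^4 := le_self_pow₀ hK (by norm_num)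
  have r : 0 ≤ Fm * m := by positivity
  have r2 : K*(Fm*m) ≤ K^4*(Fm*m) := by gcongr
  have r3 : 0 ≤ K^4*(Fm*m) := by positivity
  have r4 : 0 ≤ K^4*(ε*(1+M))*(d*a) := by have := H.hε; have := H.hM; positivity
  linarith

/-- size of second-order terms -/
def D2 (k : ℝ) (a0 a1 a2 b0 b1 b2 : ℂ) : ℝ :=
  (‖a2‖^2+2*k^2*‖a1‖^2+k^4*‖a0‖^2) + (‖b2‖^2+2*k^2*‖b1‖^2+k^4*‖b0‖^2)

lemma ebs {t T : ℝ} {x z : ℂ} (ht : |t| ≤ T) :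
    ‖(t:ℂ) * (x * cj z)‖ ≤ T * ((‖x‖^2 + ‖z‖^2)/2) := by
  refine (eb ht le_rfl le_rfl).trans ?_
  have : 0 ≤ T := (abs_nonneg _).trans ht
  have : ‖x‖*‖z‖ ≤ (‖x‖^2+‖z‖^2)/2 := by nlinarith [sq_nonneg (‖x‖-‖z‖)]
  gcongr

lemma nk (x : ℂ) : ‖(k:ℂ)*x‖^2 = k^2*‖x‖^2 := by
  rw [norm_mul, mul_pow, Complex.norm_real, Real.norm_eq_abs, sq_abs]
lemma nk2 (x : ℂ) : ‖(k:ℂ)^2*x‖^2 = k^4*‖x‖^2 := by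
  rw [norm_mul, mul_pow, norm_pow, Complex.norm_real, Real.norm_eq_abs, sq_abs]; ring
lemma nIe (x : ℂ) : ‖Complex.I * x‖ = ‖x‖ := by simp

lemma bd_U (hs : |s| = 1) (hsk : s*k = |k|) (H : Pt ε μ κ c Us Us1 G G1 Z Z1 Z2 y M K)
  (S : Sz k y Z Z1 a0 a1 a2 b0 b1 b2 w X d a m)
  (hF3 : ‖F3‖ ≤ Fm) (hF4 : ‖F4‖ ≤ Fm)
  (e3 : -Complex.I*k*a1 - (κ*ε)*(b3 - k^2*b1) = F3)
  (e4 : -Complex.I*k*(-Complex.I*k*a0) - (κ*ε)*(-Complex.I*k*b2 - k^2*(-Complex.I*k*b0)) = F4) :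
  |k| * Z * (‖a1‖^2 + k^2*‖a0‖^2)
   ≤ (dU s k ε κ Z Z1 a0 a1 a2 b1 b2 b3).re
     + (20*K^4*(ε*(1+M)*(d*a) + Fm*m) + K*(ε*Z*D2 k a0 a1 a2 b0 b1 b2)) := by
  have hy := H.hy
  have hyC : (y:ℂ) ≠ 0 := by exact_mod_cast hy.ne'
  obtain ⟨c1, c2, c3, c4, c5, c6, c7, c8⟩ := H.coef
  obtain ⟨⟨f1, f2, f3, f4⟩, ⟨g1, g2, g3, g4, g5, g6⟩, hw0, hX0, hd0, ha0⟩ := S.facts hy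
  obtain ⟨t1, t2, t3, t4, hm0⟩ := S.tests H.hZ0 H.hZ10
  have hK := H.hK
  have hZ0 := H.hZ0
  have hFm : 0 ≤ Fm := (norm_nonneg _).trans hF3
  have hT3 : ‖(Complex.I * (s*Z* cj a1) : ℂ)‖ ≤ m := by
    have h1 : Z*‖a1‖ ≤ m := by have := mul_nonneg H.hZ10 (norm_nonneg a0); linarith
    simpa [abs_of_nonneg hZ0, hs] using h1
  have hT4 : ‖(Complex.I * (s*Z*(Complex.I*k* cj a0)) : ℂ)‖ ≤ m := by
    simpa [abs_of_nonneg hZ0, hs] using t2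
  have c9 : |κ*ε*Z| ≤ K*(ε*Z) := by
    rw [abs_mul, abs_mul, abs_of_nonneg hZ0, abs_of_nonneg H.hε, mul_assoc]
    have := H.hκ; have := H.hε; gcongr
  rw [← hsk]
  refine re_extract (id_U s e3 e4) ?_
  refine (ns (ns (na (na (na (na (eb (abs1 hs c8) (nI f2) g1) (eb (abs1 hs c8) (nI f4) g3))
    (ebs (abs1 hs c9))) (ebs (ab2 (abs1 hs c9)))) (ebs (abs1 hs c9))) (eb' hF3 hT3)) (eb' hF4 hT4)).trans ?_
  simp only [nIe, nk, nk2, D2]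
  have k1 : 1 ≤ K^4 := one_le_pow₀ hK
  have r : 0 ≤ Fm * m := by positivity
  have r2 : 1*(Fm*m) ≤ K^4*(Fm*m) := by gcongr
  have r4 : 0 ≤ K^4*(ε*(1+M))*(d*a) := by have := H.hε; have := H.hM; positivity
  have hE := H.hε
  have z1 : 0 ≤ K*(ε*Z)*‖b2‖^2 := by positivity
  have z2 : 0 ≤ K*(ε*Z)*‖a2‖^2 := by positivity
  have z3 : 0 ≤ K*(ε*Z)*(k^4*‖b0‖^2) := by positivity
  have z4 : 0 ≤ K*(ε*Z)*(k^4*‖a0‖^2) := by positivity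
  have z5 : 0 ≤ K*(ε*Z)*(k^2*‖a1‖^2) := by positivity
  have z6 : 0 ≤ K*(ε*Z)*(k^2*‖b1‖^2) := by positivity
  linarith

lemma bd_H (hs : |s| = 1) (hsk : s*k = |k|) (H : Pt ε μ κ c Us Us1 G G1 Z Z1 Z2 y M K)
  (S : Sz k y Z Z1 a0 a1 a2 b0 b1 b2 w X d a m)
  (hF1 : ‖F1‖ ≤ Fm) (hF2 : ‖F2‖ ≤ Fm) (hF3 : ‖F3‖ ≤ Fm)
  (e1 : Complex.I*k*(c*Us*a1 - G*b1) + Complex.I*k*p - (μ*ε)*(a3 - k^2*a1) = F1)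
  (e2 : Complex.I*k*(c*Us*(-Complex.I*k*a0) - G*(-Complex.I*k*b0)) + p1
      - (μ*ε)*(-Complex.I*k*a2 - k^2*(-Complex.I*k*a0)) = F2)
  (e3 : -Complex.I*k*a1 - (κ*ε)*(b3 - k^2*b1) = F3) :
  |k| * G * Z * (‖b1‖^2 + k^2*‖b0‖^2) + |k|/2 * (-(G1*Z1+G*Z2)) * ‖b0‖^2
   ≤ (dH s k ε μ κ c Us Us1 G G1 Z Z1 Z2 a1 a2 a3 b0 b1 b2 b3 p p1).re
     + (20*K^4*(ε*(1+M)*(d*a) + Fm*m) + K*(ε*Z*D2 k a0 a1 a2 b0 b1 b2)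
        + |k| * (K^2*Z)*(‖a1‖*‖b1‖ + k^2*(‖a0‖*‖b0‖))) := by
  have hy := H.hy
  have hyC : (y:ℂ) ≠ 0 := by exact_mod_cast hy.ne'
  obtain ⟨c1, c2, c3, c4, c5, c6, c7, c8⟩ := H.coef
  obtain ⟨⟨f1, f2, f3, f4⟩, ⟨g1, g2, g3, g4, g5, g6⟩, hw0, hX0, hd0, ha0⟩ := S.facts hy
  obtain ⟨t1, t2, t3, t4, hm0⟩ := S.tests H.hZ0 H.hZ10
  have hK := H.hK
  have hZ0 := H.hZ0
  have hZ10 := H.hZ10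
  have hFm : 0 ≤ Fm := (norm_nonneg _).trans hF3
  have hcU : |c| * |Us| ≤ K^2 := by
        rw [← abs_mul, sq]; exact abm H.hc H.hUs
  have hb : Z*‖b1‖+Z1*‖b0‖ ≤ m := by
    have := mul_nonneg hZ10 (norm_nonneg a0)
    linarith
  have hT1 : ‖(Complex.I*(s*(Z * cj b1 + Z1 * cj b0)) : ℂ)‖ ≤ m := by
    rw [nIe, norm_mul, Complex.norm_real, Real.norm_eq_abs, hs, one_mul]
    refine (norm_add_le _ _).trans ?_
    simpa [abs_of_nonneg H.hZ0, abs_of_nonneg H.hZ10] using hb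
  have hT2 : ‖(Complex.I*(s*(Z * (Complex.I * k * cj b0))) : ℂ)‖ ≤ m := by
    simpa [abs_of_nonneg hZ0, hs] using t4
  have hT3 : ‖(Complex.I*(s*(c*Us*Z1* cj b0)) : ℂ)‖ ≤ K^2*m := by
    have h1 : Z1*‖b0‖ ≤ m := by have := mul_nonneg H.hZ0 (norm_nonneg b1); linarith
    simp only [norm_mul, Complex.norm_real, Real.norm_eq_abs, abs_of_nonneg H.hZ10,
      RCLike.norm_conj, Complex.norm_I, hs, one_mul]
    calc |c| * |Us| * Z1 * ‖b0‖ = (|c| * |Us|) * (Z1*‖b0‖) := by ring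
        _ ≤ _ := by gcongr
  have c9 : |μ*ε*Z| ≤ K*(ε*Z) := by
    rw [abs_mul, abs_mul, abs_of_nonneg hZ0, abs_of_nonneg H.hε, mul_assoc]
    have := H.hμ; have := H.hε; gcongr
  have c10 : |-(s*k*(c*Us*Z))| ≤ |k| * (K^2*Z) := by
    rw [abs_neg, hsk, abs_mul, abs_abs, abs_mul, abs_mul, abs_of_nonneg hZ0]
    gcongr
  rw [← hsk] at c10 ⊢
  refine re_extract (id_H s (b0/y) y (by field_simp) e1 e2 e3) ?_
  refine (ns (ns (ns (na (na (na (na (na (na (na (na (na (na 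
    (eb (ab2 (abs1 hs c1)) (nI f1) g2) (eb (ab2 (abs1 hs c1)) (nI f3) g4))
    (eb (abs1 hs c2) (nI f1) g6)) (eb (abs1 hs c6) (nI f2) g6)) (eb (abs1 hs c7) (nI f2) g2))
    (eb (abs1 hs c7) (nI f4) g4))
    (ebs (abs1 hs c9))) (ebs (ab2 (abs1 hs c9)))) (ebs (abs1 hs c9)))
    (eb c10 le_rfl le_rfl)) (eb c10 le_rfl le_rfl))
    (eb' hF1 hT1)) (eb' hF2 hT2)) (eb' hF3 hT3)).trans ?_
  have q : ‖(k:ℂ)*a0‖*‖(k:ℂ)*b0‖ = k^2*(‖a0‖*‖b0‖) := by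
    simp only [norm_mul, Complex.norm_real, Real.norm_eq_abs, ← sq_abs k]; ring
  simp only [q, nIe, nk, nk2, D2]
  have k1 : 1 ≤ K^4 := one_le_pow₀ hK
  have k2 : K^2 ≤ K^4 := pow_le_pow_right₀ hK (by norm_num)
  have r : 0 ≤ Fm * m := by positivity
  have r2 : 1*(Fm*m) ≤ K^4*(Fm*m) := by gcongr
  have r3 : K^2*(Fm*m) ≤ K^4*(Fm*m) := by gcongr
  have r4 : 0 ≤ K^4*(ε*(1+M))*(d*a) := by have := H.hε; have := H.hM; positivity
  have hE := H.hε
  have z1 : 0 ≤ K*(ε*Z)*‖b2‖^2 := by positivity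
  have z2 : 0 ≤ K*(ε*Z)*‖a2‖^2 := by positivity
  have z3 : 0 ≤ K*(ε*Z)*(k^4*‖b0‖^2) := by positivity
  have z4 : 0 ≤ K*(ε*Z)*(k^4*‖a0‖^2) := by positivity
  have z5 : 0 ≤ K*(ε*Z)*(k^2*‖a1‖^2) := by positivity
  have z6 : 0 ≤ K*(ε*Z)*(k^2*‖b1‖^2) := by positivity
  linarith


lemma bd_0 {se : ℝ} (H : Pt ε μ κ c Us Us1 G G1 Z Z1 Z2 y M K) (hse : 0 ≤ se)
  (hG1 : |ε * G1| ≤ K * (se * M))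
  (S : Sz k y Z Z1 a0 a1 a2 b0 b1 b2 w X d a m)
  (hF1 : ‖F1‖ ≤ Fm) (hF2 : ‖F2‖ ≤ Fm) (hF3 : ‖F3‖ ≤ Fm) (hF4 : ‖F4‖ ≤ Fm)
  (e1 : Complex.I*k*(c*Us*a1 - G*b1) + Complex.I*k*p - (μ*ε)*(a3 - k^2*a1) = F1)
  (e2 : Complex.I*k*(c*Us*(-Complex.I*k*a0) - G*(-Complex.I*k*b0)) + p1
      - (μ*ε)*(-Complex.I*k*a2 - k^2*(-Complex.I*k*a0)) = F2)
  (e3 : -Complex.I*k*a1 - (κ*ε)*(b3 - k^2*b1) = F3)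
  (e4 : -Complex.I*k*(-Complex.I*k*a0) - (κ*ε)*(-Complex.I*k*b2 - k^2*(-Complex.I*k*b0)) = F4) :
  ε*(μ*(‖a2‖^2+2*k^2*‖a1‖^2+k^4*‖a0‖^2) + κ*G*(‖b2‖^2+2*k^2*‖b1‖^2+k^4*‖b0‖^2))
   ≤ (d0 k ε μ κ G G1 a0 a1 a2 a3 b0 b1 b2 b3 p p1).re
     + 4*K^2*(se*M*(d*w) + Fm*w) := by
  have hy := H.hy
  obtain ⟨⟨f1, f2, f3, f4⟩, ⟨g1, g2, g3, g4, g5, g6⟩, hw0, hX0, hd0, ha0⟩ := S.facts hy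
  have hK := H.hK
  have hFm : 0 ≤ Fm := (norm_nonneg _).trans hF1
  have hw := S.hw
  have n1 := norm_nonneg a1
  have n2 := norm_nonneg b1
  have n3 : 0 ≤ |k| * ‖a0‖ := by positivity
  have n4 : 0 ≤ |k| * ‖b0‖ := by positivity
  have hT1 : ‖cj a1‖ ≤ w := by rw [RCLike.norm_conj]; linarith
  have hT2 : ‖Complex.I * k * cj a0‖ ≤ w := by simp; linarith
  have hB1 : ‖b1‖ ≤ w := by linarith
  have hB0 : ‖(k:ℂ)*b0‖ ≤ w := by simp; linarith
  have hT3 : ‖G * cj b1‖ ≤ K*w := by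
    refine eb' (by simpa using H.hG) ?_
    simpa using hB1
  have hT4 : ‖G*(Complex.I*k* cj b0)‖ ≤ K*w := by
    refine eb' (by simpa using H.hG) ?_
    simpa using hB0
  have c1 : |κ*ε*G1| ≤ K^2*(se*M) := by
    rw [mul_assoc]
    refine (abm H.hκ hG1).trans ?_
    linarith
  refine re_extract (id_0 e1 e2 e3 e4) ?_
  refine (ns (ns (ns (ns (na (eb c1 f2 hB1) (eb c1 f4 hB0)) (eb' hF1 hT1)) (eb' hF2 hT2))
    (eb' hF3 hT3)) (eb' hF4 hT4)).trans ?_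
  have k1 : K ≤ K^2 := le_self_pow₀ hK (by norm_num)
  have k0 : 1 ≤ K^2 := one_le_pow₀ hK
  have r : 0 ≤ Fm * w := by positivity
  have r1 : Fm*w ≤ K^2*(Fm*w) := le_mul_of_one_le_left r k0
  have r2 : K*(Fm*w) ≤ K^2*(Fm*w) := by gcongr
  have r4 : 0 ≤ K^2*(se*M)*(d*w) := by have := H.hM; positivity
  linarith

lemma aux_w {x z X0 Z0 : ℝ} (hw : w = x+z+|k| * (X0+Z0)) :
    w^2 ≤ 4*(x^2+k^2*X0^2+(z^2+k^2*Z0^2)) := by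
  rw [← sq_abs k, hw]
  nlinarith [sq_nonneg (x-z), sq_nonneg (|k| * X0 - |k| * Z0), sq_nonneg (x+z-|k| * X0 - |k| * Z0)]

lemma aux_A {N1 N2 A α β : ℝ} (hk0 : 0 ≤ |k|) (hN10 : 0 ≤ N1) (hN20 : 0 ≤ N2) (hN2 : N1^2 ≤ N2)
    (hK : 1 ≤ K) (hM : 0 ≤ M) (hε : 0 ≤ ε) (hy : 0 < y) (qa0 : 0 ≤ α) (qb0 : 0 ≤ β) (ha0 : 0 ≤ a)
    (hX : X = α+β) (h3 : |k| * X ≤ a) (hXy : X/y ≤ a)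
    (hA : 0 ≤ -A ∨ (A ≤ K*(M*ε) ∧ y ≤ 2)) :
    N1*(|k| * |A| * (α*β)) ≤ N2*(|k|/2 * (-A) * α^2) + |k|/2 * (-A) * β^2
      + 2*(N2+1)*K*(M*ε*a^2) := by
  have hX0 : 0 ≤ X := by linarith
  have hab : N1*(α*β) ≤ N2*(α^2)/2 + β^2/2 := by
    have h1 := mul_le_mul_of_nonneg_right hN2 (sq_nonneg α)
    have h2 := sq_nonneg (N1*α-β)
    linarith
  have hr : 0 ≤ 2*(N2+1)*K*(M*ε*a^2) := by positivity
  by_cases hA' : 0 ≤ -A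
  · have : |A| = -A := by rw [abs_of_nonpos (by linarith)]
    rw [this]
    have := mul_le_mul_of_nonneg_left hab (mul_nonneg hk0 hA')
    linarith
  · obtain ⟨hA, hy2⟩ := hA.resolve_left hA'
    push Not at hA'
    have h1 : |A| = A := by rw [abs_of_nonneg (by linarith)]
    rw [h1]
    have h2 : N2*(α^2)/2 + β^2/2 + N1*(α*β) ≤ (N2+1)*X^2 := by
      have e1 : N2*α^2+β^2 ≤ (N2+1)*X^2 := by
        rw [hX]
        have t1 := mul_nonneg hN20 (sq_nonneg β)
        have t2 := mul_nonneg hN20 (mul_nonneg qa0 qb0)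
        have t3 := mul_nonneg qa0 qb0
        have t4 := sq_nonneg α
        linarith
      linarith
    have h4 : X ≤ 2*a := by
      have h6 : X = y*(X/y) := by field_simp
      have h5 : 0 ≤ X/y := by positivity
      have : y*(X/y) ≤ 2*(X/y) := by gcongr
      linarith
    have h5 : |k| * X^2 ≤ 2*a^2 := by
      calc |k| * X^2 = (|k| * X)*X := by ring
        _ ≤ a * (2*a) := by gcongr
        _ = _ := by ring
    have h6 : A*(|k| * X^2) ≤ K*(M*ε)*(2*a^2) := by
      have : 0 ≤ A := by linarith
      gcongr
    have h7 := mul_le_mul_of_nonneg_left h2 (mul_nonneg hk0 (by linarith : 0 ≤ A))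
    have h8 := mul_le_mul_of_nonneg_left h6 (by linarith : 0 ≤ N2+1)
    linarith

/-- the combined pointwise inequality -/
lemma bd_tot {c₀ N1 N2 N3 : ℝ} (hs : |s| = 1) (hsk : s*k = |k|)
  (H : Pt ε μ κ c Us Us1 G G1 Z Z1 Z2 y M K)
  (hc0 : 0 < c₀) (hμc : c₀ ≤ μ) (hκc : c₀ ≤ κ * G) (hGc : c₀ ≤ G)
  (hN3 : K^4/(2*c₀) + c₀/2 ≤ N3) (hN1 : (N3+1)*K ≤ N1*c₀) (hN10 : 0 ≤ N1) (hN2 : N1^2 ≤ N2)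
  (hA : 0 ≤ -(G1*Z1+G*Z2) ∨ (G1*Z1+G*Z2 ≤ K*(M*ε) ∧ y ≤ 2))
  (S : Sz k y Z Z1 a0 a1 a2 b0 b1 b2 w X d a m)
  (hF1 : ‖F1‖ ≤ Fm) (hF2 : ‖F2‖ ≤ Fm) (hF3 : ‖F3‖ ≤ Fm) (hF4 : ‖F4‖ ≤ Fm)
  (e1 : Complex.I*k*(c*Us*a1 - G*b1) + Complex.I*k*p - (μ*ε)*(a3 - k^2*a1) = F1)
  (e2 : Complex.I*k*(c*Us*(-Complex.I*k*a0) - G*(-Complex.I*k*b0)) + p1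
      - (μ*ε)*(-Complex.I*k*a2 - k^2*(-Complex.I*k*a0)) = F2)
  (e3 : -Complex.I*k*a1 - (κ*ε)*(b3 - k^2*b1) = F3)
  (e4 : -Complex.I*k*(-Complex.I*k*a0) - (κ*ε)*(-Complex.I*k*b2 - k^2*(-Complex.I*k*b0)) = F4) :
  c₀/8*(|k| * (Z*w^2)) ≤
    (N1 * (dW k ε μ κ c Us Us1 G G1 Z Z1 Z2 a0 a1 a2 a3 b0 b1 b2 b3 p p1).re
      + N2 * (dV s k ε κ G G1 Z1 Z2 a0 a1 b2 b3).re
      + N3 * (dU s k ε κ Z Z1 a0 a1 a2 b1 b2 b3).re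
      + (dH s k ε μ κ c Us Us1 G G1 Z Z1 Z2 a1 a2 a3 b0 b1 b2 b3 p p1).re)
    + ((N1+N2+N3+1)*(20*K^4)*(ε*(1+M)*(d*a) + Fm*m) + 2*(N2+1)*K*(M*ε*a^2)) := by
  have hW := bd_W H S hF1 hF2 hF3 hF4 e1 e2 e3 e4
  have hV := bd_V hs hsk H S hF3 e3
  have hU := bd_U hs hsk H S hF3 hF4 e3 e4
  have hH := bd_H hs hsk H S hF1 hF2 hF3 e1 e2 e3
  have hK := H.hK
  have hε := H.hε
  have hM := H.hM
  have hy := H.hy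
  have hZ0 := H.hZ0
  obtain ⟨_, _, hw0, hX0, hd0, ha0⟩ := S.facts hy
  have hN30 : 0 ≤ N3 := le_trans (by positivity) hN3
  have hN20 : 0 ≤ N2 := le_trans (by positivity) hN2
  have hw := S.hw
  have hX := S.hX
  have haE := S.ha
  set β := ε*(1+M)*(d*a) + Fm*m
  set A := G1*Z1+G*Z2
  have qa0 := norm_nonneg a0
  have qb0 := norm_nonneg b0
  have qa1 := norm_nonneg a1
  have qb1 := norm_nonneg b1
  have hk0 := abs_nonneg k
  -- W lower bound
  have hW' : c₀*(ε*Z*D2 k a0 a1 a2 b0 b1 b2) ≤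
      ε*Z*(μ*(‖a2‖^2+2*k^2*‖a1‖^2+k^4*‖a0‖^2) + κ*G*(‖b2‖^2+2*k^2*‖b1‖^2+k^4*‖b0‖^2)) := by
    have hh : c₀ * D2 k a0 a1 a2 b0 b1 b2 ≤ 
       μ*(‖a2‖^2+2*k^2*‖a1‖^2+k^4*‖a0‖^2) + κ*G*(‖b2‖^2+2*k^2*‖b1‖^2+k^4*‖b0‖^2) := by
      unfold D2
      have : c₀*(‖a2‖^2+2*k^2*‖a1‖^2+k^4*‖a0‖^2) ≤ μ*(‖a2‖^2+2*k^2*‖a1‖^2+k^4*‖a0‖^2) := by gcongr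
      have : c₀*(‖b2‖^2+2*k^2*‖b1‖^2+k^4*‖b0‖^2) ≤ κ*G*(‖b2‖^2+2*k^2*‖b1‖^2+k^4*‖b0‖^2) := by gcongr
      linarith
    calc _ = ε*Z*(c₀ * D2 k a0 a1 a2 b0 b1 b2) := by ring
      _ ≤ _ := by gcongr
  have hD : 0 ≤ ε*Z*D2 k a0 a1 a2 b0 b1 b2 := by unfold D2; positivity
  have hD1 : (N3+1)*K*(ε*Z*D2 k a0 a1 a2 b0 b1 b2) ≤ N1*c₀*(ε*Z*D2 k a0 a1 a2 b0 b1 b2) := by gcongr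
  -- A terms
  have hAA := aux_A (A := A) (ε := ε) hk0 hN10 hN20 hN2 hK hM hε hy qa0 qb0 ha0 hX
    (by have : 0 ≤ X/y := by positivity
        rw [hX] at *; linarith) (by linarith) hA
  -- Young term
  have hY : ∀ x z : ℝ, K^2*(x*z) ≤ (N3-c₀/2)*x^2 + c₀/2*z^2 := by
    intro x z
    have h1 : K^4/(2*c₀)*x^2 ≤ (N3-c₀/2)*x^2 := by gcongr; linarith
    have h2 : K^4/(2*c₀)*x^2 + c₀/2*z^2 - K^2*(x*z) = (K^2*x-c₀*z)^2/(2*c₀) := by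
      field_simp; ring
    have h3 : 0 ≤ (K^2*x-c₀*z)^2/(2*c₀) := by positivity
    linarith
  have hYY : |k| * (K^2*Z)*(‖a1‖*‖b1‖ + k^2*(‖a0‖*‖b0‖)) ≤
     (N3-c₀/2)*(|k| * Z*(‖a1‖^2+k^2*‖a0‖^2)) + c₀/2*(|k| * Z*(‖b1‖^2+k^2*‖b0‖^2)) := by
    have h1 := mul_le_mul_of_nonneg_left (hY ‖a1‖ ‖b1‖) (mul_nonneg hk0 hZ0)
    have h2 := mul_le_mul_of_nonneg_left (hY ‖a0‖ ‖b0‖) (mul_nonneg (mul_nonneg hk0 hZ0) (sq_nonneg k))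
    linarith
  have hG' : c₀*(|k| * Z*(‖b1‖^2+k^2*‖b0‖^2)) ≤ |k| * G*Z*(‖b1‖^2+k^2*‖b0‖^2) := by
    have := mul_le_mul_of_nonneg_right hGc (by positivity : 0 ≤ |k| * Z*(‖b1‖^2+k^2*‖b0‖^2))
    linarith
  have hww := aux_w (k := k) hw
  have hww' := mul_le_mul_of_nonneg_left hww (by positivity : 0 ≤ c₀/8*(|k| * Z))
  have h1 := mul_le_mul_of_nonneg_left hW hN10
  have h1' := mul_le_mul_of_nonneg_left hW' hN10
  have h2 := mul_le_mul_of_nonneg_left hV hN20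
  have h3 := mul_le_mul_of_nonneg_left hU hN30
  linarith

end bounds


/-- product-type flux term -/
def tm (t : ℝ → ℝ) (x z : ℝ → ℂ) : ℝ → ℂ := fun y => (t y : ℂ) * (x y * cj (z y))

lemma tm_deriv {t : ℝ → ℝ} {x z : ℝ → ℂ} {t' y : ℝ} {x' z' : ℂ} (ht : HasDerivAt t t' y)
    (hx : HasDerivAt x x' y) (hz : HasDerivAt z z' y) :
    HasDerivAt (tm t x z) ((t' : ℂ) * (x y * cj (z y)) + t y * (x' * cj (z y) + x y * cj z')) y := by
  unfold tm
  exact ht.ofReal_comp.mul (hx.mul hz.star)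

lemma tm_zero {t : ℝ → ℝ} {x z : ℝ → ℂ} {y : ℝ} (h : t y = 0 ∨ x y = 0 ∨ z y = 0) :
    tm t x z y = 0 := by
  unfold tm; rcases h with h | h | h <;> simp [h]

lemma tm_lim {t : ℝ → ℝ} {x z : ℝ → ℂ} {B : ℝ} (ht : ∀ y, 0 < y → |t y| ≤ B)
    (hxz : Tendsto (fun y => ‖x y‖ * ‖z y‖) atTop (nhds 0)) :
    Tendsto (tm t x z) atTop (nhds 0) := by
  refine squeeze_zero_norm' (a := fun y => B * (‖x y‖ * ‖z y‖)) ?_ ?_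
  · filter_upwards [eventually_gt_atTop 0] with y hy
    exact eb (ht y hy) le_rfl le_rfl
  · simpa using hxz.const_mul B

/-- function-level data of the system -/
structure Sys (k ε μ κ c M K : ℝ) (Us Us1 G G1 Z Z1 Z2 : ℝ → ℝ)
    (a0 a1 a2 a3 b0 b1 b2 b3 p p1 : ℝ → ℂ) : Prop where
  dUs : ∀ y, HasDerivAt Us (Us1 y) y
  dG : ∀ y, HasDerivAt G (G1 y) y
  dZ : ∀ y, HasDerivAt Z (Z1 y) y
  dZ1 : ∀ y, HasDerivAt Z1 (Z2 y) y
  da0 : ∀ y, HasDerivAt a0 (a1 y) y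
  da1 : ∀ y, HasDerivAt a1 (a2 y) y
  da2 : ∀ y, HasDerivAt a2 (a3 y) y
  db0 : ∀ y, HasDerivAt b0 (b1 y) y
  db1 : ∀ y, HasDerivAt b1 (b2 y) y
  db2 : ∀ y, HasDerivAt b2 (b3 y) y
  dp : ∀ y, HasDerivAt p (p1 y) y
  pt : ∀ y, 0 < y → Pt ε μ κ c (Us y) (Us1 y) (G y) (G1 y) (Z y) (Z1 y) (Z2 y) y M K
  zK : ∀ y, 0 < y → Z y ≤ K
  za0 : a0 0 = 0
  zb0 : b0 0 = 0
  za1 : a1 0 = 0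
  zb2 : b2 0 = 0
  zZ : Z 0 = 0
  la0 : Tendsto (fun y => ‖a0 y‖) atTop (nhds 0)
  la1 : Tendsto (fun y => ‖a1 y‖) atTop (nhds 0)
  la2 : Tendsto (fun y => ‖a2 y‖) atTop (nhds 0)
  lb0 : Tendsto (fun y => ‖b0 y‖) atTop (nhds 0)
  lb1 : Tendsto (fun y => ‖b1 y‖) atTop (nhds 0)
  lb2 : Tendsto (fun y => ‖b2 y‖) atTop (nhds 0)
  lpa : Tendsto (fun y => ‖p y‖ * ‖a0 y‖) atTop (nhds 0)
  lpb : Tendsto (fun y => ‖p y‖ * ‖b0 y‖) atTop (nhds 0)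

section flux
variable {s k ε μ κ c M K : ℝ} {Us Us1 G G1 Z Z1 Z2 : ℝ → ℝ}
    {a0 a1 a2 a3 b0 b1 b2 b3 p p1 : ℝ → ℂ}

/-- multiplication by the imaginary unit -/
def iM (x : ℝ → ℂ) : ℝ → ℂ := fun y => Complex.I * x y

lemma iM_deriv {x : ℝ → ℂ} {x' : ℂ} {y : ℝ} (h : HasDerivAt x x' y) :
    HasDerivAt (iM x) (Complex.I * x') y := by unfold iM; exact h.const_mul _

lemma iM_norm (x : ℝ → ℂ) (y : ℝ) : ‖iM x y‖ = ‖x y‖ := by simp [iM]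

/-- what we need to know about a flux -/
def Flux (D : ℝ → ℂ) : Prop := ∃ f : ℝ → ℂ, (∀ y, HasDerivAt f (D y) y) ∧ f 0 = 0 ∧
  Tendsto f atTop (nhds 0)

lemma Flux.add {D E : ℝ → ℂ} (hD : Flux D) (hE : Flux E) : Flux (fun y => D y + E y) := by
  obtain ⟨f, h1, h2, h3⟩ := hD
  obtain ⟨g, g1, g2, g3⟩ := hE
  exact ⟨fun y => f y + g y, fun y => (h1 y).add (g1 y), by simp [h2, g2], by simpa using h3.add g3⟩

lemma Flux.smul {D : ℝ → ℂ} (N : ℂ) (hD : Flux D) : Flux (fun y => N * D y) := by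
  obtain ⟨f, h1, h2, h3⟩ := hD
  exact ⟨fun y => N * f y, fun y => (h1 y).const_mul N, by simp [h2], by simpa using h3.const_mul N⟩

lemma Flux.congr {D E : ℝ → ℂ} (hD : Flux D) (h : ∀ y, D y = E y) : Flux E := by
  have : D = E := funext h
  rwa [← this]

lemma Flux.tm {t t' : ℝ → ℝ} {x z x' z' : ℝ → ℂ} {B : ℝ} (ht : ∀ y, HasDerivAt t (t' y) y)
    (hx : ∀ y, HasDerivAt x (x' y) y) (hz : ∀ y, HasDerivAt z (z' y) y)
    (h0 : t 0 = 0 ∨ x 0 = 0 ∨ z 0 = 0) (hB : ∀ y, 0 < y → |t y| ≤ B)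
    (hl : Tendsto (fun y => ‖x y‖ * ‖z y‖) atTop (nhds 0)) :
    Flux (fun y => ((t' y : ℝ) : ℂ) * (x y * cj (z y))
      + t y * (x' y * cj (z y) + x y * cj (z' y))) :=
  ⟨_, fun y => tm_deriv (ht y) (hx y) (hz y), tm_zero h0, tm_lim hB hl⟩

lemma Sys.bds (S : Sys k ε μ κ c M K Us Us1 G G1 Z Z1 Z2 a0 a1 a2 a3 b0 b1 b2 b3 p p1) :
    ∀ y, 0 < y → |Us y| ≤ K ∧ |G y| ≤ K ∧ |Z y| ≤ K ∧ |Z1 y| ≤ K := by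
  intro y hy
  have h := S.pt y hy
  exact ⟨h.hUs, h.hG, by rw [abs_of_nonneg h.hZ0]; exact S.zK y hy,
    by rw [abs_of_nonneg h.hZ10]; exact h.hZ1⟩

lemma mul0 {x z : ℝ → ℝ} (hx : Tendsto x atTop (nhds 0)) (hz : Tendsto z atTop (nhds 0)) :
    Tendsto (fun y => x y * z y) atTop (nhds 0) := by simpa using hx.mul hz

lemma Sys.flux_W (S : Sys k ε μ κ c M K Us Us1 G G1 Z Z1 Z2 a0 a1 a2 a3 b0 b1 b2 b3 p p1) :
    Flux (fun y => dW k ε μ κ c (Us y) (Us1 y) (G y) (G1 y) (Z y) (Z1 y) (Z2 y)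
      (a0 y) (a1 y) (a2 y) (a3 y) (b0 y) (b1 y) (b2 y) (b3 y) (p y) (p1 y)) := by
  have B := S.bds
  have t1 := Flux.tm (fun y => (S.dZ y).const_mul (μ*ε)) S.da2 S.da1 (by simp [S.zZ])
    (fun y hy => abm le_rfl (B y hy).2.2.1) (mul0 S.la2 S.la1)
  have t2 := Flux.tm (fun y => (S.dZ y).const_mul (μ*ε*k^2)) S.da1 S.da0 (by simp [S.zZ])
    (fun y hy => abm le_rfl (B y hy).2.2.1) (mul0 S.la1 S.la0)
  have t3 := Flux.tm (fun y => (S.dZ1 y).const_mul (μ*ε)) S.da2 S.da0 (by simp [S.za0])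
    (fun y hy => abm le_rfl (B y hy).2.2.2) (mul0 S.la2 S.la0)
  have t4 := Flux.tm (fun y => (S.dZ y).const_mul (-k)) (fun y => iM_deriv (S.dp y)) S.da0 (by simp [S.zZ])
    (fun y hy => abm le_rfl (B y hy).2.2.1) (by simpa only [iM_norm] using S.lpa)
  have t5 := Flux.tm (fun y => ((S.dZ y).mul (S.dG y)).const_mul (κ*ε)) S.db2 S.db1 (by simp [S.zZ])
    (fun y hy => abm le_rfl (abm (B y hy).2.2.1 (B y hy).2.1)) (mul0 S.lb2 S.lb1)
  have t6 := Flux.tm (fun y => ((S.dZ y).mul (S.dG y)).const_mul (κ*ε*k^2)) S.db1 S.db0 (by simp [S.zZ])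
    (fun y hy => abm le_rfl (abm (B y hy).2.2.1 (B y hy).2.1)) (mul0 S.lb1 S.lb0)
  have t7 := Flux.tm (fun y => ((S.dG y).mul (S.dZ1 y)).const_mul (-(κ*ε))) S.db2 S.db0 (by simp [S.zb0])
    (fun y hy => abm le_rfl (abm (B y hy).2.1 (B y hy).2.2.2)) (mul0 S.lb2 S.lb0)
  have t8 := Flux.tm (fun y => ((S.dUs y).mul (S.dZ1 y)).const_mul (κ*ε*c)) S.db2 S.da0 (by simp [S.za0])
    (fun y hy => abm le_rfl (abm (B y hy).1 (B y hy).2.2.2)) (mul0 S.lb2 S.la0)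
  have t9 := Flux.tm (fun y => ((S.dG y).mul (S.dZ1 y)).const_mul k) (fun y => iM_deriv (S.db0 y)) S.da0
    (by simp [S.za0])
    (fun y hy => abm le_rfl (abm (B y hy).2.1 (B y hy).2.2.2))
    (by simpa only [iM_norm] using mul0 S.lb0 S.la0)
  refine ((((((((t1.add t2).add t3).add t4).add t5).add t6).add t7).add t8).add t9).congr ?_
  intro y
  simp only [dW, iM, Pi.mul_apply]
  push_cast
  ring

lemma Sys.flux_V (S : Sys k ε μ κ c M K Us Us1 G G1 Z Z1 Z2 a0 a1 a2 a3 b0 b1 b2 b3 p p1) :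
    Flux (fun y => dV s k ε κ (G y) (G1 y) (Z1 y) (Z2 y) (a0 y) (a1 y) (b2 y) (b3 y)) := by
  have B := S.bds
  have t1 := Flux.tm (fun y => ((S.dG y).mul (S.dZ1 y)).const_mul (s*(κ*ε))) (fun y => iM_deriv (S.db2 y)) S.da0
    (by simp [S.za0])
    (fun y hy => abm le_rfl (abm (B y hy).2.1 (B y hy).2.2.2))
    (by simpa only [iM_norm] using mul0 S.lb2 S.la0)
  have t2 := Flux.tm (fun y => ((S.dG y).mul (S.dZ1 y)).const_mul (-(s*k/2))) S.da0 S.da0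
    (by simp [S.za0])
    (fun y hy => abm le_rfl (abm (B y hy).2.1 (B y hy).2.2.2))
    (by simpa only [iM_norm] using mul0 S.la0 S.la0)
  refine (t1.add t2).congr ?_
  intro y
  simp only [dV, iM, Pi.mul_apply]
  push_cast
  ring

lemma Sys.flux_U (S : Sys k ε μ κ c M K Us Us1 G G1 Z Z1 Z2 a0 a1 a2 a3 b0 b1 b2 b3 p p1) :
    Flux (fun y => dU s k ε κ (Z y) (Z1 y) (a0 y) (a1 y) (a2 y) (b1 y) (b2 y) (b3 y)) := by
  have B := S.bds
  have t1 := Flux.tm (fun y => (S.dZ y).const_mul (s*(κ*ε))) (fun y => iM_deriv (S.db2 y)) S.da1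
    (by simp [S.zZ])
    (fun y hy => abm le_rfl (B y hy).2.2.1)
    (by simpa only [iM_norm] using mul0 S.lb2 S.la1)
  have t2 := Flux.tm (fun y => (S.dZ y).const_mul (s*(κ*ε)*k^2)) (fun y => iM_deriv (S.db1 y)) S.da0
    (by simp [S.zZ])
    (fun y hy => abm le_rfl (B y hy).2.2.1)
    (by simpa only [iM_norm] using mul0 S.lb1 S.la0)
  refine (t1.add t2).congr ?_
  intro y
  simp only [dU, iM]
  push_cast
  ring

lemma Sys.flux_H (S : Sys k ε μ κ c M K Us Us1 G G1 Z Z1 Z2 a0 a1 a2 a3 b0 b1 b2 b3 p p1) :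
    Flux (fun y => dH s k ε μ κ c (Us y) (Us1 y) (G y) (G1 y) (Z y) (Z1 y) (Z2 y)
      (a1 y) (a2 y) (a3 y) (b0 y) (b1 y) (b2 y) (b3 y) (p y) (p1 y)) := by
  have B := S.bds
  have t1 := Flux.tm (fun y => (S.dZ y).const_mul (s*(μ*ε))) (fun y => iM_deriv (S.da2 y)) S.db1 (by simp [S.zZ])
    (fun y hy => abm le_rfl (B y hy).2.2.1) (by simpa only [iM_norm] using mul0 S.la2 S.lb1)
  have t2 := Flux.tm (fun y => (S.dZ y).const_mul (s*(μ*ε*k^2))) (fun y => iM_deriv (S.da1 y)) S.db0 (by simp [S.zZ])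
    (fun y hy => abm le_rfl (B y hy).2.2.1) (by simpa only [iM_norm] using mul0 S.la1 S.lb0)
  have t3 := Flux.tm (fun y => (S.dZ1 y).const_mul (s*(μ*ε))) (fun y => iM_deriv (S.da2 y)) S.db0 (by simp [S.zb0])
    (fun y hy => abm le_rfl (B y hy).2.2.2) (by simpa only [iM_norm] using mul0 S.la2 S.lb0)
  have t4 := Flux.tm (fun y => (S.dZ y).const_mul (s*k)) S.dp S.db0 (by simp [S.zZ])
    (fun y hy => abm le_rfl (B y hy).2.2.1) S.lpb
  have t5 := Flux.tm (fun y => ((S.dUs y).mul (S.dZ1 y)).const_mul (s*(κ*ε*c))) (fun y => iM_deriv (S.db2 y)) S.db0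
    (by simp [S.zb0])
    (fun y hy => abm le_rfl (abm (B y hy).1 (B y hy).2.2.2)) (by simpa only [iM_norm] using mul0 S.lb2 S.lb0)
  have t6 := Flux.tm (fun y => ((S.dG y).mul (S.dZ1 y)).const_mul (-(s*k/2))) S.db0 S.db0
    (by simp [S.zb0])
    (fun y hy => abm le_rfl (abm (B y hy).2.1 (B y hy).2.2.2))
    (mul0 S.lb0 S.lb0)
  refine (((((t1.add t2).add t3).add t4).add t5).add t6).congr ?_
  intro y
  simp only [dH, iM, Pi.mul_apply]
  push_cast
  linear_combination (s*k*(p1 y * Z y * cj (b0 y) + p y * Z1 y * cj (b0 y) + p y * Z y * cj (b1 y))) * Complex.I_sq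

lemma Sys.flux_0 (S : Sys k ε μ κ c M K Us Us1 G G1 Z Z1 Z2 a0 a1 a2 a3 b0 b1 b2 b3 p p1) :
    Flux (fun y => d0 k ε μ κ (G y) (G1 y)
      (a0 y) (a1 y) (a2 y) (a3 y) (b0 y) (b1 y) (b2 y) (b3 y) (p y) (p1 y)) := by
  have B := S.bds
  have t1 := Flux.tm (fun y => hasDerivAt_const y (μ*ε)) S.da2 S.da1 (by simp [S.za1])
    (fun y hy => le_rfl) (mul0 S.la2 S.la1)
  have t2 := Flux.tm (fun y => hasDerivAt_const y (μ*ε*k^2)) S.da1 S.da0 (by simp [S.za1])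
    (fun y hy => le_rfl) (mul0 S.la1 S.la0)
  have t4 := Flux.tm (fun y => hasDerivAt_const y (-k)) (fun y => iM_deriv (S.dp y)) S.da0 (by simp [S.za0])
    (fun y hy => le_rfl) (by simpa only [iM_norm] using S.lpa)
  have t5 := Flux.tm (fun y => (S.dG y).const_mul (κ*ε)) S.db2 S.db1 (by simp [S.zb2])
    (fun y hy => abm le_rfl (B y hy).2.1) (mul0 S.lb2 S.lb1)
  have t6 := Flux.tm (fun y => (S.dG y).const_mul (κ*ε*k^2)) S.db1 S.db0 (by simp [S.zb0])
    (fun y hy => abm le_rfl (B y hy).2.1) (mul0 S.lb1 S.lb0)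
  refine ((((t1.add t2).add t4).add t5).add t6).congr ?_
  intro y
  simp only [d0, iM]
  push_cast
  ring

end flux

/-- integration of a pointwise inequality with a flux -/
lemma flux_int {D : ℝ → ℂ} (hD : Flux D) {P B : ℝ → ℝ} (hP : IntegrableOn P (Ioi 0))
    (hB : IntegrableOn B (Ioi 0)) (h : ∀ y, 0 < y → P y ≤ (D y).re + B y) :
    ∫ y in Ioi (0:ℝ), P y ≤ ∫ y in Ioi (0:ℝ), B y := by
  obtain ⟨f, h1, h2, h3⟩ := hD
  have hre : ∀ y, HasDerivAt (fun y => (f y).re) (D y).re y := fun y =>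
    (Complex.reCLM.hasFDerivAt.comp_hasDerivAt y (h1 y))
  have hPB : IntegrableOn (fun y => P y - B y) (Ioi 0) := hP.sub hB
  have key : ∀ N : ℝ, 0 ≤ N → ∫ y in (0:ℝ)..N, (P y - B y) ≤ (f N).re := by
    intro N hN
    have := intervalIntegral.integral_le_sub_of_hasDeriv_right_of_le (a := 0) (b := N)
      (g := fun y => (f y).re) (g' := fun y => (D y).re) (φ := fun y => P y - B y) hN
      (fun y _ => (hre y).continuousAt.continuousWithinAt)
      (fun y _ => (hre y).hasDerivWithinAt)
      ((integrableOn_Icc_iff_integrableOn_Ioc (by simp)).2 (hPB.mono_set Ioc_subset_Ioi_self)) (fun y hy => by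
        have := h y hy.1; linarith)
    simpa [h2] using this
  have l1 := intervalIntegral_tendsto_integral_Ioi (μ := volume) 0 hPB tendsto_id
  have l2 : Tendsto (fun N => (f N).re) atTop (nhds 0) := by
    have := (Complex.continuous_re.tendsto 0).comp h3
    simpa [Function.comp_def] using this
  have := le_of_tendsto_of_tendsto l1 l2 (by
    filter_upwards [eventually_ge_atTop 0] with N hN
    exact key N hN)
  rw [integral_sub hP hB] at this
  linarith


/-- Cauchy–Schwarz -/
lemma cs_int {m : Measure ℝ} {f g : ℝ → ℝ} (hf : MemLp f 2 m) (hg : MemLp g 2 m) :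
    ∫ y, f y * g y ∂m ≤ Real.sqrt (∫ y, f y ^ 2 ∂m) * Real.sqrt (∫ y, g y ^ 2 ∂m) := by
  have h := integral_mul_norm_le_Lp_mul_Lq (μ := m) (f := f) (g := g) (p := 2) (q := 2)
    (Real.HolderConjugate.two_two) (by simpa using hf) (by simpa using hg)
  refine (le_trans ?_ h).trans (le_of_eq ?_)
  · refine integral_mono ?_ ?_ ?_
    · exact hf.integrable_mul hg
    · exact hf.norm.integrable_mul hg.norm
    · intro y
      show f y * g y ≤ ‖f y‖ * ‖g y‖
      rw [← norm_mul]; exact le_abs_self _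
  · simp only [Real.sqrt_eq_rpow, Real.norm_eq_abs, Real.rpow_two, sq_abs]

/-- Hardy inequality -/
lemma hardy {f f' : ℝ → ℂ} (hd : ∀ y, HasDerivAt f (f' y) y) (h0 : f 0 = 0) (hc : Continuous f')
    (hi : IntegrableOn (fun y => ‖f' y‖^2) (Ioi 0)) :
    IntegrableOn (fun y => (‖f y‖/y)^2) (Ioi 0) ∧
    ∫ y in Ioi (0:ℝ), (‖f y‖/y)^2 ≤ 4 * ∫ y in Ioi (0:ℝ), ‖f' y‖^2 := by
  have hfc : Continuous f := continuous_iff_continuousAt.2 fun y => (hd y).continuousAt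
  have hbd : ∀ N : ℝ, ∃ C : ℝ, 0 ≤ C ∧ ∀ y ∈ Icc 0 N, ‖f y‖ ≤ C * y := by
    intro N
    obtain ⟨C, hC⟩ := isCompact_Icc.exists_bound_of_continuousOn (s := Icc (0:ℝ) N) hc.continuousOn
    refine ⟨max C 0, le_max_right _ _, fun y hy => ?_⟩
    have := norm_image_sub_le_of_norm_deriv_le_segment' (f := f) (f' := f') (a := 0) (b := N) (C := max C 0)
      (fun x _ => (hd x).hasDerivWithinAt) (fun x hx => (hC x ⟨hx.1, hx.2.le⟩).trans (le_max_left _ _)) y hy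
    simpa [h0] using this
  have hcont : ContinuousOn (fun y => (‖f y‖/y)^2) (Ioi 0) := by
    refine ContinuousOn.pow (ContinuousOn.div (by fun_prop) (by fun_prop) ?_) 2
    intro y hy; exact ne_of_gt hy
  have hloc : ∀ N : ℝ, IntegrableOn (fun y => (‖f y‖/y)^2) (Ioc 0 N) := by
    intro N
    obtain ⟨C, hC0, hC⟩ := hbd N
    refine Integrable.mono' (g := fun _ => C^2) (integrableOn_const (by simp)) 
      ((hcont.mono Ioc_subset_Ioi_self).aestronglyMeasurable measurableSet_Ioc) ?_
    refine (ae_restrict_iff' measurableSet_Ioc).2 (ae_of_all _ fun y hy => ?_)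
    rw [Real.norm_of_nonneg (by positivity)]
    have hy0 : 0 < y := hy.1
    have : ‖f y‖/y ≤ C := by rw [div_le_iff₀ hy0]; exact hC y ⟨hy.1.le, hy.2⟩
    gcongr
  have hsq : ∀ y, HasDerivAt (fun y => ‖f y‖^2) (2 * inner ℝ (f y) (f' y)) y := fun y => (hd y).norm_sq
  have key : ∀ N : ℝ, 0 ≤ N → ∫ y in (0:ℝ)..N, (‖f y‖/y)^2 ≤ 4 * ∫ y in Ioi (0:ℝ), ‖f' y‖^2 := by
    intro N hN
    have hJ : IntegrableOn (fun y => ‖f' y‖^2) (Ioc 0 N) := hi.mono_set Ioc_subset_Ioi_self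
    have hPB : IntegrableOn (fun y => 1/2*(‖f y‖/y)^2 - 2*‖f' y‖^2) (Ioc 0 N) :=
      ((hloc N).const_mul (1/2)).sub (hJ.const_mul 2)
    have h1 := intervalIntegral.integral_le_sub_of_hasDeriv_right_of_le (a := 0) (b := N)
      (g := fun y => -(‖f y‖^2/y)) (g' := fun y => -((2 * inner ℝ (f y) (f' y)*y - ‖f y‖^2*1)/y^2))
      (φ := fun y => 1/2*(‖f y‖/y)^2 - 2*‖f' y‖^2) hN
      ?_ (fun y hy => (((hsq y).div (hasDerivAt_id y) (ne_of_gt hy.1)).neg).hasDerivWithinAt)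
      ((integrableOn_Icc_iff_integrableOn_Ioc enorm_ne_top).2 hPB) ?_
    · rw [intervalIntegral.integral_of_le hN, integral_sub ((hloc N).const_mul (1/2)) (hJ.const_mul 2),
        integral_const_mul, integral_const_mul] at h1
      rw [intervalIntegral.integral_of_le hN]
      have h2 : ∫ y in Ioc (0:ℝ) N, ‖f' y‖^2 ≤ ∫ y in Ioi (0:ℝ), ‖f' y‖^2 :=
        setIntegral_mono_set hi (ae_of_all _ fun y => by positivity) Ioc_subset_Ioi_self.eventuallyLE
      have h3 : 0 ≤ ‖f N‖^2/N := by positivity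
      simp only [h0, norm_zero] at h1
      norm_num at h1
      linarith
    · intro y hy
      rcases hy.1.eq_or_lt with h | h
      · subst h
        obtain ⟨C, hC0, hC⟩ := hbd N
        have : Tendsto (fun y => -(‖f y‖^2/y)) (nhdsWithin 0 (Icc 0 N)) (nhds 0) := by
          refine squeeze_zero_norm' (a := fun y => C^2*y) ?_ ?_
          · filter_upwards [self_mem_nhdsWithin] with y hy
            rw [norm_neg, Real.norm_of_nonneg (div_nonneg (by positivity) hy.1)]
            rcases hy.1.eq_or_lt with h | h
            · subst h; simp
            · rw [div_le_iff₀ h]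
              have := hC y hy
              calc ‖f y‖^2 ≤ (C*y)^2 := by gcongr
                _ = _ := by ring
          · have : Tendsto (fun y : ℝ => C^2*y) (nhds 0) (nhds (C^2*0)) := by
              apply Continuous.tendsto; fun_prop
            rw [mul_zero] at this
            exact this.mono_left nhdsWithin_le_nhds
        show Tendsto _ _ _
        simpa [h0] using this
      · exact (((hsq y).div (hasDerivAt_id y) (ne_of_gt h)).neg).continuousAt.continuousWithinAt
    · intro y hy
      have hy0 : 0 < y := hy.1
      have hin : inner ℝ (f y) (f' y) ≤ ‖f y‖*‖f' y‖ := real_inner_le_norm _ _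
      have e : -((2 * inner ℝ (f y) (f' y)*y - ‖f y‖^2*1)/y^2) = (‖f y‖/y)^2 - 2*(inner ℝ (f y) (f' y)/y) := by
        field_simp; ring
      rw [e]
      have h1 : inner ℝ (f y) (f' y)/y ≤ (‖f y‖/y)*‖f' y‖ := by
        rw [div_mul_eq_mul_div]; gcongr
      nlinarith [sq_nonneg (‖f y‖/y - 2*‖f' y‖)]
  have hintg : IntegrableOn (fun y => (‖f y‖/y)^2) (Ioi 0) := by
    refine integrableOn_Ioi_of_intervalIntegral_norm_bounded (4 * ∫ y in Ioi (0:ℝ), ‖f' y‖^2) 0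
      (l := atTop) (b := id) (fun N => hloc N) tendsto_id ?_
    filter_upwards [eventually_ge_atTop 0] with N hN
    simp only [norm_pow, norm_div, Real.norm_eq_abs, sq_abs, abs_norm, div_pow]
    simpa [div_pow] using key N hN
  refine ⟨hintg, ?_⟩
  refine le_of_tendsto (intervalIntegral_tendsto_integral_Ioi (μ := volume) 0 hintg tendsto_id) ?_
  filter_upwards [eventually_ge_atTop 0] with N hN
  exact key N hN

lemma log_hardy {w Z : ℝ → ℝ} {ε K y x : ℝ} (hε : 0 < ε) (hw : Continuous w)
    (hZ : ∀ s, 0 < s → 0 ≤ K * Z s)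
    (hZs : ∀ s, 0 < s → s ≤ 2 → s ≤ K * Z s)
    (hJ : IntegrableOn (fun s => (K * Z s + ε) * w s ^ 2) (Ioi 0)) (hy : 0 < y) (hy2 : y ≤ 2)
    (hx : x ≤ ∫ s in (0:ℝ)..y, w s) :
    x ≤ Real.sqrt (∫ s in Ioi (0:ℝ), (K * Z s + ε) * w s ^ 2) * Real.sqrt (Real.log (1 + y/ε)) := by
  have hpos : ∀ s ∈ Ioc 0 y, 0 < s + ε := fun s hs => by have := hs.1; linarith
  have hc1 : ContinuousOn (fun s => Real.sqrt (s+ε) * w s) (Icc 0 y) := by fun_prop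
  have hc2 : ContinuousOn (fun s => (Real.sqrt (s+ε))⁻¹) (Icc 0 y) := by
    refine ContinuousOn.inv₀ (by fun_prop) ?_
    intro s hs
    exact (Real.sqrt_pos.2 (by have := hs.1; linarith)).ne'
  have m1 : MemLp (fun s => Real.sqrt (s+ε) * w s) 2 (volume.restrict (Ioc 0 y)) :=
    (memLp_two_iff_integrable_sq ((hc1.mono Ioc_subset_Icc_self).aestronglyMeasurable measurableSet_Ioc)).2
      ((hc1.pow 2).integrableOn_Icc.mono_set Ioc_subset_Icc_self)
  have m2 : MemLp (fun s => (Real.sqrt (s+ε))⁻¹) 2 (volume.restrict (Ioc 0 y)) :=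
    (memLp_two_iff_integrable_sq ((hc2.mono Ioc_subset_Icc_self).aestronglyMeasurable measurableSet_Ioc)).2
      ((hc2.pow 2).integrableOn_Icc.mono_set Ioc_subset_Icc_self)
  have h := cs_int m1 m2
  refine hx.trans ?_
  rw [intervalIntegral.integral_of_le hy.le]
  have e1 : ∫ s in Ioc 0 y, w s = ∫ s in Ioc 0 y, (Real.sqrt (s+ε) * w s) * (Real.sqrt (s+ε))⁻¹ := by
    refine setIntegral_congr_fun measurableSet_Ioc fun s hs => ?_
    have := (Real.sqrt_pos.2 (hpos s hs)).ne'

    field_simp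
  rw [e1]
  refine h.trans ?_
  have e2 : ∫ s in Ioc 0 y, ((Real.sqrt (s+ε))⁻¹)^2 = Real.log (1+y/ε) := by
    have : ∫ s in Ioc 0 y, ((Real.sqrt (s+ε))⁻¹)^2 = ∫ s in Ioc 0 y, (s+ε)⁻¹ := by
      refine setIntegral_congr_fun measurableSet_Ioc fun s hs => ?_

      rw [inv_pow, Real.sq_sqrt (hpos s hs).le]
    rw [this, ← intervalIntegral.integral_of_le hy.le,
      intervalIntegral.integral_comp_add_right (fun x => x⁻¹), integral_inv_of_pos (by linarith) (by linarith)]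
    congr 1
    field_simp; ring
  rw [e2]
  gcongr
  have i1 : IntegrableOn (fun s => (Real.sqrt (s+ε) * w s)^2) (Ioc 0 y) :=
    (hc1.pow 2).integrableOn_Icc.mono_set Ioc_subset_Icc_self
  calc ∫ s in Ioc 0 y, (Real.sqrt (s+ε) * w s)^2 ≤ ∫ s in Ioc 0 y, (K * Z s + ε) * w s ^ 2 := by
        refine setIntegral_mono_on i1 (hJ.mono_set Ioc_subset_Ioi_self) measurableSet_Ioc fun s hs => ?_
        rw [mul_pow, Real.sq_sqrt (hpos s hs).le]
        have := hZs s hs.1 (hs.2.trans hy2)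
        gcongr
    _ ≤ _ := by
        refine setIntegral_mono_set hJ ?_ Ioc_subset_Ioi_self.eventuallyLE
        refine (ae_restrict_iff' measurableSet_Ioi).2 (ae_of_all _ fun s hs => ?_)
        have := hZ s hs
        simp only [Pi.zero_apply]
        positivity

lemma log_bd {ε y : ℝ} (hε : 0 < ε) (hε1 : ε ≤ 1) (hy : 0 < y) (hy2 : y ≤ 2) :
    Real.log (1 + y/ε) / y ≤ 2 * Real.log (3/ε) * (y+ε)⁻¹ := by
  have hL : 1 ≤ Real.log (3/ε) := by
    rw [Real.le_log_iff_exp_le (by positivity)]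
    have := Real.exp_one_lt_d9
    rw [le_div_iff₀ hε]; nlinarith
  rcases le_total y ε with h | h
  · have h1 : Real.log (1+y/ε) ≤ y/ε := by
      have := Real.log_le_sub_one_of_pos (by positivity : 0 < 1+y/ε); linarith
    calc Real.log (1 + y/ε) / y ≤ (y/ε)/y := by gcongr
      _ = ε⁻¹ := by field_simp
      _ ≤ 2*1*(y+ε)⁻¹ := by
        rw [← div_eq_mul_inv, inv_eq_one_div, div_le_div_iff₀ hε (by linarith)]; linarith
      _ ≤ _ := by gcongr
  · have h1 : Real.log (1+y/ε) ≤ Real.log (3/ε) := by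
      apply Real.log_le_log (by positivity)
      rw [le_div_iff₀ hε]; field_simp; linarith
    calc Real.log (1 + y/ε) / y ≤ Real.log (3/ε) / y := by gcongr
      _ ≤ _ := by
        rw [div_eq_mul_inv, mul_comm 2, mul_assoc]
        gcongr
        rw [← div_eq_mul_inv, inv_eq_one_div, div_le_div_iff₀ hy (by linarith)]; linarith

lemma zeta_bd {X Z Z1 : ℝ → ℝ} {ε K Q : ℝ} (hε : 0 < ε) (hε1 : ε ≤ 1) (hK : 1 ≤ K)
    (hXc : ContinuousOn X (Ioi 0)) (hZc : ContinuousOn Z (Ioi 0)) (hZ1c : ContinuousOn Z1 (Ioi 0))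
    (hZp : ∀ y, 0 < y → 0 < Z y) (hZ10 : ∀ y, 0 < y → 0 ≤ Z1 y ∧ Z1 y ≤ K)
    (hX0 : ∀ y, 0 < y → 0 ≤ X y) (hQ : 0 ≤ Q)
    (hZs : ∀ s, 0 < s → s ≤ 2 → s ≤ K * Z s) (hZ2 : ∀ y, 2 < y → Z1 y = 0)
    (hX : ∀ y, 0 < y → y ≤ 2 → X y ≤ Real.sqrt Q * Real.sqrt (Real.log (1 + y/ε))) :
    MemLp (fun y => Z1 y * X y / Real.sqrt (Z y)) 2 (volume.restrict (Ioi 0)) ∧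
    ∫ y in Ioi (0:ℝ), (Z1 y * X y / Real.sqrt (Z y))^2 ≤ 2*K^3*Q*(Real.log (3/ε))^2 := by
  set Λ := Real.log (3/ε)
  have hΛ : 0 ≤ Λ := Real.log_nonneg (by rw [le_div_iff₀ hε]; linarith)
  have hm : AEStronglyMeasurable (fun y => Z1 y * X y / Real.sqrt (Z y)) (volume.restrict (Ioi 0)) := by
    refine ContinuousOn.aestronglyMeasurable ?_ measurableSet_Ioi
    refine ContinuousOn.div (hZ1c.mul hXc) hZc.sqrt ?_
    intro y hy; exact (Real.sqrt_pos.2 (hZp y hy)).ne'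
  have hci : ContinuousOn (fun y : ℝ => K^3*Q*(2*Λ*(y+ε)⁻¹)) (Icc 0 2) := by
    refine continuousOn_const.mul (continuousOn_const.mul (ContinuousOn.inv₀ (by fun_prop) ?_))
    intro y hy; have := hy.1; positivity
  have hgi : IntegrableOn (fun y : ℝ => K^3*Q*(2*Λ*(y+ε)⁻¹)) (Ioc 0 2) :=
    hci.integrableOn_Icc.mono_set Ioc_subset_Icc_self
  have hgi2 : Integrable ((Ioc (0:ℝ) 2).indicator (fun y : ℝ => K^3*Q*(2*Λ*(y+ε)⁻¹)))
      (volume.restrict (Ioi 0)) :=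
    ((integrable_indicator_iff measurableSet_Ioc).2 hgi).mono_measure Measure.restrict_le_self
  have hle : ∀ y ∈ Ioi (0:ℝ), (Z1 y * X y / Real.sqrt (Z y))^2 ≤
      (Ioc (0:ℝ) 2).indicator (fun y : ℝ => K^3*Q*(2*Λ*(y+ε)⁻¹)) y := by
    intro y hy
    have hy0 : 0 < y := hy
    by_cases h2 : y ≤ 2
    · rw [indicator_of_mem (show y ∈ Ioc (0:ℝ) 2 from ⟨hy, h2⟩)]
      have hZ := hZp y hy
      have hlog : 0 ≤ Real.log (1+y/ε) := Real.log_nonneg (by have : 0 < y/ε := by positivity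
                                                              linarith)
      rw [div_pow, mul_pow, Real.sq_sqrt hZ.le]
      have hx2 : X y ^2 ≤ Q * Real.log (1+y/ε) := by
        have := pow_le_pow_left₀ (hX0 y hy) (hX y hy h2) 2
        rwa [mul_pow, Real.sq_sqrt hQ, Real.sq_sqrt hlog] at this
      have hz := hZ10 y hy
      have hz2 : Z1 y^2 ≤ K^2 := pow_le_pow_left₀ hz.1 hz.2 2
      have hs := hZs y hy h2
      calc Z1 y^2 * X y^2 / Z y ≤ K^2*(Q*Real.log (1+y/ε)) / (y/K) := by
            gcongr
            rw [div_le_iff₀ (by linarith)]; linarith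
        _ = K^3*Q*(Real.log (1+y/ε)/y) := by field_simp
        _ ≤ _ := by
            have := log_bd hε hε1 hy0 h2
            gcongr
    · have : y ∉ Ioc (0:ℝ) 2 := fun h => h2 h.2
      rw [indicator_of_notMem this, hZ2 y (by linarith)]; simp
  have hintg : IntegrableOn (fun y => (Z1 y * X y / Real.sqrt (Z y))^2) (Ioi 0) := by
    refine Integrable.mono' hgi2 (hm.pow 2) ?_
    refine (ae_restrict_iff' measurableSet_Ioi).2 (ae_of_all _ fun y hy => ?_)
    rw [Real.norm_of_nonneg (by positivity)]
    exact hle y hy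
  refine ⟨(memLp_two_iff_integrable_sq hm).2 hintg, ?_⟩
  calc _ ≤ ∫ y in Ioi (0:ℝ), (Ioc (0:ℝ) 2).indicator (fun y : ℝ => K^3*Q*(2*Λ*(y+ε)⁻¹)) y :=
        setIntegral_mono_on hintg hgi2 measurableSet_Ioi hle
    _ = ∫ y in Ioc (0:ℝ) 2, K^3*Q*(2*Λ*(y+ε)⁻¹) := by
        rw [setIntegral_indicator measurableSet_Ioc]
        congr 2
        ext y; simp only [mem_inter_iff, mem_Ioi, mem_Ioc]; tauto
    _ = K^3*Q*(2*Λ*Real.log ((2+ε)/ε)) := by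
        rw [← intervalIntegral.integral_of_le (by norm_num), intervalIntegral.integral_const_mul,
          intervalIntegral.integral_const_mul, intervalIntegral.integral_comp_add_right (fun x => x⁻¹),
          integral_inv_of_pos (by linarith) (by linarith), zero_add]
    _ ≤ K^3*Q*(2*Λ*Λ) := by
        have : Real.log ((2+ε)/ε) ≤ Λ := Real.log_le_log (by positivity) (by gcongr; linarith)
        gcongr
    _ = _ := by ring


def wf (k : ℝ) (a0 a1 b0 b1 : ℝ → ℂ) : ℝ → ℝ := fun y => ‖a1 y‖+‖b1 y‖+|k| * (‖a0 y‖+‖b0 y‖)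
def Xf (a0 b0 : ℝ → ℂ) : ℝ → ℝ := fun y => ‖a0 y‖+‖b0 y‖
def df (k : ℝ) (a0 a1 a2 b0 b1 b2 : ℝ → ℂ) : ℝ → ℝ :=
  fun y => ‖a2 y‖+‖b2 y‖+|k| * wf k a0 a1 b0 b1 y
def af (k : ℝ) (a0 a1 b0 b1 : ℝ → ℂ) : ℝ → ℝ := fun y => wf k a0 a1 b0 b1 y + Xf a0 b0 y / y

/-- the measure on the half line -/
abbrev mI : Measure ℝ := volume.restrict (Ioi (0:ℝ))

/-- full set of data -/
structure Dat (s k ε μ κ c M K c₀ : ℝ) (Us Us1 G G1 Z Z1 Z2 : ℝ → ℝ)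
    (a0 a1 a2 a3 b0 b1 b2 b3 p p1 F1 F2 F3 F4 : ℝ → ℂ) (r nn : ℝ → ℝ) : Prop where
  S : Sys k ε μ κ c M K Us Us1 G G1 Z Z1 Z2 a0 a1 a2 a3 b0 b1 b2 b3 p p1
  hs : |s| = 1
  hsk : s * k = |k|
  hε : 0 < ε
  hε1 : ε ≤ 1
  hM : 0 ≤ M
  hK : 1 ≤ K
  hc0 : 0 < c₀
  hμc : c₀ ≤ μ
  hκc : ∀ y, 0 < y → c₀ ≤ κ * G y
  hGc : ∀ y, 0 < y → c₀ ≤ G y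
  hA : ∀ y, 0 < y → 0 ≤ -(G1 y*Z1 y+G y*Z2 y) ∨ (G1 y*Z1 y+G y*Z2 y ≤ K*(M*ε) ∧ y ≤ 2)
  hG1 : ∀ y, 0 < y → |ε * G1 y| ≤ K * (Real.sqrt ε * M)
  hZs : ∀ y, 0 < y → y ≤ 2 → y ≤ K * Z y
  hZp : ∀ y, 0 < y → 0 < Z y
  hZ2 : ∀ y, 2 < y → Z1 y = 0
  hF1 : ∀ y, 0 < y → ‖F1 y‖ ≤ r y + nn y
  hF2 : ∀ y, 0 < y → ‖F2 y‖ ≤ r y + nn y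
  hF3 : ∀ y, 0 < y → ‖F3 y‖ ≤ r y + nn y
  hF4 : ∀ y, 0 < y → ‖F4 y‖ ≤ r y + nn y
  hr : ∀ y, 0 < y → 0 ≤ r y
  hn0 : ∀ y, 0 < y → 0 ≤ nn y
  hn1 : ∀ y, 0 < y → nn y ≤ K*(Real.sqrt ε*M*df k a0 a1 a2 b0 b1 b2 y + M*(1+M)*af k a0 a1 b0 b1 y)
  hn2 : ∀ y, 0 < y → y * nn y ≤
    K*Real.sqrt ε*(Real.sqrt ε*M*df k a0 a1 a2 b0 b1 b2 y + M*(1+M)*af k a0 a1 b0 b1 y)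
  e1 : ∀ y, 0 < y → Complex.I*k*(c*Us y*a1 y - G y*b1 y) + Complex.I*k*p y - (μ*ε)*(a3 y - k^2*a1 y) = F1 y
  e2 : ∀ y, 0 < y → Complex.I*k*(c*Us y*(-Complex.I*k*a0 y) - G y*(-Complex.I*k*b0 y)) + p1 y
      - (μ*ε)*(-Complex.I*k*a2 y - k^2*(-Complex.I*k*a0 y)) = F2 y
  e3 : ∀ y, 0 < y → -Complex.I*k*a1 y - (κ*ε)*(b3 y - k^2*b1 y) = F3 y
  e4 : ∀ y, 0 < y → -Complex.I*k*(-Complex.I*k*a0 y)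
      - (κ*ε)*(-Complex.I*k*b2 y - k^2*(-Complex.I*k*b0 y)) = F4 y
  lr : MemLp r 2 mI
  la0 : MemLp (fun y => ‖a0 y‖) 2 mI
  la1 : MemLp (fun y => ‖a1 y‖) 2 mI
  la2 : MemLp (fun y => ‖a2 y‖) 2 mI
  lb0 : MemLp (fun y => ‖b0 y‖) 2 mI
  lb1 : MemLp (fun y => ‖b1 y‖) 2 mI
  lb2 : MemLp (fun y => ‖b2 y‖) 2 mI

lemma aux_M {M : ℝ} (hM : 0 ≤ M) : M^2 ≤ M*(1+M) := by nlinarith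
lemma aux_se {se ε : ℝ} (h0 : 0 ≤ se) (h1 : se ≤ 1) (h2 : se^2 = ε) : ε ≤ se := by nlinarith
lemma aux_sM {se M : ℝ} (h0 : 0 ≤ se) (h1 : 0 ≤ M) : M*se ≤ se*(M*(1+M)) := by
  nlinarith [mul_nonneg h0 (mul_nonneg h1 h1)]

lemma aux_d {k a0 a1 a2 b0 b1 b2 w : ℝ} (hw : w = a1+b1+|k| * (a0+b0)) :
    (a2+b2+|k| * w)^2 ≤ 6*((a2^2+2*k^2*a1^2+k^4*a0^2) + (b2^2+2*k^2*b1^2+k^4*b0^2)) := by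
  have e2 : k^2 = |k|^2 := (sq_abs k).symm
  have e4 : k^4 = |k|^4 := by rw [show k^4 = (k^2)^2 by ring, e2]; ring
  rw [e2, e4, hw]
  set q := |k|
  have : ∀ x1 x2 x3 x4 x5 x6 : ℝ, (x1+x2+x3+x4+x5+x6)^2 ≤ 6*(x1^2+x2^2+x3^2+x4^2+x5^2+x6^2) := by
    intro x1 x2 x3 x4 x5 x6
    nlinarith [sq_nonneg (x1-x2), sq_nonneg (x1-x3), sq_nonneg (x1-x4), sq_nonneg (x1-x5), sq_nonneg (x1-x6),
      sq_nonneg (x2-x3), sq_nonneg (x2-x4), sq_nonneg (x2-x5), sq_nonneg (x2-x6), sq_nonneg (x3-x4),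
      sq_nonneg (x3-x5), sq_nonneg (x3-x6), sq_nonneg (x4-x5), sq_nonneg (x4-x6), sq_nonneg (x5-x6)]
  have h1 := this a2 b2 (q*a1) (q*b1) (q^2*a0) (q^2*b0)
  have z1 : 0 ≤ q^2*a1^2 := by positivity
  have z2 : 0 ≤ q^2*b1^2 := by positivity
  calc (a2+b2+q*(a1+b1+q*(a0+b0)))^2 = (a2+b2+q*a1+q*b1+q^2*a0+q^2*b0)^2 := by ring
    _ ≤ _ := h1
    _ ≤ _ := by linarith

section
variable {s k ε μ κ c M K c₀ : ℝ} {Us Us1 G G1 Z Z1 Z2 : ℝ → ℝ}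
    {a0 a1 a2 a3 b0 b1 b2 b3 p p1 F1 F2 F3 F4 : ℝ → ℂ} {r nn : ℝ → ℝ}

lemma Dat.sz (k : ℝ) (Z Z1 : ℝ → ℝ) (a0 a1 a2 b0 b1 b2 : ℝ → ℂ) (y : ℝ) : Sz k y (Z y) (Z1 y) (a0 y) (a1 y) (a2 y) (b0 y) (b1 y) (b2 y)
    (wf k a0 a1 b0 b1 y) (Xf a0 b0 y) (df k a0 a1 a2 b0 b1 b2 y) (af k a0 a1 b0 b1 y)
    (Z y * wf k a0 a1 b0 b1 y + Z1 y * Xf a0 b0 y) := ⟨rfl, rfl, rfl, rfl, rfl⟩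

lemma Dat.pw0 (D : Dat s k ε μ κ c M K c₀ Us Us1 G G1 Z Z1 Z2 a0 a1 a2 a3 b0 b1 b2 b3 p p1 F1 F2 F3 F4 r nn)
    (y : ℝ) (hy : 0 < y) :
    c₀/12*(ε*df k a0 a1 a2 b0 b1 b2 y^2) ≤ (d0 k ε μ κ (G y) (G1 y)
      (a0 y) (a1 y) (a2 y) (a3 y) (b0 y) (b1 y) (b2 y) (b3 y) (p y) (p1 y)).re
      + (4*K^3 + 3/c₀*(4*K^2*(1+K))^2) * (M*(1+M)*af k a0 a1 b0 b1 y^2 + r y * wf k a0 a1 b0 b1 y) := by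
  have hsz := Dat.sz k Z Z1 a0 a1 a2 b0 b1 b2 y
  obtain ⟨_, _, hw0, hX0, hd0, ha0⟩ := hsz.facts hy
  have hse := Real.sqrt_nonneg ε
  have h := bd_0 (D.S.pt y hy) hse (D.hG1 y hy) hsz (D.hF1 y hy) (D.hF2 y hy) (D.hF3 y hy) (D.hF4 y hy)
    (D.e1 y hy) (D.e2 y hy) (D.e3 y hy) (D.e4 y hy)
  have hd := aux_d (k := k) (a0 := ‖a0 y‖) (a1 := ‖a1 y‖) (a2 := ‖a2 y‖) (b0 := ‖b0 y‖)
    (b1 := ‖b1 y‖) (b2 := ‖b2 y‖) (w := wf k a0 a1 b0 b1 y) rfl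
  have hwa : wf k a0 a1 b0 b1 y ≤ af k a0 a1 b0 b1 y := by
    have : 0 ≤ Xf a0 b0 y / y := by positivity
    unfold af; linarith
  have hd' : df k a0 a1 a2 b0 b1 b2 y^2 ≤ _ := hd
  have hn1 := D.hn1 y hy
  have hr := D.hr y hy
  have hn0 := D.hn0 y hy
  have hM := D.hM
  have hK := D.hK
  have hc0 := D.hc0
  have hε := D.hε
  have hμc := D.hμc
  have hκc := D.hκc y hy
  set w := wf k a0 a1 b0 b1 y
  set a := af k a0 a1 b0 b1 y
  set d := df k a0 a1 a2 b0 b1 b2 y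
  set se := Real.sqrt ε with hsedef
  have hse2 : se^2 = ε := Real.sq_sqrt hε.le
  have lowP : c₀/6*(ε*d^2) ≤ ε*(μ*(‖a2 y‖^2+2*k^2*‖a1 y‖^2+k^4*‖a0 y‖^2) + κ*G y*(‖b2 y‖^2+2*k^2*‖b1 y‖^2+k^4*‖b0 y‖^2)) := by
    have t1 : c₀*(‖a2 y‖^2+2*k^2*‖a1 y‖^2+k^4*‖a0 y‖^2) ≤ μ*(‖a2 y‖^2+2*k^2*‖a1 y‖^2+k^4*‖a0 y‖^2) := by gcongr
    have t2 : c₀*(‖b2 y‖^2+2*k^2*‖b1 y‖^2+k^4*‖b0 y‖^2) ≤ κ*G y*(‖b2 y‖^2+2*k^2*‖b1 y‖^2+k^4*‖b0 y‖^2) := by gcongr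
    have t3 := mul_le_mul_of_nonneg_left hd' (by positivity : 0 ≤ c₀/6*ε)
    have t4 := mul_le_mul_of_nonneg_left (add_le_add t1 t2) hε.le
    linarith
  clear_value w a d
  have b1 : nn y * w ≤ K*(se*M*(d*a) + M*(1+M)*a^2) := by
    calc nn y * w ≤ K*(se*M*d + M*(1+M)*a) * a := by gcongr
      _ = _ := by ring
  have b2 : se*M*(d*w) ≤ se*M*(d*a) := by gcongr
  have yng : (4*K^2*(1+K))*(se*M*(d*a)) ≤ c₀/12*(ε*d^2) + 3/c₀*(4*K^2*(1+K))^2*(M^2*a^2) := by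
    set T := 4*K^2*(1+K)
    have : c₀/12*(ε*d^2) + 3/c₀*T^2*(M^2*a^2) - T*(se*M*(d*a)) = (c₀*se*d - 6*T*M*a)^2/(12*c₀) := by
      rw [← hse2]; field_simp; ring
    have h3 : 0 ≤ (c₀*se*d - 6*T*M*a)^2/(12*c₀) := by positivity
    linarith
  have b3 : M^2*a^2 ≤ M*(1+M)*a^2 := by
    have : M^2 ≤ M*(1+M) := aux_M hM
    gcongr
  have b4 : 3/c₀*(4*K^2*(1+K))^2*(M^2*a^2) ≤ 3/c₀*(4*K^2*(1+K))^2*(M*(1+M)*a^2) := by gcongr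
  have b5 : 4*K^2*(r y*w) ≤ 4*K^3*(r y*w) := by
    have : K^2 ≤ K^3 := pow_le_pow_right₀ hK (by norm_num)
    gcongr
  have b6 : 0 ≤ 3/c₀*(4*K^2*(1+K))^2*(r y*w) := by positivity
  have b7 := mul_le_mul_of_nonneg_left b1 (by positivity : 0 ≤ 4*K^2)
  have b8 := mul_le_mul_of_nonneg_left b2 (by positivity : 0 ≤ 4*K^2)
  linarith

lemma Dat.pw1 (D : Dat s k ε μ κ c M K c₀ Us Us1 G G1 Z Z1 Z2 a0 a1 a2 a3 b0 b1 b2 b3 p p1 F1 F2 F3 F4 r nn)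
   {N1 N2 N3 : ℝ} (hN3 : K^4/(2*c₀) + c₀/2 ≤ N3) (hN1 : (N3+1)*K ≤ N1*c₀) (hN10 : 0 ≤ N1) (hN2 : N1^2 ≤ N2)
    (y : ℝ) (hy : 0 < y) :
    c₀/8*(|k| * (Z y*wf k a0 a1 b0 b1 y^2)) ≤ 
     (N1 * (dW k ε μ κ c (Us y) (Us1 y) (G y) (G1 y) (Z y) (Z1 y) (Z2 y)
      (a0 y) (a1 y) (a2 y) (a3 y) (b0 y) (b1 y) (b2 y) (b3 y) (p y) (p1 y)).re
      + N2 * (dV s k ε κ (G y) (G1 y) (Z1 y) (Z2 y) (a0 y) (a1 y) (b2 y) (b3 y)).re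
      + N3 * (dU s k ε κ (Z y) (Z1 y) (a0 y) (a1 y) (a2 y) (b1 y) (b2 y) (b3 y)).re
      + (dH s k ε μ κ c (Us y) (Us1 y) (G y) (G1 y) (Z y) (Z1 y) (Z2 y)
      (a1 y) (a2 y) (a3 y) (b0 y) (b1 y) (b2 y) (b3 y) (p y) (p1 y)).re)
      + ((N1+N2+N3+1)*(20*K^4)*(1+K^2)+2*(N2+1)*K) * (ε*(1+M)*(df k a0 a1 a2 b0 b1 b2 y*af k a0 a1 b0 b1 y)
        + Real.sqrt ε * (M*(1+M)) *af k a0 a1 b0 b1 y^2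
        + r y * (Z y * wf k a0 a1 b0 b1 y + Z1 y * Xf a0 b0 y)) := by
  have hsz := Dat.sz k Z Z1 a0 a1 a2 b0 b1 b2 y
  obtain ⟨_, _, hw0, hX0, hd0, ha0⟩ := hsz.facts hy
  have hP := D.S.pt y hy
  have hse := Real.sqrt_nonneg ε
  have h := bd_tot D.hs D.hsk hP D.hc0 D.hμc (D.hκc y hy) (D.hGc y hy) hN3 hN1 hN10 hN2 (D.hA y hy)
    hsz (D.hF1 y hy) (D.hF2 y hy) (D.hF3 y hy) (D.hF4 y hy)
    (D.e1 y hy) (D.e2 y hy) (D.e3 y hy) (D.e4 y hy)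
  have hm : Z y * wf k a0 a1 b0 b1 y + Z1 y * Xf a0 b0 y ≤ K * (y * af k a0 a1 b0 b1 y) := by
    have e : K * (y * af k a0 a1 b0 b1 y) = K*y*wf k a0 a1 b0 b1 y + K*Xf a0 b0 y := by
      unfold af; field_simp
    rw [e]
    have := hP.hZ; have := hP.hZ1
    gcongr
  have hm0 : 0 ≤ Z y * wf k a0 a1 b0 b1 y + Z1 y * Xf a0 b0 y := by
    have := hP.hZ0; have := hP.hZ10; positivity
  have hn2 := D.hn2 y hy
  have hr := D.hr y hy
  have hn0 := D.hn0 y hy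
  have hM := D.hM
  have hK := D.hK
  have hc0 := D.hc0
  have hε := D.hε
  have hε1 := D.hε1
  set w := wf k a0 a1 b0 b1 y
  set a := af k a0 a1 b0 b1 y
  set d := df k a0 a1 a2 b0 b1 b2 y
  set m := Z y * w + Z1 y * Xf a0 b0 y
  set se := Real.sqrt ε with hsedef
  have hse2 : se^2 = ε := Real.sq_sqrt hε.le
  have hse1 : se ≤ 1 := Real.sqrt_le_one.2 hε1
  refine h.trans ?_
  clear h
  clear_value w a d m
  have b1 : nn y * m ≤ K^2*(ε*(1+M)*(d*a) + se*(M*(1+M))*a^2) := by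
    calc nn y * m ≤ nn y * (K*(y*a)) := by gcongr
      _ = K*a*(y*nn y) := by ring
      _ ≤ K*a*(K*se*(se*M*d+M*(1+M)*a)) := by gcongr
      _ = K^2*(ε*M*(d*a) + se*(M*(1+M))*a^2) := by rw [← hse2]; ring
      _ ≤ _ := by
        have : ε*M*(d*a) ≤ ε*(1+M)*(d*a) := by gcongr; linarith
        gcongr
  have b2 : M*ε*a^2 ≤ se*(M*(1+M))*a^2 := by
    have t1 : ε ≤ se := aux_se hse hse1 hse2
    have : M*ε ≤ se*(M*(1+M)) := by
      calc M*ε ≤ M*se := by gcongr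
        _ ≤ se*(M*(1+M)) := aux_sM hse hM
    gcongr
  have hN30 : 0 ≤ N3 := le_trans (by positivity) hN3
  have hN20 : 0 ≤ N2 := le_trans (by positivity) hN2
  have q1 : 0 ≤ ε*(1+M)*(d*a) := by positivity
  have q2 : 0 ≤ se*(M*(1+M))*a^2 := by positivity
  have q3 : 0 ≤ r y * m := by positivity
  have b3 := mul_le_mul_of_nonneg_left b1 (by positivity : 0 ≤ (N1+N2+N3+1)*(20*K^4))
  have b4 := mul_le_mul_of_nonneg_left b2 (by positivity : 0 ≤ 2*(N2+1)*K)
  have b5 : 0 ≤ 2*(N2+1)*K*(ε*(1+M)*(d*a) + r y*m) := by positivity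
  have b6 : 0 ≤ (N1+N2+N3+1)*(20*K^4)*(se*(M*(1+M))*a^2) := by positivity
  have b7 : 0 ≤ (N1+N2+N3+1)*(20*K^4)*K^2*(r y*m) := by positivity
  linarith

end


section
variable {s k ε μ κ c M K c₀ : ℝ} {Us Us1 G G1 Z Z1 Z2 : ℝ → ℝ}
    {a0 a1 a2 a3 b0 b1 b2 b3 p p1 F1 F2 F3 F4 : ℝ → ℂ} {r nn : ℝ → ℝ}

lemma iadd {m : Measure ℝ} {f g : ℝ → ℝ} (hf : Integrable f m) (hg : Integrable g m) :
    Integrable (fun y => f y + g y) m := hf.add hg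

lemma Dat.cts (D : Dat s k ε μ κ c M K c₀ Us Us1 G G1 Z Z1 Z2 a0 a1 a2 a3 b0 b1 b2 b3 p p1 F1 F2 F3 F4 r nn) :
    Continuous a0 ∧ Continuous a1 ∧ Continuous a2 ∧ Continuous b0 ∧ Continuous b1 ∧ Continuous b2 ∧
    Continuous Z ∧ Continuous Z1 := by
  have S := D.S
  exact ⟨continuous_iff_continuousAt.2 fun y => (S.da0 y).continuousAt,
    continuous_iff_continuousAt.2 fun y => (S.da1 y).continuousAt,
    continuous_iff_continuousAt.2 fun y => (S.da2 y).continuousAt,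
    continuous_iff_continuousAt.2 fun y => (S.db0 y).continuousAt,
    continuous_iff_continuousAt.2 fun y => (S.db1 y).continuousAt,
    continuous_iff_continuousAt.2 fun y => (S.db2 y).continuousAt,
    continuous_iff_continuousAt.2 fun y => (S.dZ y).continuousAt,
    continuous_iff_continuousAt.2 fun y => (S.dZ1 y).continuousAt⟩

lemma Dat.lw (D : Dat s k ε μ κ c M K c₀ Us Us1 G G1 Z Z1 Z2 a0 a1 a2 a3 b0 b1 b2 b3 p p1 F1 F2 F3 F4 r nn) :
    MemLp (wf k a0 a1 b0 b1) 2 mI :=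
  (D.la1.add D.lb1).add ((D.la0.add D.lb0).const_mul |k|)

lemma Dat.ld (D : Dat s k ε μ κ c M K c₀ Us Us1 G G1 Z Z1 Z2 a0 a1 a2 a3 b0 b1 b2 b3 p p1 F1 F2 F3 F4 r nn) :
    MemLp (df k a0 a1 a2 b0 b1 b2) 2 mI :=
  (D.la2.add D.lb2).add (D.lw.const_mul |k|)

lemma hardyM {f f' : ℝ → ℂ} (hd : ∀ y, HasDerivAt f (f' y) y) (h0 : f 0 = 0) (hc : Continuous f')
    (hi : MemLp (fun y => ‖f' y‖) 2 mI) : MemLp (fun y => ‖f y‖ / y) 2 mI ∧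
    ∫ y, (‖f y‖/y)^2 ∂mI ≤ 4 * ∫ y, ‖f' y‖^2 ∂mI := by
  have hfc : Continuous f := continuous_iff_continuousAt.2 fun y => (hd y).continuousAt
  have h := hardy hd h0 hc hi.integrable_sq
  refine ⟨?_, h.2⟩
  rw [memLp_two_iff_integrable_sq]
  · exact h.1
  · exact (hfc.norm.measurable.div measurable_id).aestronglyMeasurable

lemma Dat.la (D : Dat s k ε μ κ c M K c₀ Us Us1 G G1 Z Z1 Z2 a0 a1 a2 a3 b0 b1 b2 b3 p p1 F1 F2 F3 F4 r nn) :
    MemLp (af k a0 a1 b0 b1) 2 mI ∧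
    ∫ y, af k a0 a1 b0 b1 y ^2 ∂mI ≤ 18 * ∫ y, wf k a0 a1 b0 b1 y ^2 ∂mI := by
  obtain ⟨c0, c1, c2, d0, d1, d2, _, _⟩ := D.cts
  obtain ⟨A1, A2⟩ := hardyM D.S.da0 D.S.za0 c1 D.la1
  obtain ⟨B1, B2⟩ := hardyM D.S.db0 D.S.zb0 d1 D.lb1
  have hm : MemLp (af k a0 a1 b0 b1) 2 mI := by
    have := D.lw.add (A1.add B1)
    refine this.congr_norm ?_ ?_
    · have : Measurable (af k a0 a1 b0 b1) := by
        unfold af wf Xf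
        exact (by fun_prop : Continuous _).measurable.add ((by fun_prop : Continuous fun y => ‖a0 y‖+‖b0 y‖).measurable.div measurable_id)
      exact this.aestronglyMeasurable
    · refine Eventually.of_forall fun y => ?_
      simp only [af, Xf, Pi.add_apply, add_div]
  refine ⟨hm, ?_⟩
  have i1 := D.lw.integrable_sq
  have i2 := A1.integrable_sq
  have i3 := B1.integrable_sq
  have i4 := D.la1.integrable_sq
  have i5 := D.lb1.integrable_sq
  have s1 : ∫ y, af k a0 a1 b0 b1 y ^2 ∂mI ≤
      ∫ y, (2*wf k a0 a1 b0 b1 y^2 + (4*(‖a0 y‖/y)^2 + 4*(‖b0 y‖/y)^2)) ∂mI := by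
    refine integral_mono hm.integrable_sq (iadd (i1.const_mul 2) (iadd (i2.const_mul 4) (i3.const_mul 4))) fun y => ?_
    show (wf k a0 a1 b0 b1 y + Xf a0 b0 y / y)^2 ≤ _
    have : Xf a0 b0 y / y = ‖a0 y‖/y+‖b0 y‖/y := by unfold Xf; rw [add_div]
    rw [this]
    nlinarith [sq_nonneg (wf k a0 a1 b0 b1 y - (‖a0 y‖/y+‖b0 y‖/y)), sq_nonneg (‖a0 y‖/y-‖b0 y‖/y)]
  rw [integral_add (i1.const_mul 2) (iadd (i2.const_mul 4) (i3.const_mul 4)),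
    integral_add (i2.const_mul 4) (i3.const_mul 4), integral_const_mul, integral_const_mul, integral_const_mul] at s1
  have s2 : ∫ y, (‖a1 y‖^2 + ‖b1 y‖^2) ∂mI ≤ ∫ y, wf k a0 a1 b0 b1 y ^2 ∂mI := by
    refine integral_mono (i4.add i5) i1 fun y => ?_
    show ‖a1 y‖^2 + ‖b1 y‖^2 ≤ (‖a1 y‖+‖b1 y‖+|k| * (‖a0 y‖+‖b0 y‖))^2
    have q : 0 ≤ |k| * (‖a0 y‖+‖b0 y‖) := by positivity
    have q1 := norm_nonneg (a1 y)
    have q2 := norm_nonneg (b1 y)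
    calc ‖a1 y‖^2 + ‖b1 y‖^2 ≤ (‖a1 y‖+‖b1 y‖)^2 := by nlinarith
      _ ≤ _ := pow_le_pow_left₀ (by positivity) (by linarith) 2
  rw [integral_add i4 i5] at s2
  linarith

lemma Dat.w0 (k : ℝ) (a0 a1 b0 b1 : ℝ → ℂ) (y : ℝ) : 0 ≤ wf k a0 a1 b0 b1 y := by
  unfold wf; positivity

lemma Dat.kd (D : Dat s k ε μ κ c M K c₀ Us Us1 G G1 Z Z1 Z2 a0 a1 a2 a3 b0 b1 b2 b3 p p1 F1 F2 F3 F4 r nn) :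
    k^2 * ∫ y, wf k a0 a1 b0 b1 y ^2 ∂mI ≤ ∫ y, df k a0 a1 a2 b0 b1 b2 y ^2 ∂mI := by
  rw [← integral_const_mul]
  refine integral_mono (D.lw.integrable_sq.const_mul _) D.ld.integrable_sq fun y => ?_
  show k^2 * wf k a0 a1 b0 b1 y ^2 ≤ (‖a2 y‖+‖b2 y‖+|k| * wf k a0 a1 b0 b1 y)^2
  have := Dat.w0 k a0 a1 b0 b1 y
  rw [← sq_abs k, ← mul_pow]
  gcongr
  have : 0 ≤ ‖a2 y‖+‖b2 y‖ := by positivity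
  linarith

/-- energy bound -/
lemma Dat.energy (D : Dat s k ε μ κ c M K c₀ Us Us1 G G1 Z Z1 Z2 a0 a1 a2 a3 b0 b1 b2 b3 p p1 F1 F2 F3 F4 r nn) :
    c₀/12*(ε * ∫ y, df k a0 a1 a2 b0 b1 b2 y ^2 ∂mI) ≤ (4*K^3 + 3/c₀*(4*K^2*(1+K))^2) *
     (M*(1+M)*(18 * ∫ y, wf k a0 a1 b0 b1 y ^2 ∂mI)
       + Real.sqrt (∫ y, r y ^2 ∂mI) * Real.sqrt (∫ y, wf k a0 a1 b0 b1 y ^2 ∂mI)) := by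
  have i1 : Integrable (fun y => r y * wf k a0 a1 b0 b1 y) mI := D.lr.integrable_mul D.lw
  have i2 := D.la.1.integrable_sq
  have hM := D.hM
  have hK := D.hK
  have hc0 := D.hc0
  have h := flux_int D.S.flux_0 (P := fun y => c₀/12*(ε*df k a0 a1 a2 b0 b1 b2 y^2))
    (B := fun y => (4*K^3 + 3/c₀*(4*K^2*(1+K))^2) * (M*(1+M)*af k a0 a1 b0 b1 y^2 + r y * wf k a0 a1 b0 b1 y))
    ((D.ld.integrable_sq.const_mul _).const_mul _) ((iadd (i2.const_mul _) i1).const_mul _) D.pw0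
  rw [integral_const_mul, integral_const_mul, integral_const_mul, integral_add (i2.const_mul _) i1,
    integral_const_mul] at h
  refine h.trans ?_
  have := D.la.2
  have := cs_int D.lr D.lw
  gcongr

lemma Dat.sqZ (D : Dat s k ε μ κ c M K c₀ Us Us1 G G1 Z Z1 Z2 a0 a1 a2 a3 b0 b1 b2 b3 p p1 F1 F2 F3 F4 r nn)
    {f : ℝ → ℝ} (hf : MemLp f 2 mI) : MemLp (fun y => Real.sqrt (Z y) * f y) 2 mI := by
  obtain ⟨_, _, _, _, _, _, cZ, _⟩ := D.cts
  refine MemLp.of_le_mul (c := Real.sqrt K) hf ?_ ?_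
  · exact (Real.continuous_sqrt.comp cZ).aestronglyMeasurable.mul hf.1
  · refine (ae_restrict_iff' measurableSet_Ioi).2 (Eventually.of_forall fun y hy => ?_)
    rw [norm_mul, Real.norm_of_nonneg (Real.sqrt_nonneg _)]
    have := Real.sqrt_le_sqrt (D.S.zK y hy)
    gcongr

lemma Dat.wz (D : Dat s k ε μ κ c M K c₀ Us Us1 G G1 Z Z1 Z2 a0 a1 a2 a3 b0 b1 b2 b3 p p1 F1 F2 F3 F4 r nn)
    {f : ℝ → ℝ} (hf : MemLp f 2 mI) : Integrable (fun y => Z y * f y ^2) mI ∧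
      ∫ y, (Real.sqrt (Z y) * f y)^2 ∂mI = ∫ y, Z y * f y ^2 ∂mI := by
  have h := (D.sqZ hf).integrable_sq
  have e : (fun y => (Real.sqrt (Z y) * f y)^2) =ᵐ[mI] fun y => Z y * f y ^2 := by
    refine (ae_restrict_iff' measurableSet_Ioi).2 (Eventually.of_forall fun y hy => ?_)
    show (Real.sqrt (Z y) * f y)^2 = Z y * f y ^2
    rw [mul_pow, Real.sq_sqrt (D.hZp y hy).le]
  exact ⟨h.congr e, integral_congr_ae e⟩

lemma Dat.zeta (D : Dat s k ε μ κ c M K c₀ Us Us1 G G1 Z Z1 Z2 a0 a1 a2 a3 b0 b1 b2 b3 p p1 F1 F2 F3 F4 r nn) :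
    MemLp (fun y => Z1 y * Xf a0 b0 y / Real.sqrt (Z y)) 2 mI ∧
    ∫ y, (Z1 y * Xf a0 b0 y / Real.sqrt (Z y))^2 ∂mI ≤ 2*K^3*
      (K * (∫ y, Z y * wf k a0 a1 b0 b1 y^2 ∂mI) + ε * ∫ y, wf k a0 a1 b0 b1 y^2 ∂mI)*(Real.log (3/ε))^2 := by
  obtain ⟨c0, c1, c2, d0, d1, d2, cZ, cZ1⟩ := D.cts
  have hw : Continuous (wf k a0 a1 b0 b1) := by unfold wf; fun_prop
  have i1 := (D.wz D.lw).1
  have i2 := D.lw.integrable_sq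
  have i3 : Integrable (fun s => (K * Z s + ε) * wf k a0 a1 b0 b1 s ^ 2) mI := by
    refine ((i1.const_mul K).add (i2.const_mul ε)).congr (Eventually.of_forall fun y => ?_)
    simp only [Pi.add_apply]; ring
  have e3 : ∫ y, (K * Z y + ε) * wf k a0 a1 b0 b1 y ^ 2 ∂mI =
      K * (∫ y, Z y * wf k a0 a1 b0 b1 y^2 ∂mI) + ε * ∫ y, wf k a0 a1 b0 b1 y^2 ∂mI := by
    rw [← integral_const_mul, ← integral_const_mul, ← integral_add (i1.const_mul K) (i2.const_mul ε)]
    congr 1; ext y; ring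
  have hK0 : 0 ≤ K := by linarith [D.hK]
  rw [← e3]
  refine zeta_bd D.hε D.hε1 D.hK (by unfold Xf; fun_prop) cZ.continuousOn cZ1.continuousOn D.hZp
    (fun y hy => ⟨(D.S.pt y hy).hZ10, (D.S.pt y hy).hZ1⟩) (fun y hy => by unfold Xf; positivity)
    ?_ D.hZs D.hZ2 ?_
  · refine setIntegral_nonneg measurableSet_Ioi fun y hy => ?_
    have := D.hZp y hy
    have := D.hε
    positivity
  · intro y hy hy2
    refine log_hardy D.hε hw (fun s hs => by have := D.hZp s hs; positivity) D.hZs i3 hy hy2 ?_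
    have f1 : ∀ {f f' : ℝ → ℂ}, (∀ y, HasDerivAt f (f' y) y) → f 0 = 0 → Continuous f' →
        ‖f y‖ ≤ ∫ s in (0:ℝ)..y, ‖f' s‖ := by
      intro f f' hd h0 hc
      have := intervalIntegral.integral_eq_sub_of_hasDerivAt (a := 0) (b := y) (fun x _ => hd x) (hc.intervalIntegrable _ _)
      rw [h0, sub_zero] at this
      rw [← this]
      exact intervalIntegral.norm_integral_le_integral_norm hy.le
    have g1 := f1 D.S.da0 D.S.za0 c1
    have g2 := f1 D.S.db0 D.S.zb0 d1
    calc Xf a0 b0 y ≤ (∫ s in (0:ℝ)..y, ‖a1 s‖) + ∫ s in (0:ℝ)..y, ‖b1 s‖ := add_le_add g1 g2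
      _ = ∫ s in (0:ℝ)..y, (‖a1 s‖ + ‖b1 s‖) :=
        (intervalIntegral.integral_add (c1.norm.intervalIntegrable _ _) (d1.norm.intervalIntegrable _ _)).symm
      _ ≤ _ := by
        refine intervalIntegral.integral_mono_on hy.le ((c1.norm.add d1.norm).intervalIntegrable _ _) (hw.intervalIntegrable _ _) fun x _ => ?_
        unfold wf
        have : 0 ≤ |k| * (‖a0 x‖+‖b0 x‖) := by positivity
        linarith

/-- weighted bound -/
lemma Dat.weighted (D : Dat s k ε μ κ c M K c₀ Us Us1 G G1 Z Z1 Z2 a0 a1 a2 a3 b0 b1 b2 b3 p p1 F1 F2 F3 F4 r nn)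
    {N1 N2 N3 : ℝ} (hN3 : K^4/(2*c₀) + c₀/2 ≤ N3) (hN1 : (N3+1)*K ≤ N1*c₀) (hN10 : 0 ≤ N1) (hN2 : N1^2 ≤ N2) :
    c₀/8*(|k| * ∫ y, Z y * wf k a0 a1 b0 b1 y ^2 ∂mI) ≤ ((N1+N2+N3+1)*(20*K^4)*(1+K^2)+2*(N2+1)*K) *
     (ε*(1+M)*(Real.sqrt (∫ y, df k a0 a1 a2 b0 b1 b2 y^2 ∂mI) * Real.sqrt (18 * ∫ y, wf k a0 a1 b0 b1 y ^2 ∂mI))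
      + Real.sqrt ε * (M*(1+M)) * (18 * ∫ y, wf k a0 a1 b0 b1 y ^2 ∂mI)
      + Real.sqrt (∫ y, Z y * r y ^2 ∂mI) * (Real.sqrt (∫ y, Z y * wf k a0 a1 b0 b1 y ^2 ∂mI) +
         Real.sqrt (2*K^3*(K * (∫ y, Z y * wf k a0 a1 b0 b1 y^2 ∂mI) 
          + ε * ∫ y, wf k a0 a1 b0 b1 y^2 ∂mI)*(Real.log (3/ε))^2))) := by
  have hM := D.hM
  have hK := D.hK
  have hc0 := D.hc0
  have hε := D.hε
  have hN30 : 0 ≤ N3 := le_trans (by positivity) hN3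
  have hN20 : 0 ≤ N2 := le_trans (by positivity) hN2
  set C := (N1+N2+N3+1)*(20*K^4)*(1+K^2)+2*(N2+1)*K with hC
  have hC0 : 0 ≤ C := by positivity
  have i1 : Integrable (fun y => df k a0 a1 a2 b0 b1 b2 y * af k a0 a1 b0 b1 y) mI := D.ld.integrable_mul D.la.1
  have i2 := D.la.1.integrable_sq
  have lz := D.sqZ D.lr
  have i3 : Integrable (fun y => (Real.sqrt (Z y) * r y) * (Real.sqrt (Z y) * wf k a0 a1 b0 b1 y)) mI :=
    lz.integrable_mul (D.sqZ D.lw)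
  have i4 : Integrable (fun y => (Real.sqrt (Z y) * r y) * (Z1 y * Xf a0 b0 y / Real.sqrt (Z y))) mI :=
    lz.integrable_mul D.zeta.1
  have iT : Integrable (fun y => ε*(1+M)*(df k a0 a1 a2 b0 b1 b2 y*af k a0 a1 b0 b1 y)
        + Real.sqrt ε * (M*(1+M)) *af k a0 a1 b0 b1 y^2
        + ((Real.sqrt (Z y) * r y) * (Real.sqrt (Z y) * wf k a0 a1 b0 b1 y) + (Real.sqrt (Z y) * r y) * (Z1 y * Xf a0 b0 y / Real.sqrt (Z y)))) mI :=
    iadd (iadd (i1.const_mul _) (i2.const_mul _)) (iadd i3 i4)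
  have S := D.S
  have fl := ((((S.flux_W).smul (N1:ℂ)).add ((S.flux_V (s := s)).smul (N2:ℂ))).add ((S.flux_U (s := s)).smul (N3:ℂ))).add (S.flux_H (s := s))
  have h := flux_int fl (P := fun y => c₀/8*(|k| * (Z y*wf k a0 a1 b0 b1 y^2)))
    (B := fun y => C * (ε*(1+M)*(df k a0 a1 a2 b0 b1 b2 y*af k a0 a1 b0 b1 y)
        + Real.sqrt ε * (M*(1+M)) *af k a0 a1 b0 b1 y^2
        + ((Real.sqrt (Z y) * r y) * (Real.sqrt (Z y) * wf k a0 a1 b0 b1 y) + (Real.sqrt (Z y) * r y) * (Z1 y * Xf a0 b0 y / Real.sqrt (Z y)))))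
    (((D.wz D.lw).1.const_mul _).const_mul _) (iT.const_mul _) (by
      intro y hy
      have := D.pw1 hN3 hN1 hN10 hN2 y hy
      rw [← hC] at this
      have e : (Real.sqrt (Z y) * r y) * (Real.sqrt (Z y) * wf k a0 a1 b0 b1 y) + (Real.sqrt (Z y) * r y) * (Z1 y * Xf a0 b0 y / Real.sqrt (Z y)) = r y * (Z y * wf k a0 a1 b0 b1 y + Z1 y * Xf a0 b0 y) := by
        have hz := Real.sqrt_pos.2 (D.hZp y hy)
        have hz2 := Real.sq_sqrt (D.hZp y hy).le
        field_simp
        rw [hz2]; ring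
      rw [e]
      simpa only [Complex.add_re, Complex.re_ofReal_mul] using this)
  rw [integral_const_mul, integral_const_mul, integral_const_mul,
    integral_add (iadd (i1.const_mul _) (i2.const_mul _)) (iadd i3 i4),
    integral_add (i1.const_mul _) (i2.const_mul _), integral_add i3 i4, integral_const_mul, integral_const_mul] at h
  refine h.trans ?_
  have j1 := cs_int D.ld D.la.1
  have j1' := Real.sqrt_le_sqrt D.la.2
  have j2 := D.la.2
  have j3 := cs_int lz (D.sqZ D.lw)
  have j4 := cs_int lz D.zeta.1
  have j4' := Real.sqrt_le_sqrt D.zeta.2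
  rw [(D.wz D.lr).2] at j3 j4
  rw [(D.wz D.lw).2] at j3
  rw [mul_add (Real.sqrt (∫ y, Z y * r y ^2 ∂mI))]
  refine mul_le_mul_of_nonneg_left ?_ hC0
  refine add_le_add (add_le_add ?_ ?_) (add_le_add j3 (j4.trans ?_))
  · refine mul_le_mul_of_nonneg_left (j1.trans ?_) (by positivity)
    gcongr
  · gcongr
  · gcongr

end


lemma sc_m1 {m : ℝ} (hm : 0 ≤ m) : (1+m^4)^3 ≤ 8*(1+m^5)^4 := by
  rcases le_total m 1 with h | h
  · have h1 : m^4 ≤ 1 := pow_le_one₀ hm h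
    calc (1+m^4)^3 ≤ (1+1)^3 := by gcongr
      _ = 8*1^4 := by norm_num
      _ ≤ _ := by gcongr; linarith [pow_nonneg hm 5]
  · have h1 : 1 ≤ m^4 := one_le_pow₀ h
    have h2 : m^12 ≤ m^20 := pow_le_pow_right₀ h (by norm_num)
    calc (1+m^4)^3 ≤ (m^4+m^4)^3 := by gcongr
      _ = 8*m^12 := by ring
      _ ≤ 8*m^20 := by linarith
      _ = 8*(0+m^5)^4 := by ring
      _ ≤ _ := by gcongr; norm_num

lemma sc_m2 {m : ℝ} (hm : 0 ≤ m) : m^2*(1+m^4) ≤ 2*(1+m^5)^2 := by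
  rcases le_total m 1 with h | h
  · have h1 : m^4 ≤ 1 := pow_le_one₀ hm h
    have h2 : m^2 ≤ 1 := pow_le_one₀ hm h
    calc m^2*(1+m^4) ≤ 1*(1+1) := by gcongr
      _ = 2*1^2 := by norm_num
      _ ≤ _ := by gcongr; linarith [pow_nonneg hm 5]
  · have h1 : 1 ≤ m^4 := one_le_pow₀ h
    have h2 : m^6 ≤ m^10 := pow_le_pow_right₀ h (by norm_num)
    calc m^2*(1+m^4) ≤ m^2*(m^4+m^4) := by gcongr
      _ = 2*m^6 := by ring
      _ ≤ 2*m^10 := by linarith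
      _ = 2*(0+m^5)^2 := by ring
      _ ≤ _ := by gcongr; norm_num

lemma sc_m3 {m : ℝ} (hm : 0 ≤ m) : (1+m^4)^2 ≤ (1+m^2)^4 := by
  have : 1+m^4 ≤ (1+m^2)^2 := by nlinarith [sq_nonneg m]
  calc (1+m^4)^2 ≤ ((1+m^2)^2)^2 := by gcongr
    _ = _ := by ring

lemma sc_4 {x y : ℝ} (hx : 0 ≤ x) (hy : 0 ≤ y) : x^4+y^4 ≤ (x+y)^4 := by
  have : (x+y)^4 = x^4+y^4 + (4*x^3*y+6*x^2*y^2+4*x*y^3) := by ring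
  have : 0 ≤ 4*x^3*y+6*x^2*y^2+4*x*y^3 := by positivity
  linarith

lemma sc_X {B e m ρ ω E : ℝ} (hB : 0 ≤ B) (he : 0 ≤ e) (hm : 0 ≤ m) (hρ : 0 ≤ ρ) (hω : 0 ≤ ω)
    (hE : 0 ≤ E) (h : E^2 ≤ B*(m^4*(1+m^4)*ω^8+ρ^4*ω^4)) :
    e^2*(1+m^4)*(E*ω^4) ≤ Real.sqrt (8*B) * (e*(1+m^2)*ρ*ω^3+e*m*(1+m^5)*ω^4)^2 := by
  set T := e*(1+m^2)*ρ*ω^3+e*m*(1+m^5)*ω^4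
  refine le_of_sq_le_sq ?_ (by positivity)
  rw [mul_pow (Real.sqrt _), Real.sq_sqrt (by positivity)]
  have hT : (e*(1+m^2)*ρ*ω^3)^4+(e*m*(1+m^5)*ω^4)^4 ≤ (T^2)^2 := by
    rw [← pow_mul]; exact sc_4 (by positivity) (by positivity)
  have s1 : m^4*ω^16*(1+m^4)^3 ≤ m^4*ω^16*(8*(1+m^5)^4) := by
    have := sc_m1 hm; gcongr
  have s2 : ρ^4*ω^12*(1+m^4)^2 ≤ ρ^4*ω^12*(1+m^2)^4 := by
    have := sc_m3 hm; gcongr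
  have s3 : 0 ≤ ρ^4*ω^12*(1+m^2)^4 := by positivity
  calc (e^2*(1+m^4)*(E*ω^4))^2 = e^4*(1+m^4)^2*ω^8*E^2 := by ring
    _ ≤ e^4*(1+m^4)^2*ω^8*(B*(m^4*(1+m^4)*ω^8+ρ^4*ω^4)) := by gcongr
    _ = B*e^4*(m^4*ω^16*(1+m^4)^3 + ρ^4*ω^12*(1+m^4)^2) := by ring
    _ ≤ B*e^4*(m^4*ω^16*(8*(1+m^5)^4) + 8*(ρ^4*ω^12*(1+m^2)^4)) := by
      refine mul_le_mul_of_nonneg_left ?_ (by positivity); linarith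
    _ = 8*B*((e*(1+m^2)*ρ*ω^3)^4+(e*m*(1+m^5)*ω^4)^4) := by ring
    _ ≤ _ := by gcongr

lemma sc_fin {P S T V X b B1 K : ℝ} (hS : 0 ≤ S) (hT : 0 ≤ T) (hP : 0 ≤ P) (hb : 0 ≤ b) (hB1 : 0 < B1) (hK : 0 < K)
    (hV2 : V^2 ≤ X) (hX : X ≤ b*T^2) (h : P^2 ≤ B1*(5*X+36*T^2+3*K^2*(S*(P+V)))) :
    P ≤ Real.sqrt (2*B1*(5*b+36+3*K^2*b+3*K^2)+9*K^4*B1^2) * (S+T) := by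
  refine le_of_sq_le_sq ?_ (by positivity)
  rw [mul_pow (Real.sqrt _), Real.sq_sqrt (by positivity)]
  have y1 : S*V ≤ S^2+b*T^2 := by nlinarith [sq_nonneg (S-V), sq_nonneg (S+V)]
  have y2 : 3*K^2*B1*(S*P) ≤ P^2/2 + 9*K^4*B1^2/2*S^2 := by nlinarith [sq_nonneg (P-3*K^2*B1*S)]
  have y3 := mul_le_mul_of_nonneg_left y1 (by positivity : 0 ≤ 3*K^2*B1)
  have y4 := mul_le_mul_of_nonneg_left hX (by positivity : 0 ≤ 5*B1)
  have y5 : P^2 ≤ 2*B1*((5*b+36+3*K^2*b)*T^2+3*K^2*S^2)+9*K^4*B1^2*S^2 := by linarith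
  have y6 : T^2 ≤ (S+T)^2 := by gcongr; linarith
  have y7 : S^2 ≤ (S+T)^2 := by gcongr; linarith
  calc P^2 ≤ _ := y5
    _ ≤ 2*B1*((5*b+36+3*K^2*b)*(S+T)^2+3*K^2*(S+T)^2)+9*K^4*B1^2*(S+T)^2 := by gcongr
    _ = _ := by ring

lemma scal {c₀ K C0 C1 : ℝ} (hc : 0 < c₀) (hK : 1 ≤ K) (h0 : 0 < C0) (h1 : 0 < C1) :
    ∃ C : ℝ, 0 < C ∧ ∀ x A Dd e m ρ ω Rz Λ : ℝ, 0 < x → 0 ≤ A → 0 ≤ Dd → 0 ≤ e → 0 ≤ m → 0 ≤ ρ → 0 ≤ ω →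
      0 ≤ Rz → 1 ≤ Λ →
      c₀/12 * (e^4*Dd^2) ≤ C0*(m^4*(1+m^4)*(18*ω^8)+ρ^4*ω^4) →
      c₀/8*(x^2*A^2) ≤ C1*(e^4*(1+m^4)*(Dd*(5*ω^4)) + e^2*(m^4*(1+m^4))*(18*ω^8)+Rz*(A + 2*K^2*Λ*(A+e^2*ω^4))) →
      x^2*ω^4 ≤ Dd →
      x*A ≤ C*(x⁻¹*Λ*Rz + (e*(1+m^2)*ρ*ω^3+e*m*(1+m^5)*ω^4)) := by
  set B := 216*C0/c₀ with hB
  set b := Real.sqrt (8*B) with hb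
  set B1 := 8*C1/c₀ with hB1
  refine ⟨Real.sqrt (2*B1*(5*b+36+3*K^2*b+3*K^2)+9*K^4*B1^2), by positivity, ?_⟩
  intro x A Dd e m ρ ω Rz Λ hx hA hD he hm hρ hω hRz hΛ H1 H2 H3
  set T := e*(1+m^2)*ρ*ω^3+e*m*(1+m^5)*ω^4 with hT
  have hE : (e^2*Dd)^2 ≤ B*(m^4*(1+m^4)*ω^8+ρ^4*ω^4) := by
    have z : 0 ≤ C0*(ρ^4*ω^4) := by positivity
    have : c₀*(e^2*Dd)^2 ≤ 216*C0*(m^4*(1+m^4)*ω^8+ρ^4*ω^4) := by nlinarith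
    rw [hB, div_mul_eq_mul_div, le_div_iff₀ hc]
    linarith
  have hX := sc_X (by positivity) he hm hρ hω (by positivity) hE
  rw [← hT, ← hb] at hX
  have hT2 : e^2*(m^4*(1+m^4))*ω^8 ≤ 2*T^2 := by
    have s1 := sc_m2 hm
    calc e^2*(m^4*(1+m^4))*ω^8 = e^2*m^2*ω^8*(m^2*(1+m^4)) := by ring
      _ ≤ e^2*m^2*ω^8*(2*(1+m^5)^2) := by gcongr
      _ = 2*(e*m*(1+m^5)*ω^4)^2 := by ring
      _ ≤ 2*T^2 := by
        have : 0 ≤ e*(1+m^2)*ρ*ω^3 := by positivity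
        gcongr; rw [hT]; linarith
  refine sc_fin (X := e^2*(1+m^4)*(e^2*Dd*ω^4)) (V := x*(e^2*ω^4)) (by positivity) (by positivity) (by positivity) (by positivity) (by positivity) (by positivity) ?_ hX ?_
  · calc (x*(e^2*ω^4))^2 = e^4*ω^4*(x^2*ω^4) := by ring
      _ ≤ e^4*ω^4*Dd := by gcongr
      _ = e^2*1*(e^2*Dd*ω^4) := by ring
      _ ≤ _ := by gcongr; linarith [pow_nonneg hm 4]
  · have hx' : x⁻¹*x = 1 := inv_mul_cancel₀ hx.ne'
    have e1 : x⁻¹*Λ*Rz*(x*A+x*(e^2*ω^4)) = Rz*(Λ*(A+e^2*ω^4)) := by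
      calc _ = (x⁻¹*x)*(Rz*(Λ*(A+e^2*ω^4))) := by ring
        _ = _ := by rw [hx', one_mul]
    rw [e1, hB1, div_mul_eq_mul_div, le_div_iff₀ hc]
    have s1 : A ≤ K^2*Λ*(A+e^2*ω^4) := by
      calc A = 1*1*(A+0) := by ring
        _ ≤ K^2*Λ*(A+e^2*ω^4) := by
          have := one_le_pow₀ (n := 2) hK
          gcongr; positivity
    have s2 : Rz*(A + 2*K^2*Λ*(A+e^2*ω^4)) ≤ 3*K^2*(Rz*(Λ*(A+e^2*ω^4))) := by
      calc Rz*(A + 2*K^2*Λ*(A+e^2*ω^4)) ≤ Rz*(K^2*Λ*(A+e^2*ω^4) + 2*K^2*Λ*(A+e^2*ω^4)) := by gcongr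
        _ = _ := by ring
    have s3 := mul_le_mul_of_nonneg_left s2 h1.le
    have s4 := mul_le_mul_of_nonneg_left hT2 h1.le
    linarith


lemma q4 {a : ℝ} (ha : 0 ≤ a) : (a^((1:ℝ)/4))^4 = a ∧ (a^((1:ℝ)/4))^2 = Real.sqrt a ∧
    (a^((1:ℝ)/4))^3 = a^((3:ℝ)/4) ∧ (a^((1:ℝ)/4))^5 = a^((5:ℝ)/4) := by
  refine ⟨?_, ?_, ?_, ?_⟩
  · rw [← Real.rpow_natCast, ← Real.rpow_mul ha]; norm_num
  · rw [← Real.rpow_natCast, ← Real.rpow_mul ha, Real.sqrt_eq_rpow]; norm_num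
  · rw [← Real.rpow_natCast, ← Real.rpow_mul ha]; norm_num
  · rw [← Real.rpow_natCast, ← Real.rpow_mul ha]; norm_num

lemma sq18 {W : ℝ} (hW : 0 ≤ W) : Real.sqrt (18*W^2) ≤ 5*W := by
  refine Real.sqrt_le_iff.2 ⟨by positivity, by nlinarith [sq_nonneg W]⟩

lemma sqQ {K A2 A ε se W W2 Λ : ℝ} (hK : 1 ≤ K) (hA : 0 ≤ A) (hse : 0 ≤ se) (hW : 0 ≤ W) (hΛ : 0 ≤ Λ)
    (h1 : A2 = A^2) (h2 : ε = se^2) (h3 : W2 = W^2) :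
    Real.sqrt (2*K^3*(K*A2+ε*W2)*Λ^2) ≤ 2*K^2*Λ*(A+se*W) := by
  refine Real.sqrt_le_iff.2 ⟨by positivity, ?_⟩
  rw [h1, h2, h3]
  have z1 : 0 ≤ A*(se*W) := by positivity
  have z2 : A^2+(se*W)^2 ≤ (A+se*W)^2 := by nlinarith
  have hK4 : K^3 ≤ K^4 := pow_le_pow_right₀ hK (by norm_num)
  have z3 : K*A^2+se^2*W^2 ≤ K*(A^2+(se*W)^2) := by nlinarith [sq_nonneg (se*W)]
  calc 2*K^3*(K*A^2+se^2*W^2)*Λ^2 ≤ 2*K^3*(K*(A+se*W)^2)*Λ^2 := by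
        gcongr
        exact z3.trans (by gcongr)
    _ = 2*K^4*Λ^2*(A+se*W)^2 := by ring
    _ ≤ 4*K^4*Λ^2*(A+se*W)^2 := by gcongr; norm_num
    _ = _ := by ring

lemma log3_ge {ε : ℝ} (hε : 0 < ε) (h1 : ε ≤ 1) : 1 ≤ Real.log (3/ε) := by
  rw [Real.le_log_iff_exp_le (by positivity), le_div_iff₀ hε]
  have := Real.exp_one_lt_d9
  nlinarith

set_option maxHeartbeats 1000000 in
lemma main_abs {c₀ K : ℝ} (hc : 0 < c₀) (hK : 1 ≤ K) : ∃ C : ℝ, 0 < C ∧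
    ∀ {s k ε μ κ c M : ℝ} {Us Us1 G G1 Z Z1 Z2 : ℝ → ℝ}
    {a0 a1 a2 a3 b0 b1 b2 b3 p p1 F1 F2 F3 F4 : ℝ → ℂ} {r nn : ℝ → ℝ}, k ≠ 0 →
    Dat s k ε μ κ c M K c₀ Us Us1 G G1 Z Z1 Z2 a0 a1 a2 a3 b0 b1 b2 b3 p p1 F1 F2 F3 F4 r nn →
    Real.sqrt |k| * Real.sqrt (∫ y, Z y * wf k a0 a1 b0 b1 y ^2 ∂mI) ≤
     C*((Real.sqrt |k|)⁻¹ * Real.log (3/ε) * Real.sqrt (∫ y, Z y * r y ^2 ∂mI) +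
      (ε^((1:ℝ)/4)*(1+Real.sqrt M) * Real.sqrt (∫ y, r y ^2 ∂mI) ^((1:ℝ)/4) *
          Real.sqrt (∫ y, wf k a0 a1 b0 b1 y ^2 ∂mI) ^((3:ℝ)/4)
       + ε^((1:ℝ)/4)*M^((1:ℝ)/4)*(1+M^((5:ℝ)/4)) * Real.sqrt (∫ y, wf k a0 a1 b0 b1 y ^2 ∂mI))) := by
  set N3 := K^4/(2*c₀) + c₀/2 with hN3
  set N1 := (N3+1)*K/c₀ with hN1
  have hN30 : 0 ≤ N3 := by positivity
  obtain ⟨C, hC, H⟩ := scal (c₀ := c₀) (K := K) (C0 := 4*K^3 + 3/c₀*(4*K^2*(1+K))^2)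
    (C1 := (N1+N1^2+N3+1)*(20*K^4)*(1+K^2)+2*(N1^2+1)*K) hc hK (by positivity) (by positivity)
  refine ⟨C, hC, ?_⟩
  intro s k ε μ κ c M Us Us1 G G1 Z Z1 Z2 a0 a1 a2 a3 b0 b1 b2 b3 p p1 F1 F2 F3 F4 r nn hk D
  have hε := D.hε
  have hM := D.hM
  have nA : 0 ≤ ∫ y, Z y * wf k a0 a1 b0 b1 y ^2 ∂mI :=
    setIntegral_nonneg measurableSet_Ioi fun y hy => by have := D.hZp y hy; positivity
  have nR : 0 ≤ ∫ y, Z y * r y ^2 ∂mI :=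
    setIntegral_nonneg measurableSet_Ioi fun y hy => by have := D.hZp y hy; positivity
  have nW : 0 ≤ ∫ y, wf k a0 a1 b0 b1 y ^2 ∂mI := integral_nonneg fun y => by positivity
  have nD : 0 ≤ ∫ y, df k a0 a1 a2 b0 b1 b2 y ^2 ∂mI := integral_nonneg fun y => by positivity
  have g1 := D.energy
  have g2 := D.weighted (N1 := N1) (N2 := N1^2) (N3 := N3) le_rfl (by rw [hN1]; field_simp; rfl) (by positivity) le_rfl
  have g3 := D.kd
  set A2 := ∫ y, Z y * wf k a0 a1 b0 b1 y ^2 ∂mI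
  set W2 := ∫ y, wf k a0 a1 b0 b1 y ^2 ∂mI
  set D2 := ∫ y, df k a0 a1 a2 b0 b1 b2 y ^2 ∂mI
  set Rn := Real.sqrt (∫ y, r y ^2 ∂mI)
  set Rz := Real.sqrt (∫ y, Z y * r y ^2 ∂mI)
  set W := Real.sqrt W2 with hW
  set A := Real.sqrt A2 with hA
  set Dd := Real.sqrt D2 with hDd
  set x := Real.sqrt |k| with hx
  set Λ := Real.log (3/ε)
  have hRn0 : 0 ≤ Rn := Real.sqrt_nonneg _
  have hRz0 : 0 ≤ Rz := Real.sqrt_nonneg _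
  have hW0 : 0 ≤ W := Real.sqrt_nonneg _
  have hA0 : 0 ≤ A := Real.sqrt_nonneg _
  have hD0 : 0 ≤ Dd := Real.sqrt_nonneg _
  have hx0 : 0 < x := Real.sqrt_pos.2 (abs_pos.2 hk)
  have hx2 : x^2 = |k| := Real.sq_sqrt (abs_nonneg k)
  have hW2 : W2 = W^2 := (Real.sq_sqrt nW).symm
  have hA2 : A2 = A^2 := (Real.sq_sqrt nA).symm
  have hD2 : D2 = Dd^2 := (Real.sq_sqrt nD).symm
  have hΛ : 1 ≤ Λ := log3_ge hε D.hε1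
  obtain ⟨e1, e2, e3, e4⟩ := q4 hε.le
  obtain ⟨m1, m2, m3, m4⟩ := q4 hM
  obtain ⟨r1, r2, r3, r4⟩ := q4 hRn0
  obtain ⟨w1, w2, w3, w4⟩ := q4 hW0
  have hh := H x A Dd (ε^((1:ℝ)/4)) (M^((1:ℝ)/4)) (Rn^((1:ℝ)/4)) (W^((1:ℝ)/4)) Rz Λ hx0 hA0 hD0
    (by positivity) (by positivity) (by positivity) (by positivity) hRz0 hΛ
  have w8 : (W^((1:ℝ)/4))^8 = W2 := by
    rw [hW2, show (8:ℕ) = 4*2 by norm_num, pow_mul, w1]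
  rw [e1, e2, m1, m2, m4, r1, w8, w1, w3, hx2, ← hA2, ← hD2] at hh
  refine hh g1 ?_ ?_
  · refine g2.trans ?_
    have t1 : Real.sqrt (18*W2) ≤ 5*W := by rw [hW2]; exact sq18 hW0
    have t2 := sqQ (K := K) (A2 := A2) (A := A) (ε := ε) (se := Real.sqrt ε) (W := W) (W2 := W2) (Λ := Λ)
      hK hA0 (Real.sqrt_nonneg _) hW0 (by linarith) hA2 (Real.sq_sqrt hε.le).symm hW2
    gcongr
  · refine le_of_sq_le_sq ?_ hD0
    rw [mul_pow, sq_abs, ← hW2, ← hD2]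
    exact g3


lemma ab_ml {M t : ℝ} {A0 A1 h g : ℂ} {w : ℝ} (hA0 : ‖A0‖ ≤ M*t) (hA1 : ‖A1‖ ≤ M*t) (hw : ‖h‖+‖g‖ ≤ w) (hMt : 0 ≤ M*t) :
    ‖A0*h+A1*g‖ ≤ M*t*w := by
  calc ‖A0*h+A1*g‖ ≤ ‖A0*h‖+‖A1*g‖ := norm_add_le _ _
    _ = ‖A0‖*‖h‖+‖A1‖*‖g‖ := by rw [norm_mul, norm_mul]
    _ ≤ M*t*‖h‖+M*t*‖g‖ := by gcongr
    _ = M*t*(‖h‖+‖g‖) := by ring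
    _ ≤ _ := by gcongr

lemma Nbd_D {se L t X y : ℝ} {ψ D0 : ℂ} (hse : 0 < se) (hy : 0 < y) (ht : t = (1+y/se)⁻¹) (hL : 0 ≤ L)
    (hD : ‖D0‖ ≤ L*t^2) (hψ : ‖ψ‖ ≤ X) : ‖((se⁻¹:ℝ):ℂ)*ψ*D0‖ ≤ L*t*(X/y) := by
  have h1 : 0 < 1+y/se := by positivity
  have ht0 : 0 ≤ t := by rw [ht]; positivity
  have hX : 0 ≤ X := (norm_nonneg _).trans hψ
  have hts : t*se⁻¹ ≤ y⁻¹ := by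
    rw [ht, ← mul_inv]
    refine inv_anti₀ hy ?_
    have : (1+y/se)*se = se+y := by field_simp
    rw [this]; linarith
  rw [norm_mul, norm_mul, Complex.norm_real, Real.norm_of_nonneg (by positivity)]
  calc se⁻¹*‖ψ‖*‖D0‖ ≤ se⁻¹*X*(L*t^2) := by gcongr
    _ = L*t*X*(t*se⁻¹) := by ring
    _ ≤ L*t*X*y⁻¹ := by gcongr
    _ = _ := by ring

lemma Nbd1 {k se M t w d X y : ℝ} {A0 A1 B0 B1 C0 C1 D0 h g h' g' ψ : ℂ} (hse : 0 < se) (hy : 0 < y)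
    (ht : t = (1+y/se)⁻¹) (hM : 0 ≤ M) (hA0 : ‖A0‖ ≤ M*t) (hA1 : ‖A1‖ ≤ M*t) (hB0 : ‖B0‖ ≤ M*t) (hB1 : ‖B1‖ ≤ M*t)
    (hC0 : ‖C0‖ ≤ M*(1+M)*t) (hC1 : ‖C1‖ ≤ M*(1+M)*t) (hD : ‖D0‖ ≤ M*(1+M)*t^2)
    (hw : ‖h‖+‖g‖ ≤ w) (hkw : |k| * w ≤ d) (hd : ‖h'‖+‖g'‖ ≤ d) (hψ : ‖ψ‖ ≤ X) :
    ‖Complex.I*(k:ℂ)*((se:ℂ)*(A0*h+A1*g)) + (se:ℂ)*(B0*h'+B1*g') + (C0*h+C1*g) + ((se⁻¹:ℝ):ℂ)*ψ*D0‖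
      ≤ t*(2*(se*M*d)+M*(1+M)*(w+X/y)) := by
  have ht0 : 0 ≤ t := by rw [ht]; positivity
  have n1 : ‖Complex.I*(k:ℂ)*((se:ℂ)*(A0*h+A1*g))‖ ≤ t*(se*M*d) := by
    rw [norm_mul, norm_mul, norm_mul, Complex.norm_I, one_mul, Complex.norm_real, Complex.norm_real,
      Real.norm_of_nonneg hse.le, Real.norm_eq_abs]
    have := ab_ml hA0 hA1 hw (by positivity)
    calc |k| * (se*‖A0*h+A1*g‖) ≤ |k| * (se*(M*t*w)) := by gcongr
      _ = t*(se*M*(|k| * w)) := by ring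
      _ ≤ _ := by gcongr
  have n2 : ‖(se:ℂ)*(B0*h'+B1*g')‖ ≤ t*(se*M*d) := by
    rw [norm_mul, Complex.norm_real, Real.norm_of_nonneg hse.le]
    have := ab_ml hB0 hB1 hd (by positivity)
    calc se*‖B0*h'+B1*g'‖ ≤ se*(M*t*d) := by gcongr
      _ = _ := by ring
  have n3 := ab_ml hC0 hC1 hw (by positivity)
  have n4 := Nbd_D hse hy ht (by positivity) hD hψ
  refine (norm_add_le _ _).trans ?_
  have := norm_add₃_le (a := Complex.I*(k:ℂ)*((se:ℂ)*(A0*h+A1*g))) (b := (se:ℂ)*(B0*h'+B1*g')) (c := (C0*h+C1*g))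
  linarith

lemma Nbd3 {se M t w d X y b Kb : ℝ} {C0 C1 D0 h g h' ψ : ℂ} (hse : 0 < se) (hy : 0 < y)
    (ht : t = (1+y/se)⁻¹) (hM : 0 ≤ M)
    (hC0 : ‖C0‖ ≤ M*(1+M)*t) (hC1 : ‖C1‖ ≤ M*(1+M)*t) (hD : ‖D0‖ ≤ M*(1+M)*t^2) (hb : |b| ≤ Kb*(se*(M*t)))
    (hw : ‖h‖+‖g‖ ≤ w) (hd : ‖h'‖ ≤ d) (hψ : ‖ψ‖ ≤ X) :
    ‖-((b:ℂ)*h') + (C0*h+C1*g) + ((se⁻¹:ℝ):ℂ)*ψ*D0‖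
      ≤ t*(Kb*(se*M*d)+M*(1+M)*(w+X/y)) := by
  have ht0 : 0 ≤ t := by rw [ht]; positivity
  have n1 : ‖-((b:ℂ)*h')‖ ≤ t*(Kb*(se*M*d)) := by
    rw [norm_neg, norm_mul, Complex.norm_real, Real.norm_eq_abs]
    calc |b| * ‖h'‖ ≤ Kb*(se*(M*t)) * d := mul_le_mul hb hd (norm_nonneg _) ((abs_nonneg _).trans hb)
      _ = _ := by ring
  have n3 := ab_ml hC0 hC1 hw (by positivity)
  have n4 := Nbd_D hse hy ht (by positivity) hD hψ
  have := norm_add₃_le (a := -((b:ℂ)*h')) (b := (C0*h+C1*g)) (c := ((se⁻¹:ℝ):ℂ)*ψ*D0)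
  linarith

lemma ML_memLp {f : ℝ → ℂ} (h : IntegrableOn (fun y => ‖f y‖^2) (Ioi 0)) : MemLp (fun y => ‖f y‖) 2 mI := by
  have hm : AEStronglyMeasurable (fun y => ‖f y‖) mI := by
    have := Real.continuous_sqrt.comp_aestronglyMeasurable (h.aestronglyMeasurable)
    refine this.congr (Eventually.of_forall fun y => ?_)
    exact Real.sqrt_sq (norm_nonneg _)
  exact (memLp_two_iff_integrable_sq hm).2 h

/-- equality of integrals of four squares with weight -/
lemma four_le {Z : ℝ → ℝ} {f1 f2 f3 f4 : ℝ → ℂ} {w : ℝ → ℝ} (hZ : ∀ y, 0 < y → 0 ≤ Z y)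
    (h1 : IntegrableOn (fun y => Z y * ‖f1 y‖^2) (Ioi 0)) (h2 : IntegrableOn (fun y => Z y * ‖f2 y‖^2) (Ioi 0))
    (h3 : IntegrableOn (fun y => Z y * ‖f3 y‖^2) (Ioi 0)) (h4 : IntegrableOn (fun y => Z y * ‖f4 y‖^2) (Ioi 0))
    (hw : IntegrableOn (fun y => Z y * w y ^2) (Ioi 0))
    (hwe : ∀ y, 0 < y → w y = ‖f1 y‖+‖f2 y‖+‖f3 y‖+‖f4 y‖) :
    (∫ y, Z y * ‖f1 y‖^2 ∂mI) + (∫ y, Z y * ‖f2 y‖^2 ∂mI) + (∫ y, Z y * ‖f3 y‖^2 ∂mI) + (∫ y, Z y * ‖f4 y‖^2 ∂mI)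
      ≤ ∫ y, Z y * w y ^2 ∂mI ∧
    ∫ y, Z y * w y ^2 ∂mI ≤ 4 * ((∫ y, Z y * ‖f1 y‖^2 ∂mI) + (∫ y, Z y * ‖f2 y‖^2 ∂mI) + (∫ y, Z y * ‖f3 y‖^2 ∂mI) + (∫ y, Z y * ‖f4 y‖^2 ∂mI)) := by
  have e : (∫ y, Z y * ‖f1 y‖^2 ∂mI) + (∫ y, Z y * ‖f2 y‖^2 ∂mI) + (∫ y, Z y * ‖f3 y‖^2 ∂mI) + (∫ y, Z y * ‖f4 y‖^2 ∂mI)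
    = ∫ y, (Z y * ‖f1 y‖^2 + Z y * ‖f2 y‖^2 + Z y * ‖f3 y‖^2 + Z y * ‖f4 y‖^2) ∂mI := by
    rw [integral_add (iadd (iadd h1 h2) h3) h4, integral_add (iadd h1 h2) h3, integral_add h1 h2]
  have hs := iadd (iadd (iadd h1 h2) h3) h4
  rw [e, ← integral_const_mul]
  constructor
  · refine setIntegral_mono_on hs hw measurableSet_Ioi fun y hy => ?_
    rw [hwe y hy]
    have := hZ y hy
    have a1 := norm_nonneg (f1 y)
    have a2 := norm_nonneg (f2 y)
    have a3 := norm_nonneg (f3 y)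
    have a4 := norm_nonneg (f4 y)
    generalize ‖f1 y‖ = a at *
    generalize ‖f2 y‖ = b at *
    generalize ‖f3 y‖ = c at *
    generalize ‖f4 y‖ = d at *
    have e : Z y*(a+b+c+d)^2 = (Z y*a^2+Z y*b^2+Z y*c^2+Z y*d^2) + Z y*(2*(a*b+a*c+a*d+b*c+b*d+c*d)) := by ring
    rw [e]
    have : 0 ≤ Z y*(2*(a*b+a*c+a*d+b*c+b*d+c*d)) := by positivity
    linarith
  · refine setIntegral_mono_on hw (hs.const_mul 4) measurableSet_Ioi fun y hy => ?_
    rw [hwe y hy]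
    have := hZ y hy
    generalize ‖f1 y‖ = a at *
    generalize ‖f2 y‖ = b at *
    generalize ‖f3 y‖ = c at *
    generalize ‖f4 y‖ = d at *
    have e : 4*(Z y*a^2+Z y*b^2+Z y*c^2+Z y*d^2) = Z y*(a+b+c+d)^2 + Z y*((a-b)^2+(a-c)^2+(a-d)^2+(b-c)^2+(b-d)^2+(c-d)^2) := by ring
    rw [e]
    have : 0 ≤ Z y*((a-b)^2+(a-c)^2+(a-d)^2+(b-c)^2+(b-d)^2+(c-d)^2) := by positivity
    linarith

lemma fin_log {ε η : ℝ} (hε : 0 < ε) (h1 : ε ≤ Real.exp (-1)) (hη : 0 < η) :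
    Real.log (3/ε) ≤ 3 * |Real.log ε| ^ (1+η/3) := by
  have hl : Real.log ε ≤ -1 := (Real.log_le_iff_le_exp hε).2 h1
  have ha : |Real.log ε| = -Real.log ε := abs_of_neg (by linarith)
  rw [Real.log_div (by norm_num) hε.ne']
  have h3 : Real.log 3 ≤ 2 := by
    have := Real.log_le_sub_one_of_pos (by norm_num : (0:ℝ) < 3); linarith
  have hL : 1 ≤ |Real.log ε| := by rw [ha]; linarith
  have : |Real.log ε| ^ (1:ℝ) ≤ |Real.log ε| ^ (1+η/3) := Real.rpow_le_rpow_of_exponent_le hL (by linarith)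
  rw [Real.rpow_one] at this
  linarith

/-- final comparison of the right-hand sides -/
lemma fin_cmp {C x Λ L Rz Rz' e sM Rn Rn' W W' m m5 P T2 : ℝ} (hC : 0 < C) (hx : 0 < x) (hRz' : 0 ≤ Rz') (hRz : 0 ≤ Rz)
    (hL : 0 ≤ L)
    (he : 0 ≤ e) (hsM : 0 ≤ sM) (hRn : 0 ≤ Rn) (hRn' : 0 ≤ Rn') (hW : 0 ≤ W) (hW' : 0 ≤ W') (hm : 0 ≤ m) (hm5 : 0 ≤ m5)
    (hΛ : Λ ≤ 3*L) (h1 : Rz ≤ 2*Rz') (h2 : Rn ≤ 2*Rn') (h3 : W ≤ 2*W') (hT2 : 0 ≤ T2)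
    (h : P ≤ C*(x⁻¹*Λ*Rz + (e*(1+sM)*Rn^((1:ℝ)/4)*W^((3:ℝ)/4) + e*m*(1+m5)*W))) :
    P ≤ (6*C)*x⁻¹*L*Rz' + T2 + (6*C)*e*(1+sM)*Rn'^((1:ℝ)/4)*W'^((3:ℝ)/4) + (6*C)*e*m*(1+m5)*W' := by
  have r1 : Rn^((1:ℝ)/4) ≤ 2*Rn'^((1:ℝ)/4) := by
    calc Rn^((1:ℝ)/4) ≤ (2*Rn')^((1:ℝ)/4) := Real.rpow_le_rpow hRn h2 (by norm_num)
      _ = (2:ℝ)^((1:ℝ)/4)*Rn'^((1:ℝ)/4) := Real.mul_rpow (by norm_num) hRn'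
      _ ≤ (2:ℝ)^(1:ℝ)*Rn'^((1:ℝ)/4) := by
        gcongr <;> norm_num
      _ = _ := by rw [Real.rpow_one]
  have r2 : W^((3:ℝ)/4) ≤ 2*W'^((3:ℝ)/4) := by
    calc W^((3:ℝ)/4) ≤ (2*W')^((3:ℝ)/4) := Real.rpow_le_rpow hW h3 (by norm_num)
      _ = (2:ℝ)^((3:ℝ)/4)*W'^((3:ℝ)/4) := Real.mul_rpow (by norm_num) hW'
      _ ≤ (2:ℝ)^(1:ℝ)*W'^((3:ℝ)/4) := by
        gcongr <;> norm_num
      _ = _ := by rw [Real.rpow_one]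
  have q1 : x⁻¹*Λ*Rz ≤ x⁻¹*(3*L)*(2*Rz') := by gcongr
  have q2 : e*(1+sM)*Rn^((1:ℝ)/4)*W^((3:ℝ)/4) ≤ e*(1+sM)*(2*Rn'^((1:ℝ)/4))*(2*W'^((3:ℝ)/4)) := by gcongr
  have q3 : e*m*(1+m5)*W ≤ e*m*(1+m5)*(2*W') := by gcongr
  have z2 : 0 ≤ e*(1+sM)*Rn'^((1:ℝ)/4)*W'^((3:ℝ)/4) := by positivity
  have z3 : 0 ≤ e*m*(1+m5)*W' := by positivity
  calc P ≤ _ := h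
    _ ≤ C*(x⁻¹*(3*L)*(2*Rz') + (e*(1+sM)*(2*Rn'^((1:ℝ)/4))*(2*W'^((3:ℝ)/4)) + e*m*(1+m5)*(2*W'))) := by gcongr
    _ = 6*C*x⁻¹*L*Rz' + 4*C*(e*(1+sM)*Rn'^((1:ℝ)/4)*W'^((3:ℝ)/4)) + 2*C*(e*m*(1+m5)*W') := by ring
    _ ≤ 6*C*x⁻¹*L*Rz' + 6*C*(e*(1+sM)*Rn'^((1:ℝ)/4)*W'^((3:ℝ)/4)) + 6*C*(e*m*(1+m5)*W') := by gcongr <;> norm_num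
    _ ≤ _ := by linarith


lemma strm {k : ℝ} {u v : ℝ → ℂ} (hu : ContDiff ℝ 3 u) (hv : ContDiff ℝ 3 v)
    (h : ∀ y, 0 < y → Complex.I * (k:ℂ) * u y + deriv v y = 0) (hv0 : v 0 = 0) :
    (∀ y, 0 < y → v y = -Complex.I*k*(∫ s in (0:ℝ)..y, u s)) ∧ (∀ y, 0 < y → deriv v y = -Complex.I*k*u y) ∧
    (∀ y, 0 < y → deriv (deriv v) y = -Complex.I*k*deriv u y) := by
  have h1 : ∀ y, 0 < y → deriv v y = -Complex.I*k*u y := fun y hy => by linear_combination h y hy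
  refine ⟨fun y hy => ?_, h1, fun y hy => ?_⟩
  · have hd : ∀ x, HasDerivAt v (deriv v x) x := fun x => (hv.differentiable (by norm_num) x).hasDerivAt
    have hc : Continuous (deriv v) := hv.continuous_deriv (by norm_num)
    have := intervalIntegral.integral_eq_sub_of_hasDerivAt (a := 0) (b := y) (fun x _ => hd x) (hc.intervalIntegrable _ _)
    rw [hv0, sub_zero] at this
    rw [← this, ← intervalIntegral.integral_const_mul]
    refine intervalIntegral.integral_congr_ae (Eventually.of_forall fun x hx => ?_)
    rw [uIoc_of_le hy.le] at hx
    exact h1 x hx.1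
  · have : deriv v =ᶠ[nhds y] fun x => -Complex.I*k*u x := by
      filter_upwards [Ioi_mem_nhds hy] with x hx using h1 x hx
    rw [this.deriv_eq, deriv_const_mul _ (hu.differentiable (by norm_num) y)]

lemma dfs {u : ℝ → ℂ} (hu : ContDiff ℝ 3 u) :
    (∀ y, HasDerivAt (fun y => ∫ s in (0:ℝ)..y, u s) (u y) y) ∧ (∀ y, HasDerivAt u (deriv u y) y) ∧
    (∀ y, HasDerivAt (deriv u) (deriv (deriv u) y) y) := by
  refine ⟨fun y => ?_, fun y => (hu.differentiable (by norm_num) y).hasDerivAt, fun y => ?_⟩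
  · exact (hu.continuous.integral_hasStrictDerivAt 0 y).hasDerivAt
  · have : ContDiff ℝ 2 (deriv u) := by
      have h : ContDiff ℝ (2+1) u := by norm_num; exact hu
      exact (contDiff_succ_iff_deriv.1 h).2.2
    exact (this.differentiable (by norm_num) y).hasDerivAt

lemma dZs {Z : ℝ → ℝ} (hZ : ContDiff ℝ 2 Z) :
    (∀ y, HasDerivAt Z (deriv Z y) y) ∧ (∀ y, HasDerivAt (deriv Z) (deriv (deriv Z) y) y) := by
  refine ⟨fun y => (hZ.differentiable (by norm_num) y).hasDerivAt, fun y => ?_⟩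
  have : ContDiff ℝ 1 (deriv Z) := by
    have h : ContDiff ℝ (1+1) Z := by norm_num; exact hZ
    exact (contDiff_succ_iff_deriv.1 h).2.2
  exact (this.differentiable (by norm_num) y).hasDerivAt

lemma dcf {U : ℝ → ℝ} (se : ℝ) (hU : ContDiff ℝ 3 U) (y : ℝ) :
    HasDerivAt (fun y => U (y/se)) (deriv U (y/se)/se) y := by
  have h1 := (hU.differentiable (by norm_num) (y/se)).hasDerivAt
  have h2 : HasDerivAt (fun y : ℝ => y/se) (1/se) y := (hasDerivAt_id y).div_const se
  have := h1.comp y h2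
  simpa [Function.comp_def, div_eq_mul_inv] using this

/-- derivative of the coefficient -/
def Gd (Us Hs : ℝ → ℝ) (se y : ℝ) : ℝ := (2*Hs (y/se)*deriv Hs (y/se) - 2*Us (y/se)*deriv Us (y/se))/se

lemma dGf {Us Hs : ℝ → ℝ} (se : ℝ) (hU : ContDiff ℝ 3 Us) (hH : ContDiff ℝ 3 Hs) (y : ℝ) :
    HasDerivAt (fun y => Hs (y/se)^2 - Us (y/se)^2) (Gd Us Hs se y) y := by
  have := ((dcf se hH y).pow 2).sub ((dcf se hU y).pow 2)
  refine this.congr_deriv ?_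
  unfold Gd
  simp only [Nat.cast_ofNat]
  ring

section
variable {μ κ γ γbar γ₀ C₀ ε M K : ℝ} {Us Hs Z : ℝ → ℝ}

lemma co1 (hbd : ∀ Y, 0 ≤ Y → ∀ k : ℕ, 1 ≤ k → k ≤ 3 →
        (1 + Y)^3 * (|iteratedDeriv k Us Y| + |iteratedDeriv k Hs Y|) ≤ M) (Y : ℝ) (hY : 0 ≤ Y) :
     (1+Y) * (|deriv Us Y|+|deriv Hs Y|) ≤ M := by
  have h := hbd Y hY 1 le_rfl (by norm_num)
  simp only [iteratedDeriv_one] at h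
  refine le_trans ?_ h
  gcongr
  exact le_self_pow₀ (by linarith) (by norm_num)

lemma co2 (hH : ∀ Y, 0 ≤ Y → γ ≤ |Hs Y| ∧ |Hs Y| ≤ γbar) (hγ₀ : 0 < γ₀) 
    (hG : ∀ Y, 0 ≤ Y → γ₀ ≤ Hs Y ^ 2 - Us Y ^ 2) (Y : ℝ) (hY : 0 ≤ Y) :
    |Us Y| ≤ γbar ∧ |Hs Y^2-Us Y^2| ≤ γbar^2 := by
  have h1 := (hH Y hY).2
  have h2 := hG Y hY
  have h0 := (abs_nonneg _).trans h1
  have h3 : Hs Y^2 ≤ γbar^2 := by rw [← sq_abs]; gcongr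
  constructor
  · refine abs_le_of_sq_le_sq (by linarith) h0
  · rw [abs_of_nonneg (by linarith)]
    linarith [sq_nonneg (Us Y)]

lemma co3 (hH : ∀ Y, 0 ≤ Y → γ ≤ |Hs Y| ∧ |Hs Y| ≤ γbar) (hγ₀ : 0 < γ₀) 
    (hG : ∀ Y, 0 ≤ Y → γ₀ ≤ Hs Y ^ 2 - Us Y ^ 2)
    (hd : ∀ Y, 0 ≤ Y → (1+Y) * (|deriv Us Y|+|deriv Hs Y|) ≤ M) {se y : ℝ} (hse : 0 < se) (hy : 0 < y) :
    y * |Gd Us Hs se y| ≤ 2*γbar*M ∧ se * |Gd Us Hs se y| ≤ 2*γbar*M ∧ y * |deriv Us (y/se)/se| ≤ M := by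
  have hY : 0 ≤ y/se := by positivity
  have h1 := (hH _ hY).2
  have h2 := (co2 hH hγ₀ hG _ hY).1
  have h3 := hd _ hY
  have h0 := (abs_nonneg _).trans h1
  set Y := y/se with hYd
  have hD : 0 ≤ |deriv Us Y|+|deriv Hs Y| := by positivity
  have e1 : se * |Gd Us Hs se y| = |2*Hs Y*deriv Hs Y - 2*Us Y*deriv Us Y| := by
    unfold Gd
    rw [abs_div, abs_of_pos hse]; field_simp
    rw [hYd]
  have e2 : |2*Hs Y*deriv Hs Y - 2*Us Y*deriv Us Y| ≤ 2*γbar*(|deriv Us Y|+|deriv Hs Y|) := by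
    refine (abs_sub _ _).trans ?_
    rw [abs_mul, abs_mul, abs_mul, abs_mul, abs_two]
    have : 2*|Hs Y| * |deriv Hs Y| ≤ 2*γbar*|deriv Hs Y| := by gcongr
    have : 2*|Us Y| * |deriv Us Y| ≤ 2*γbar*|deriv Us Y| := by gcongr
    linarith
  have hy' : y = Y*se := by rw [hYd]; field_simp
  have hYM : Y*(|deriv Us Y|+|deriv Hs Y|) ≤ M := by linarith
  have hM : |deriv Us Y|+|deriv Hs Y| ≤ M := by nlinarith
  refine ⟨?_, ?_, ?_⟩
  · calc y * |Gd Us Hs se y| = Y*(se * |Gd Us Hs se y|) := by rw [hy']; ring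
      _ ≤ Y*(2*γbar*(|deriv Us Y|+|deriv Hs Y|)) := by rw [e1]; gcongr
      _ = 2*γbar*(Y*(|deriv Us Y|+|deriv Hs Y|)) := by ring
      _ ≤ _ := by gcongr
  · rw [e1]; exact e2.trans (by gcongr)
  · rw [abs_div, abs_of_pos hse]
    calc y*(|deriv Us Y|/se) = Y*|deriv Us Y| := by rw [hYd]; field_simp
      _ ≤ Y*(|deriv Us Y|+|deriv Hs Y|) := by gcongr; linarith [abs_nonneg (deriv Hs Y)]
      _ ≤ M := hYM

lemma coZ (hC₀ : 1 ≤ C₀) (h1 : ∀ y, 0 ≤ y → 0 ≤ Z y ∧ Z y ≤ C₀ ∧ 0 ≤ deriv Z y)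
    (h2 : ∀ y ∈ Set.Icc (0:ℝ) 2, C₀⁻¹ * y ≤ Z y ∧ Z y ≤ C₀ * y) (h3 : ∀ y, 2 ≤ y → Z y = Z 2) :
    (∀ y, 0 < y → Z y ≤ C₀*y) ∧ (∀ y, 0 < y → 0 < Z y) ∧ (∀ y, 0 < y → y ≤ 2 → y ≤ C₀*Z y) ∧
    (∀ y, 2 < y → deriv Z y = 0 ∧ deriv (deriv Z) y = 0) ∧ Z 0 = 0 := by
  have hc : 0 < C₀ := by linarith
  refine ⟨fun y hy => ?_, fun y hy => ?_, fun y hy hy2 => ?_, fun y hy => ?_, ?_⟩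
  · rcases le_total y 2 with h | h
    · exact (h2 y ⟨hy.le, h⟩).2
    · refine (h1 y hy.le).2.1.trans ?_
      nlinarith
  · rcases le_total y 2 with h | h
    · exact lt_of_lt_of_le (by positivity) (h2 y ⟨hy.le, h⟩).1
    · rw [h3 y h]
      exact lt_of_lt_of_le (by positivity) (h2 2 ⟨by norm_num, le_rfl⟩).1
  · have := (h2 y ⟨hy.le, hy2⟩).1
    calc y = C₀*(C₀⁻¹*y) := by field_simp
      _ ≤ _ := by gcongr
  · have g : ∀ x, 2 < x → deriv Z x = 0 := by
      intro x hx
      have : Z =ᶠ[nhds x] fun _ => Z 2 := by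
        filter_upwards [Ioi_mem_nhds hx] with t ht using h3 t (le_of_lt ht)
      rw [this.deriv_eq]; simp
    refine ⟨g y hy, ?_⟩
    have : deriv Z =ᶠ[nhds y] fun _ => 0 := by
      filter_upwards [Ioi_mem_nhds hy] with t ht using g t ht
    rw [this.deriv_eq]; simp
  · have := (h2 0 ⟨le_rfl, by norm_num⟩)
    simp at this
    linarith [this.1, this.2]

lemma coA {G G1 : ℝ → ℝ} (hZ : ContDiff ℝ 2 Z) (hGd : ∀ y, HasDerivAt G (G1 y) y)
    (h1 : ∀ y ∈ Set.Icc (0:ℝ) 1, G y * deriv Z y = 1)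
    (h2 : ∀ y, 1 ≤ y → -(C₀*M*ε) ≤ -(deriv (fun t => G t * deriv Z t) y))
    (h3 : ∀ y, 2 < y → deriv Z y = 0 ∧ deriv (deriv Z) y = 0) (hK : C₀ ≤ K) (hM : 0 ≤ M) (hε : 0 < ε) (y : ℝ) (hy : 0 < y) :
    0 ≤ -(G1 y*deriv Z y+G y*deriv (deriv Z) y) ∨ (G1 y*deriv Z y+G y*deriv (deriv Z) y ≤ K*(M*ε) ∧ y ≤ 2) := by
  have hd := ((hGd y).mul ((dZs hZ).2 y))
  have hd' : deriv (fun t => G t * deriv Z t) y = G1 y*deriv Z y+G y*deriv (deriv Z) y := hd.deriv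
  rw [← hd']
  rcases lt_or_ge y 1 with h | h
  · left
    have : (fun t => G t * deriv Z t) =ᶠ[nhds y] fun _ => 1 := by
      filter_upwards [Ioo_mem_nhds hy h] with t ht using h1 t ⟨ht.1.le, ht.2.le⟩
    rw [this.deriv_eq]; simp
  · rcases le_or_gt y 2 with h' | h'
    · right
      refine ⟨?_, h'⟩
      have := h2 y h
      have : C₀*(M*ε) ≤ K*(M*ε) := by gcongr
      linarith
    · left
      rw [hd', (h3 y h').1, (h3 y h').2]; simp
end


lemma t_bd {Y a b L : ℝ} (hY : 0 ≤ Y) (ha : 0 ≤ a) (hb : 0 ≤ b) (h : (1+Y)*(a+b) ≤ L) :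
    a ≤ L*(1+Y)⁻¹ ∧ b ≤ L*(1+Y)⁻¹ := by
  have hp : 0 < 1+Y := by linarith
  rw [← div_eq_mul_inv, le_div_iff₀ hp, le_div_iff₀ hp]
  constructor <;> nlinarith [mul_nonneg hp.le ha, mul_nonneg hp.le hb]

lemma t2_bd {Y a b L : ℝ} (hY : 0 ≤ Y) (ha : 0 ≤ a) (hb : 0 ≤ b) (h : (1+Y)^2*(a+b) ≤ L) :
    a ≤ L*(1+Y)⁻¹^2 ∧ b ≤ L*(1+Y)⁻¹^2 := by
  have hp : 0 < (1+Y)^2 := by positivity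
  rw [inv_pow, ← div_eq_mul_inv, le_div_iff₀ hp, le_div_iff₀ hp]
  constructor <;> nlinarith [mul_nonneg hp.le ha, mul_nonneg hp.le hb]

lemma bp_bd {κ γ se M Y x z : ℝ} (hκ : 0 < κ) (hγ : 0 < γ) (hse : 0 < se) (hx : γ ≤ |x|) (hz : |z| ≤ M*(1+Y)⁻¹) :
    |2*κ*se*(z/x)| ≤ 2*κ/γ*(se*(M*(1+Y)⁻¹)) := by
  rw [abs_mul, abs_div, abs_of_pos (by positivity : 0 < 2*κ*se)]
  calc 2*κ*se*(|z|/|x|) ≤ 2*κ*se*(M*(1+Y)⁻¹/γ) := by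
        have := (abs_nonneg _).trans hz
        gcongr
    _ = _ := by ring

lemma nk_eq {k : ℝ} {z : ℂ} : ‖-Complex.I*(k:ℂ)*z‖ = |k| * ‖z‖ := by
  rw [norm_mul, norm_mul, norm_neg, Complex.norm_I, one_mul, Complex.norm_real, Real.norm_eq_abs]

lemma ten_le {f g : ℝ → ℝ} {c : ℝ} (h : Tendsto g atTop (nhds 0)) (h0 : ∀ y, 0 ≤ f y) (hfg : ∀ y, 0 < y → f y ≤ c * g y) :
    Tendsto f atTop (nhds 0) := by
  have h2 : Tendsto (fun y => c * g y) atTop (nhds 0) := by simpa using h.const_mul c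
  exact squeeze_zero' (Eventually.of_forall h0) ((eventually_gt_atTop 0).mono hfg) h2

lemma nn_a {Kb t S w' L q : ℝ} (ht : 0 ≤ t) (hS : 0 ≤ S) (hw : 0 ≤ L*w') (hq : q ≤ Kb) (h1 : 1 ≤ Kb) :
    t*(q*S+L*w') ≤ Kb*(t*(S+L*w')) := by
  calc t*(q*S+L*w') ≤ t*(Kb*S+Kb*(L*w')) := by
        refine mul_le_mul_of_nonneg_left ?_ ht
        have := mul_le_mul_of_nonneg_right hq hS
        have := mul_le_mul_of_nonneg_right h1 hw
        linarith
    _ = _ := by ring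

lemma hn_a {Kb K t S y se : ℝ} (hKb0 : 0 ≤ Kb) (hKb : Kb ≤ K) (hS : 0 ≤ S) (hy : 0 < y) (hse : 0 < se) (ht : t = (1+y/se)⁻¹) :
    Kb*(t*S) ≤ K*S ∧ y*(Kb*(t*S)) ≤ K*se*S ∧ 0 ≤ Kb*(t*S) := by
  have h1 : 0 < 1+y/se := by positivity
  have ht0 : 0 ≤ t := by rw [ht]; positivity
  have ht1 : t ≤ 1 := by rw [ht]; exact inv_le_one_of_one_le₀ (by have : 0 ≤ y/se := by positivity
                                                                  linarith)
  have hyt : y*t ≤ se := by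
    rw [ht, ← div_eq_mul_inv, div_le_iff₀ h1]
    have : se*(1+y/se) = se+y := by field_simp
    rw [this]; linarith
  have hK0 : 0 ≤ K := hKb0.trans hKb
  refine ⟨?_, ?_, by positivity⟩
  · calc Kb*(t*S) ≤ K*(1*S) := by gcongr
      _ = _ := by ring
  · calc y*(Kb*(t*S)) = Kb*(y*t)*S := by ring
      _ ≤ K*se*S := by gcongr

/-- the nonlinear remainder majorant -/
def nnf (Kb k ε M : ℝ) (a0 a1 a2 b0 b1 b2 : ℝ → ℂ) : ℝ → ℝ := fun y =>
  Kb*((1+y/Real.sqrt ε)⁻¹*(Real.sqrt ε*M*df k a0 a1 a2 b0 b1 b2 y + M*(1+M)*af k a0 a1 b0 b1 y))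

/-- primitive -/
def prim (u : ℝ → ℂ) : ℝ → ℂ := fun y => ∫ s in (0:ℝ)..y, u s

set_option maxHeartbeats 2000000 in
lemma mkDat {μ κ γ γbar γ₀ C₀ ε k K c₀ M : ℝ} (hμ : 0 < μ) (hκ : 0 < κ)
    (hγ : 0 < γ) (hγγ : γ ≤ γbar) (hγ₀ : 0 < γ₀) (hC₀ : 1 ≤ C₀)
    (hKμ : μ ≤ K) (hKκ : κ ≤ K) (hKc : 1+μ/κ ≤ K) (hKγ : γbar ≤ K) (hKγ2 : γbar^2 ≤ K) (hKγ3 : 2*γbar ≤ K) (hKC : C₀ ≤ K)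
    (hKb : 2+2*κ/γ ≤ K) (hc0 : 0 < c₀) (hc1 : c₀ ≤ μ) (hc2 : c₀ ≤ κ*γ₀) (hc3 : c₀ ≤ γ₀)
    (hε : 0 < ε) (hε1 : ε ≤ 1) (hk : k ≠ 0)
    {Us Hs : ℝ → ℝ} (hU : ContDiff ℝ 3 Us) (hH : ContDiff ℝ 3 Hs)
    (hHs : ∀ Y, 0 ≤ Y → γ ≤ |Hs Y| ∧ |Hs Y| ≤ γbar)
    (hG : ∀ Y, 0 ≤ Y → γ₀ ≤ Hs Y ^ 2 - Us Y ^ 2)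
    (hbd : ∀ Y, 0 ≤ Y → ∀ k : ℕ, 1 ≤ k → k ≤ 3 →
        (1 + Y)^3 * (|iteratedDeriv k Us Y| + |iteratedDeriv k Hs Y|) ≤ M)
    {AU BU CU CH : ℝ → Matrix (Fin 2) (Fin 2) ℂ} {DU DH : ℝ → Fin 2 → ℂ}
    (hAB : ∀ Y, 0 ≤ Y → ∀ i j, (1 + Y) * (‖AU Y i j‖ + ‖BU Y i j‖) ≤ M)
    (hCC : ∀ Y, 0 ≤ Y → ∀ i j, (1 + Y) * (‖CU Y i j‖ + ‖CH Y i j‖) ≤ M * (1 + M))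
    (hDD : ∀ Y, 0 ≤ Y → ∀ i, (1 + Y)^2 * (‖DU Y i‖ + ‖DH Y i‖) ≤ M * (1 + M))
    {Z : ℝ → ℝ} (hZ : ContDiff ℝ 2 Z)
    (z1 : ∀ y, 0 ≤ y → 0 ≤ Z y ∧ Z y ≤ C₀ ∧ 0 ≤ deriv Z y)
    (z2 : ∀ y ∈ Set.Icc (0:ℝ) 2, C₀⁻¹ * y ≤ Z y ∧ Z y ≤ C₀ * y)
    (z3 : ∀ y, 2 ≤ y → Z y = Z 2)
    (z4 : ∀ y ∈ Set.Icc (0:ℝ) 1,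
        (Hs (y / Real.sqrt ε) ^ 2 - Us (y / Real.sqrt ε) ^ 2) * deriv Z y = 1)
    (z6 : ∀ y, 1 ≤ y → -(C₀ * M * ε) ≤
        -(deriv (fun t => (Hs (t / Real.sqrt ε) ^ 2 - Us (t / Real.sqrt ε) ^ 2)
            * deriv Z t) y))
    (z8 : ∀ y, 0 ≤ y → (1 + y) * |deriv Z y| ≤ C₀ ∧
        y * |deriv (deriv Z) y| ≤ C₀ * (M + 1))
    {u v h g p R1 R2 R3 R4 : ℝ → ℂ}
    (cu : ContDiff ℝ 3 u) (cv : ContDiff ℝ 3 v) (ch : ContDiff ℝ 3 h) (cg : ContDiff ℝ 3 g)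
    (cp : ContDiff ℝ 2 p)
    (m0 : MemLp (fun y => ‖u y‖) 2 mI ∧ MemLp (fun y => ‖v y‖) 2 mI ∧ MemLp (fun y => ‖h y‖) 2 mI ∧ MemLp (fun y => ‖g y‖) 2 mI)
    (m1 : MemLp (fun y => ‖deriv u y‖) 2 mI ∧ MemLp (fun y => ‖deriv h y‖) 2 mI)
    (l0 : Tendsto (fun y => ‖u y‖ + ‖v y‖ + ‖h y‖ + ‖g y‖) atTop (nhds 0))
    (l1 : Tendsto (fun y => ‖deriv u y‖ + ‖deriv v y‖ + ‖deriv h y‖ + ‖deriv g y‖)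
        atTop (nhds 0))
    (lp : Tendsto (fun y => ‖p y‖ * (‖u y‖ + ‖v y‖ + ‖h y‖ + ‖g y‖)) atTop (nhds 0))
    (mR : MemLp (fun y => ‖R1 y‖) 2 mI ∧ MemLp (fun y => ‖R2 y‖) 2 mI ∧ MemLp (fun y => ‖R3 y‖) 2 mI ∧ MemLp (fun y => ‖R4 y‖) 2 mI)
    (E1 : ∀ y, 0 < y →
        Complex.I * (k : ℂ) *
            ((((1 + μ/κ) * Us (y / Real.sqrt ε) : ℝ) : ℂ) * u y
              - ((Hs (y / Real.sqrt ε) ^ 2 - Us (y / Real.sqrt ε) ^ 2 : ℝ) : ℂ) * h y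
              + ((Real.sqrt ε : ℝ) : ℂ) *
                  (AU (y / Real.sqrt ε) 0 0 * h y + AU (y / Real.sqrt ε) 0 1 * g y))
          + ((Real.sqrt ε : ℝ) : ℂ) *
              (BU (y / Real.sqrt ε) 0 0 * deriv h y + BU (y / Real.sqrt ε) 0 1 * deriv g y)
          + (CU (y / Real.sqrt ε) 0 0 * h y + CU (y / Real.sqrt ε) 0 1 * g y)
          + (((Real.sqrt ε)⁻¹ : ℝ) : ℂ) * (∫ s in (0:ℝ)..y, h s) * DU (y / Real.sqrt ε) 0
          + Complex.I * (k : ℂ) * p y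
          - ((μ * ε : ℝ) : ℂ) *
              (deriv (deriv u) y - (k : ℂ)^2 * u y)
          = R1 y)
    (E2 : ∀ y, 0 < y →
        Complex.I * (k : ℂ) *
            ((((1 + μ/κ) * Us (y / Real.sqrt ε) : ℝ) : ℂ) * v y
              - ((Hs (y / Real.sqrt ε) ^ 2 - Us (y / Real.sqrt ε) ^ 2 : ℝ) : ℂ) * g y
              + ((Real.sqrt ε : ℝ) : ℂ) *
                  (AU (y / Real.sqrt ε) 1 0 * h y + AU (y / Real.sqrt ε) 1 1 * g y))
          + ((Real.sqrt ε : ℝ) : ℂ) *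
              (BU (y / Real.sqrt ε) 1 0 * deriv h y + BU (y / Real.sqrt ε) 1 1 * deriv g y)
          + (CU (y / Real.sqrt ε) 1 0 * h y + CU (y / Real.sqrt ε) 1 1 * g y)
          + (((Real.sqrt ε)⁻¹ : ℝ) : ℂ) * (∫ s in (0:ℝ)..y, h s) * DU (y / Real.sqrt ε) 1
          + deriv p y
          - ((μ * ε : ℝ) : ℂ) *
              (deriv (deriv v) y - (k : ℂ)^2 * v y)
          = R2 y)
    (E3 : ∀ y, 0 < y →
        -(Complex.I * (k : ℂ)) * u y
          - ((2 * κ * Real.sqrt ε *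
              (deriv Hs (y / Real.sqrt ε) / Hs (y / Real.sqrt ε)) : ℝ) : ℂ) * deriv h y
          + (CH (y / Real.sqrt ε) 0 0 * h y + CH (y / Real.sqrt ε) 0 1 * g y)
          + (((Real.sqrt ε)⁻¹ : ℝ) : ℂ) * (∫ s in (0:ℝ)..y, h s) * DH (y / Real.sqrt ε) 0
          - ((κ * ε : ℝ) : ℂ) *
              (deriv (deriv h) y - (k : ℂ)^2 * h y)
          = R3 y)
    (E4 : ∀ y, 0 < y →
        -(Complex.I * (k : ℂ)) * v y
          - ((2 * κ * Real.sqrt ε *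
              (deriv Hs (y / Real.sqrt ε) / Hs (y / Real.sqrt ε)) : ℝ) : ℂ) * deriv g y
          + (CH (y / Real.sqrt ε) 1 0 * h y + CH (y / Real.sqrt ε) 1 1 * g y)
          + (((Real.sqrt ε)⁻¹ : ℝ) : ℂ) * (∫ s in (0:ℝ)..y, h s) * DH (y / Real.sqrt ε) 1
          - ((κ * ε : ℝ) : ℂ) *
              (deriv (deriv g) y - (k : ℂ)^2 * g y)
          = R4 y)
    (dv : ∀ y, 0 < y →
        Complex.I * (k : ℂ) * u y + deriv v y = 0 ∧
        Complex.I * (k : ℂ) * h y + deriv g y = 0)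
    (u0 : u 0 = 0) (v0 : v 0 = 0) (h0 : deriv h 0 = 0) (g0 : g 0 = 0) :
    (∃ s F1 F2 F3 F4, Dat s k ε μ κ (1+μ/κ) M K c₀ (fun y => Us (y/Real.sqrt ε)) (fun y => deriv Us (y/Real.sqrt ε)/Real.sqrt ε)
      (fun y => Hs (y/Real.sqrt ε)^2 - Us (y/Real.sqrt ε)^2) (Gd Us Hs (Real.sqrt ε)) Z (deriv Z) (deriv (deriv Z))
      (prim u) u (deriv u) (deriv (deriv u)) (prim h) h (deriv h) (deriv (deriv h)) p (deriv p) F1 F2 F3 F4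
      (fun y => ‖R1 y‖+‖R2 y‖+‖R3 y‖+‖R4 y‖) (nnf (2+2*κ/γ) k ε M (prim u) u (deriv u) (prim h) h (deriv h))) ∧
    ∀ y, 0 < y → wf k (prim u) u (prim h) h y = ‖u y‖+‖v y‖+‖h y‖+‖g y‖ := by
  have hse : 0 < Real.sqrt ε := Real.sqrt_pos.2 hε
  have hse2 : Real.sqrt ε * Real.sqrt ε = ε := Real.mul_self_sqrt hε.le
  have hd := co1 hbd
  have hM : 0 ≤ M := by
    refine le_trans ?_ (hd 0 le_rfl); positivity
  have hK : 1 ≤ K := hC₀.trans hKC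
  have hKK : 0 ≤ K := by linarith
  obtain ⟨sv, sv1, sv2⟩ := strm cu cv (fun y hy => (dv y hy).1) v0
  obtain ⟨sg, sg1, sg2⟩ := strm ch cg (fun y hy => (dv y hy).2) g0
  have nv : ∀ y, 0 < y → ‖v y‖ = |k| * ‖prim u y‖ := fun y hy => by rw [sv y hy, nk_eq]; rfl
  have ng : ∀ y, 0 < y → ‖g y‖ = |k| * ‖prim h y‖ := fun y hy => by rw [sg y hy, nk_eq]; rfl
  have hka : 0 < |k| := abs_pos.2 hk
  have nv' : ∀ y, 0 < y → ‖prim u y‖ = |k|⁻¹ * ‖v y‖ := fun y hy => by rw [nv y hy]; field_simp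
  have ng' : ∀ y, 0 < y → ‖prim h y‖ = |k|⁻¹ * ‖g y‖ := fun y hy => by rw [ng y hy]; field_simp
  obtain ⟨cz1, cz2, cz3, cz4, cz5⟩ := coZ hC₀ z1 z2 z3
  obtain ⟨du0, du1, du2⟩ := dfs cu
  obtain ⟨dh0, dh1, dh2⟩ := dfs ch
  have hYp : ∀ y : ℝ, 0 < y → 0 ≤ y/Real.sqrt ε := fun y hy => by positivity
  have mprim : ∀ {f f' : ℝ → ℂ}, ContDiff ℝ 3 f → MemLp (fun y => ‖f' y‖) 2 mI → (∀ y, 0 < y → ‖prim f y‖ = |k|⁻¹ * ‖f' y‖) →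
      MemLp (fun y => ‖prim f y‖) 2 mI := by
    intro f f' hf hm he
    have hc : Continuous (prim f) := continuous_iff_continuousAt.2 fun y => ((dfs hf).1 y).continuousAt
    refine (hm.const_mul |k|⁻¹).congr_norm hc.norm.aestronglyMeasurable ?_
    refine (ae_restrict_iff' measurableSet_Ioi).2 (Eventually.of_forall fun y hy => ?_)
    rw [he y hy]
  have S : Sys k ε μ κ (1+μ/κ) M K (fun y => Us (y/Real.sqrt ε)) (fun y => deriv Us (y/Real.sqrt ε)/Real.sqrt ε)
      (fun y => Hs (y/Real.sqrt ε)^2 - Us (y/Real.sqrt ε)^2) (Gd Us Hs (Real.sqrt ε)) Z (deriv Z) (deriv (deriv Z))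
      (prim u) u (deriv u) (deriv (deriv u)) (prim h) h (deriv h) (deriv (deriv h)) p (deriv p) := by
    refine ⟨dcf _ hU, dGf _ hU hH, (dZs hZ).1, (dZs hZ).2, du0, du1, du2, dh0, dh1, dh2,
      fun y => (cp.differentiable (by norm_num) y).hasDerivAt, ?_, fun y hy => (z1 y hy.le).2.1.trans hKC,
      by simp [prim], by simp [prim], u0, h0, cz5, ?_, ?_, ?_, ?_, ?_, ?_, ?_, ?_⟩
    · intro y hy
      have c2 := co2 hHs hγ₀ hG _ (hYp y hy)
      have c3 := co3 hHs hγ₀ hG hd hse hy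
      have z8y := z8 y hy.le
      refine ⟨hε.le, hM, hK, hy, by rwa [abs_of_pos hμ], by rwa [abs_of_pos hκ], ?_, c2.1.trans hKγ, c2.2.trans hKγ2,
        (z1 y hy.le).1, (cz1 y hy).trans (by gcongr), (z1 y hy.le).2.2, ?_, ?_, c3.1.trans (by gcongr), c3.2.2.trans ?_⟩
      · rw [abs_of_pos (by positivity)]; exact hKc
      · refine (le_abs_self _).trans (le_trans ?_ (z8y.1.trans hKC))
        exact le_mul_of_one_le_left (abs_nonneg _) (by linarith)
      · refine z8y.2.trans ?_
        rw [add_comm 1 M]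
        gcongr
      · exact le_mul_of_one_le_left hM hK
    · exact ten_le (c := |k|⁻¹) l0 (fun y => norm_nonneg _) fun y hy => by
        rw [nv' y hy]; gcongr
        linarith [norm_nonneg (u y), norm_nonneg (h y), norm_nonneg (g y)]
    · exact ten_le (c := 1) l0 (fun y => norm_nonneg _) fun y hy => by
        linarith [norm_nonneg (v y), norm_nonneg (h y), norm_nonneg (g y)]
    · exact ten_le (c := 1) l1 (fun y => norm_nonneg _) fun y hy => by
        linarith [norm_nonneg (deriv v y), norm_nonneg (deriv h y), norm_nonneg (deriv g y)]
    · exact ten_le (c := |k|⁻¹) l0 (fun y => norm_nonneg _) fun y hy => by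
        rw [ng' y hy]; gcongr
        linarith [norm_nonneg (u y), norm_nonneg (h y), norm_nonneg (v y)]
    · exact ten_le (c := 1) l0 (fun y => norm_nonneg _) fun y hy => by
        linarith [norm_nonneg (v y), norm_nonneg (u y), norm_nonneg (g y)]
    · exact ten_le (c := 1) l1 (fun y => norm_nonneg _) fun y hy => by
        linarith [norm_nonneg (deriv v y), norm_nonneg (deriv u y), norm_nonneg (deriv g y)]
    · exact ten_le (c := |k|⁻¹) lp (fun y => by positivity) fun y hy => by
        rw [nv' y hy, mul_left_comm]; gcongr
        linarith [norm_nonneg (u y), norm_nonneg (h y), norm_nonneg (g y)]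
    · exact ten_le (c := |k|⁻¹) lp (fun y => by positivity) fun y hy => by
        rw [ng' y hy, mul_left_comm]; gcongr
        linarith [norm_nonneg (u y), norm_nonneg (h y), norm_nonneg (v y)]
  have hwe : ∀ y, 0 < y → wf k (prim u) u (prim h) h y = ‖u y‖+‖v y‖+‖h y‖+‖g y‖ := by
    intro y hy
    rw [nv y hy, ng y hy]; unfold wf; ring
  refine ⟨?_, hwe⟩
  have hKbp : 0 ≤ 2*κ/γ := by positivity
  have hX : ∀ y, ‖prim h y‖ ≤ Xf (prim u) (prim h) y := fun y => by unfold Xf; linarith [norm_nonneg (prim u y)]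
  have hwb : ∀ y, 0 < y → ‖h y‖+‖g y‖ ≤ wf k (prim u) u (prim h) h y := fun y hy => by
    rw [hwe y hy]; linarith [norm_nonneg (u y), norm_nonneg (v y)]
  have hw0 := Dat.w0 k (prim u) u (prim h) h
  have hkwd : ∀ y, |k| * wf k (prim u) u (prim h) h y ≤ df k (prim u) u (deriv u) (prim h) h (deriv h) y := fun y => by
    unfold df; linarith [norm_nonneg (deriv u y), norm_nonneg (deriv h y)]
  have hdb : ∀ y, 0 < y → ‖deriv h y‖+‖deriv g y‖ ≤ df k (prim u) u (deriv u) (prim h) h (deriv h) y := fun y hy => by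
    have : |k| * ‖h y‖ ≤ |k| * wf k (prim u) u (prim h) h y := by
      gcongr; linarith [hwb y hy, norm_nonneg (g y)]
    rw [sg1 y hy, nk_eq]
    unfold df; linarith [norm_nonneg (deriv u y)]
  have hd0 : ∀ y, 0 ≤ df k (prim u) u (deriv u) (prim h) h (deriv h) y := fun y => by
    have := hw0 y
    unfold df; positivity
  have ha0 : ∀ y, 0 < y → 0 ≤ af k (prim u) u (prim h) h y := fun y hy => by
    have := hw0 y
    have : 0 ≤ Xf (prim u) (prim h) y := (norm_nonneg _).trans (hX y)
    unfold af; positivity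
  have hN1 : ∀ (i : Fin 2) y, 0 < y → ‖Complex.I*(k:ℂ)*((Real.sqrt ε:ℂ)*(AU (y / Real.sqrt ε) i 0*h y+AU (y / Real.sqrt ε) i 1*g y))
      + (Real.sqrt ε:ℂ)*(BU (y / Real.sqrt ε) i 0*deriv h y+BU (y / Real.sqrt ε) i 1*deriv g y)
      + (CU (y / Real.sqrt ε) i 0*h y+CU (y / Real.sqrt ε) i 1*g y) + (((Real.sqrt ε)⁻¹:ℝ):ℂ)*(prim h y)*DU (y / Real.sqrt ε) i‖
      ≤ nnf (2+2*κ/γ) k ε M (prim u) u (deriv u) (prim h) h (deriv h) y := by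
    intro i y hy
    have hY := hYp y hy
    have n := norm_nonneg (E := ℂ)
    refine (Nbd1 (M := M) (w := wf k (prim u) u (prim h) h y) (d := df k (prim u) u (deriv u) (prim h) h (deriv h) y)
      (X := Xf (prim u) (prim h) y) hse hy rfl hM (t_bd hY (n _) (n _) (hAB _ hY i 0)).1
      (t_bd hY (n _) (n _) (hAB _ hY i 1)).1 (t_bd hY (n _) (n _) (hAB _ hY i 0)).2 (t_bd hY (n _) (n _) (hAB _ hY i 1)).2
      (t_bd hY (n _) (n _) (hCC _ hY i 0)).1 (t_bd hY (n _) (n _) (hCC _ hY i 1)).1 (t2_bd hY (n _) (n _) (hDD _ hY i)).1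
      (hwb y hy) (hkwd y) (hdb y hy) (hX y)).trans ?_
    have := hd0 y
    have := ha0 y hy
    exact nn_a (by positivity) (by positivity) (mul_nonneg (by positivity) this) (by linarith) (by linarith)
  have hN3 : ∀ (i : Fin 2) (q : ℝ → ℂ) y, 0 < y → ‖q y‖ ≤ df k (prim u) u (deriv u) (prim h) h (deriv h) y →
     ‖-(((2 * κ * Real.sqrt ε * (deriv Hs (y / Real.sqrt ε) / Hs (y / Real.sqrt ε)) : ℝ) : ℂ) * q y)
      + (CH (y / Real.sqrt ε) i 0*h y+CH (y / Real.sqrt ε) i 1*g y) + (((Real.sqrt ε)⁻¹:ℝ):ℂ)*(prim h y)*DH (y / Real.sqrt ε) i‖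
      ≤ nnf (2+2*κ/γ) k ε M (prim u) u (deriv u) (prim h) h (deriv h) y := by
    intro i q y hy hq
    have hY := hYp y hy
    have n := norm_nonneg (E := ℂ)
    refine (Nbd3 (M := M) (w := wf k (prim u) u (prim h) h y) (d := df k (prim u) u (deriv u) (prim h) h (deriv h) y)
      (X := Xf (prim u) (prim h) y) (Kb := 2*κ/γ) hse hy rfl hM
      (t_bd hY (n _) (n _) (hCC _ hY i 0)).2 (t_bd hY (n _) (n _) (hCC _ hY i 1)).2 (t2_bd hY (n _) (n _) (hDD _ hY i)).2
      (bp_bd hκ hγ hse (hHs _ hY).1 (t_bd hY (abs_nonneg _) (abs_nonneg _) (hd _ hY)).2)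
      (hwb y hy) hq (hX y)).trans ?_
    have := hd0 y
    have := ha0 y hy
    exact nn_a (by positivity) (by positivity) (mul_nonneg (by positivity) this) (by linarith) (by linarith)
  have hnn : ∀ y : ℝ, 0 < y → _ := fun y hy => hn_a (Kb := 2+2*κ/γ) (K := K) (t := (1+y/Real.sqrt ε)⁻¹)
    (S := Real.sqrt ε*M*df k (prim u) u (deriv u) (prim h) h (deriv h) y + M*(1+M)*af k (prim u) u (prim h) h y)
    (y := y) (se := Real.sqrt ε) (by positivity) hKb
    (by have := hd0 y; have := ha0 y hy; positivity) hy hse rfl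
  have nsub : ∀ {F R N : ℂ} {A B : ℝ}, F = R - N → ‖R‖ ≤ A → ‖N‖ ≤ B → ‖F‖ ≤ A + B := by
    intro F R N A B e a b
    rw [e]; exact (norm_sub_le _ _).trans (add_le_add a b)
  refine ⟨k/|k|, _, _, _, _, ⟨S, ?_, ?_, hε, hε1, hM, hK, hc0, hc1, ?_, ?_, ?_, ?_, ?_, cz2, fun y hy => (cz4 y hy).1,
    ?_, ?_, ?_, ?_, fun y _ => by positivity, fun y hy => (hnn y hy).2.2, fun y hy => (hnn y hy).1, fun y hy => (hnn y hy).2.1,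
    fun y _ => rfl, fun y _ => rfl, fun y _ => rfl, fun y _ => rfl, 
    ((mR.1.add mR.2.1).add mR.2.2.1).add mR.2.2.2, mprim cu m0.2.1 nv', m0.1, m1.1, mprim ch m0.2.2.2 ng', m0.2.2.1, m1.2⟩⟩
  · rw [abs_div, abs_abs, div_self hka.ne']
  · rw [div_mul_eq_mul_div, div_eq_iff hka.ne', abs_mul_abs_self]
  · intro y hy
    exact hc2.trans (by have := hG _ (hYp y hy); gcongr)
  · intro y hy
    exact hc3.trans (hG _ (hYp y hy))
  · exact coA hZ (dGf _ hU hH) z4 z6 cz4 hKC hM hε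
  · intro y hy
    have c3 := (co3 hHs hγ₀ hG hd hse hy).2.1
    rw [abs_mul, abs_of_pos hε]
    calc ε * |Gd Us Hs (Real.sqrt ε) y| = Real.sqrt ε * (Real.sqrt ε * |Gd Us Hs (Real.sqrt ε) y|) := by
          rw [← mul_assoc, hse2]
      _ ≤ Real.sqrt ε * (K*M) := mul_le_mul_of_nonneg_left (c3.trans (by gcongr)) hse.le
      _ = _ := by ring
  · intro y hy hy2
    refine (cz3 y hy hy2).trans ?_
    have := cz2 y hy
    gcongr
  · intro y hy
    refine nsub (R := R1 y) ?_ ?_ (hN1 0 y hy)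
    · have := E1 y hy
      simp only [prim]
      push_cast at this ⊢
      linear_combination this
    · linarith [norm_nonneg (R2 y), norm_nonneg (R3 y), norm_nonneg (R4 y)]
  · intro y hy
    refine nsub (R := R2 y) ?_ ?_ (hN1 1 y hy)
    · have := E2 y hy
      rw [sv2 y hy] at this
      have e1 := sv y hy
      have e2 := sg y hy
      simp only [prim]
      rw [← e1, ← e2]
      push_cast at this ⊢
      linear_combination this
    · linarith [norm_nonneg (R1 y), norm_nonneg (R3 y), norm_nonneg (R4 y)]
  · intro y hy
    refine nsub (R := R3 y) ?_ ?_ (hN3 0 (deriv h) y hy (by linarith [hdb y hy, norm_nonneg (deriv g y)]))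
    · have := E3 y hy
      simp only [prim]
      push_cast at this ⊢
      linear_combination this
    · linarith [norm_nonneg (R1 y), norm_nonneg (R2 y), norm_nonneg (R4 y)]
  · intro y hy
    refine nsub (R := R4 y) ?_ ?_ (hN3 1 (deriv g) y hy (by linarith [hdb y hy, norm_nonneg (deriv h y)]))
    · have := E4 y hy
      rw [sg2 y hy] at this
      have e1 := sv y hy
      have e2 := sg y hy
      simp only [prim]
      rw [← e1, ← e2]
      push_cast at this ⊢
      linear_combination this
    · linarith [norm_nonneg (R1 y), norm_nonneg (R2 y), norm_nonneg (R3 y)]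

lemma wt_eq {Z : ℝ → ℝ} (f : ℝ → ℂ) (hZ : ∀ y, 0 < y → 0 ≤ Z y) : nsq (wt Z f) = ∫ y, Z y * ‖f y‖^2 ∂mI := by
  unfold nsq wt
  refine setIntegral_congr_fun measurableSet_Ioi fun y hy => ?_
  rw [norm_mul, mul_pow, Complex.norm_real, Real.norm_eq_abs, sq_abs, Real.sq_sqrt (hZ y hy)]

lemma nsq_one (f : ℝ → ℂ) : nsq f = ∫ y, (fun _ => (1:ℝ)) y * ‖f y‖^2 ∂mI := by
  unfold nsq
  simp only [one_mul]

lemma sqrt4 {a b : ℝ} (h : a ≤ 4 * b) : Real.sqrt a ≤ 2 * Real.sqrt b := by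
  have h4 : Real.sqrt 4 = 2 := by rw [show (4:ℝ) = 2^2 by norm_num]; exact Real.sqrt_sq (by norm_num)
  rw [← h4, ← Real.sqrt_mul (by norm_num)]
  exact Real.sqrt_le_sqrt h

/-- comparison of weighted norms -/
lemma nrm_w {Z : ℝ → ℝ} {f1 f2 f3 f4 : ℝ → ℂ} {w : ℝ → ℝ} (hZ : ∀ y, 0 < y → 0 ≤ Z y)
    (hi : ∀ f : ℝ → ℝ, MemLp f 2 mI → Integrable (fun y => Z y * f y ^2) mI)
    (h1 : ML2 f1) (h2 : ML2 f2) (h3 : ML2 f3) (h4 : ML2 f4) (hw : MemLp w 2 mI)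
    (hwe : ∀ y, 0 < y → w y = ‖f1 y‖+‖f2 y‖+‖f3 y‖+‖f4 y‖) :
    nrm4 (wt Z f1) (wt Z f2) (wt Z f3) (wt Z f4) ≤ Real.sqrt (∫ y, Z y * w y ^2 ∂mI) ∧
    Real.sqrt (∫ y, Z y * w y ^2 ∂mI) ≤ 2 * nrm4 (wt Z f1) (wt Z f2) (wt Z f3) (wt Z f4) := by
  have := four_le hZ (hi _ (ML_memLp h1)) (hi _ (ML_memLp h2)) (hi _ (ML_memLp h3)) (hi _ (ML_memLp h4)) (hi _ hw) hwe
  unfold nrm4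
  rw [wt_eq f1 hZ, wt_eq f2 hZ, wt_eq f3 hZ, wt_eq f4 hZ]
  exact ⟨Real.sqrt_le_sqrt this.1, sqrt4 this.2⟩

lemma nrm_1 {f1 f2 f3 f4 : ℝ → ℂ} {w : ℝ → ℝ}
    (h1 : ML2 f1) (h2 : ML2 f2) (h3 : ML2 f3) (h4 : ML2 f4) (hw : MemLp w 2 mI)
    (hwe : ∀ y, 0 < y → w y = ‖f1 y‖+‖f2 y‖+‖f3 y‖+‖f4 y‖) :
    Real.sqrt (∫ y, w y ^2 ∂mI) ≤ 2 * nrm4 f1 f2 f3 f4 := by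
  have hi : ∀ f : ℝ → ℝ, MemLp f 2 mI → Integrable (fun y => (fun _ => (1:ℝ)) y * f y ^2) mI := fun f hf => by
    simpa only [one_mul] using hf.integrable_sq
  have := four_le (Z := fun _ => 1) (fun _ _ => zero_le_one) (hi _ (ML_memLp h1)) (hi _ (ML_memLp h2))
    (hi _ (ML_memLp h3)) (hi _ (ML_memLp h4)) (hi _ hw) hwe
  unfold nrm4
  rw [nsq_one f1, nsq_one f2, nsq_one f3, nsq_one f4]
  have h := sqrt4 this.2
  have e : ∫ y, (fun _ => (1:ℝ)) y * w y ^2 ∂mI = ∫ y, w y ^2 ∂mI := by simp only [one_mul]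
  rw [e] at h
  exact h

/-- the weighted L² estimate on `|ñ|^{1/2}‖Z^{1/2}Ŵ‖_{L²}`
for solutions of the transformed linearized MHD system on one Fourier mode. -/
theorem stmt16
    (μ κ γ γbar γ₀ C₀ : ℝ) (hμ : 0 < μ) (hκ : 0 < κ)
    (hγ : 0 < γ) (hγγ : γ ≤ γbar) (hγ₀ : 0 < γ₀) (hC₀ : 1 ≤ C₀) :
    ∃ ε₁ : ℝ, 0 < ε₁ ∧ ∀ η : ℝ, 0 < η → ∃ C₅ : ℝ, 0 < C₅ ∧
    ∀ (ε ϱ : ℝ) (n : ℤ), ε ∈ Set.Ioc (0:ℝ) 1 → ε < ε₁ → 0 < ϱ → n ≠ 0 →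
    ∀ Us Hs : ℝ → ℝ, ContDiff ℝ 3 Us → ContDiff ℝ 3 Hs → Us 0 = 0 →
      (∀ Y, 0 ≤ Y → γ ≤ |Hs Y| ∧ |Hs Y| ≤ γbar) →
      (∀ Y, 0 ≤ Y → γ₀ ≤ Hs Y ^ 2 - Us Y ^ 2) →
    ∀ Mbar : ℝ,
      (∀ Y, 0 ≤ Y → ∀ k : ℕ, 1 ≤ k → k ≤ 3 →
        (1 + Y)^3 * (|iteratedDeriv k Us Y| + |iteratedDeriv k Hs Y|) ≤ Mbar) →
    ∀ (AU BU CU CH : ℝ → Matrix (Fin 2) (Fin 2) ℂ) (DU DH : ℝ → Fin 2 → ℂ),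
      Continuous AU → Continuous BU → Continuous CU → Continuous CH →
      Continuous DU → Continuous DH →
      (∀ Y, 0 ≤ Y → ∀ i j, (1 + Y) * (‖AU Y i j‖ + ‖BU Y i j‖) ≤ Mbar) →
      (∀ Y, 0 ≤ Y → ∀ i j, (1 + Y) * (‖CU Y i j‖ + ‖CH Y i j‖) ≤ Mbar * (1 + Mbar)) →
      (∀ Y, 0 ≤ Y → ∀ i, (1 + Y)^2 * (‖DU Y i‖ + ‖DH Y i‖) ≤ Mbar * (1 + Mbar)) →
    ∀ Z : ℝ → ℝ, ContDiff ℝ 2 Z →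
      (∀ y, 0 ≤ y → 0 ≤ Z y ∧ Z y ≤ C₀ ∧ 0 ≤ deriv Z y) →
      (∀ y ∈ Set.Icc (0:ℝ) 2, C₀⁻¹ * y ≤ Z y ∧ Z y ≤ C₀ * y) →
      (∀ y, 2 ≤ y → Z y = Z 2) →
      (∀ y ∈ Set.Icc (0:ℝ) 1,
        (Hs (y / Real.sqrt ε) ^ 2 - Us (y / Real.sqrt ε) ^ 2) * deriv Z y = 1) →
      (∀ y ∈ Set.Icc (0:ℝ) (3/2), ∀ k : ℕ, k ≤ 3 →
        |y ^ k * deriv (deriv Z) y| ≤ C₀ * Mbar * ε ^ (((k:ℝ) - 1)/2)) →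
      (∀ y, 1 ≤ y → -(C₀ * Mbar * ε) ≤
        -(deriv (fun t => (Hs (t / Real.sqrt ε) ^ 2 - Us (t / Real.sqrt ε) ^ 2)
            * deriv Z t) y)) →
      (∀ y, 3/2 ≤ y → deriv (deriv Z) y ≤ 0) →
      (∀ y, 0 ≤ y → (1 + y) * |deriv Z y| ≤ C₀ ∧
        y * |deriv (deriv Z) y| ≤ C₀ * (Mbar + 1)) →
    ∀ u v h g p R1 R2 R3 R4 : ℝ → ℂ,
      ContDiff ℝ 3 u → ContDiff ℝ 3 v → ContDiff ℝ 3 h → ContDiff ℝ 3 g →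
      ContDiff ℝ 2 p →
      (ML2 u ∧ ML2 v ∧ ML2 h ∧ ML2 g) →
      (ML2 (deriv u) ∧ ML2 (deriv v) ∧ ML2 (deriv h) ∧ ML2 (deriv g)) →
      (ML2 (deriv (deriv u)) ∧ ML2 (deriv (deriv v)) ∧
        ML2 (deriv (deriv h)) ∧ ML2 (deriv (deriv g))) →
      Tendsto (fun y => ‖u y‖ + ‖v y‖ + ‖h y‖ + ‖g y‖) atTop (nhds 0) →
      Tendsto (fun y => ‖deriv u y‖ + ‖deriv v y‖ + ‖deriv h y‖ + ‖deriv g y‖)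
        atTop (nhds 0) →
      Tendsto (fun y => ‖deriv (deriv u) y‖ + ‖deriv (deriv v) y‖
        + ‖deriv (deriv h) y‖ + ‖deriv (deriv g) y‖) atTop (nhds 0) →
      Tendsto (fun y => ‖p y‖ * (‖u y‖ + ‖v y‖ + ‖h y‖ + ‖g y‖)) atTop (nhds 0) →
      (ML2 R1 ∧ ML2 R2 ∧ ML2 R3 ∧ ML2 R4) →
      -- equation (E1), first and second components
      (∀ y, 0 < y →
        Complex.I * (((n:ℝ)/ϱ : ℝ) : ℂ) *
            ((((1 + μ/κ) * Us (y / Real.sqrt ε) : ℝ) : ℂ) * u y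
              - ((Hs (y / Real.sqrt ε) ^ 2 - Us (y / Real.sqrt ε) ^ 2 : ℝ) : ℂ) * h y
              + ((Real.sqrt ε : ℝ) : ℂ) *
                  (AU (y / Real.sqrt ε) 0 0 * h y + AU (y / Real.sqrt ε) 0 1 * g y))
          + ((Real.sqrt ε : ℝ) : ℂ) *
              (BU (y / Real.sqrt ε) 0 0 * deriv h y + BU (y / Real.sqrt ε) 0 1 * deriv g y)
          + (CU (y / Real.sqrt ε) 0 0 * h y + CU (y / Real.sqrt ε) 0 1 * g y)
          + (((Real.sqrt ε)⁻¹ : ℝ) : ℂ) * (∫ s in (0:ℝ)..y, h s) * DU (y / Real.sqrt ε) 0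
          + Complex.I * (((n:ℝ)/ϱ : ℝ) : ℂ) * p y
          - ((μ * ε : ℝ) : ℂ) *
              (deriv (deriv u) y - (((n:ℝ)/ϱ : ℝ) : ℂ)^2 * u y)
          = R1 y) →
      (∀ y, 0 < y →
        Complex.I * (((n:ℝ)/ϱ : ℝ) : ℂ) *
            ((((1 + μ/κ) * Us (y / Real.sqrt ε) : ℝ) : ℂ) * v y
              - ((Hs (y / Real.sqrt ε) ^ 2 - Us (y / Real.sqrt ε) ^ 2 : ℝ) : ℂ) * g y
              + ((Real.sqrt ε : ℝ) : ℂ) *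
                  (AU (y / Real.sqrt ε) 1 0 * h y + AU (y / Real.sqrt ε) 1 1 * g y))
          + ((Real.sqrt ε : ℝ) : ℂ) *
              (BU (y / Real.sqrt ε) 1 0 * deriv h y + BU (y / Real.sqrt ε) 1 1 * deriv g y)
          + (CU (y / Real.sqrt ε) 1 0 * h y + CU (y / Real.sqrt ε) 1 1 * g y)
          + (((Real.sqrt ε)⁻¹ : ℝ) : ℂ) * (∫ s in (0:ℝ)..y, h s) * DU (y / Real.sqrt ε) 1
          + deriv p y
          - ((μ * ε : ℝ) : ℂ) *
              (deriv (deriv v) y - (((n:ℝ)/ϱ : ℝ) : ℂ)^2 * v y)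
          = R2 y) →
      -- equation (E2), first and second components
      (∀ y, 0 < y →
        -(Complex.I * (((n:ℝ)/ϱ : ℝ) : ℂ)) * u y
          - ((2 * κ * Real.sqrt ε *
              (deriv Hs (y / Real.sqrt ε) / Hs (y / Real.sqrt ε)) : ℝ) : ℂ) * deriv h y
          + (CH (y / Real.sqrt ε) 0 0 * h y + CH (y / Real.sqrt ε) 0 1 * g y)
          + (((Real.sqrt ε)⁻¹ : ℝ) : ℂ) * (∫ s in (0:ℝ)..y, h s) * DH (y / Real.sqrt ε) 0
          - ((κ * ε : ℝ) : ℂ) *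
              (deriv (deriv h) y - (((n:ℝ)/ϱ : ℝ) : ℂ)^2 * h y)
          = R3 y) →
      (∀ y, 0 < y →
        -(Complex.I * (((n:ℝ)/ϱ : ℝ) : ℂ)) * v y
          - ((2 * κ * Real.sqrt ε *
              (deriv Hs (y / Real.sqrt ε) / Hs (y / Real.sqrt ε)) : ℝ) : ℂ) * deriv g y
          + (CH (y / Real.sqrt ε) 1 0 * h y + CH (y / Real.sqrt ε) 1 1 * g y)
          + (((Real.sqrt ε)⁻¹ : ℝ) : ℂ) * (∫ s in (0:ℝ)..y, h s) * DH (y / Real.sqrt ε) 1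
          - ((κ * ε : ℝ) : ℂ) *
              (deriv (deriv g) y - (((n:ℝ)/ϱ : ℝ) : ℂ)^2 * g y)
          = R4 y) →
      -- equation (E3): divergence-free conditions
      (∀ y, 0 < y →
        Complex.I * (((n:ℝ)/ϱ : ℝ) : ℂ) * u y + deriv v y = 0 ∧
        Complex.I * (((n:ℝ)/ϱ : ℝ) : ℂ) * h y + deriv g y = 0) →
      -- equation (E4): boundary conditions
      u 0 = 0 → v 0 = 0 → deriv h 0 = 0 → g 0 = 0 →
      Real.sqrt |(n:ℝ)/ϱ| * nrm4 (wt Z u) (wt Z v) (wt Z h) (wt Z g)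
        ≤ C₅ * (Real.sqrt |(n:ℝ)/ϱ|)⁻¹ * |Real.log ε| ^ ((1:ℝ) + η/3) *
              nrm4 (wt Z R1) (wt Z R2) (wt Z R3) (wt Z R4)
          + C₅ * ε ^ ((1:ℝ)/4) * Real.sqrt Mbar *
              Real.sqrt (nrm4 R1 R2 R3 R4) * Real.sqrt (nrm4 u v h g)
          + C₅ * ε ^ ((1:ℝ)/4) * (1 + Real.sqrt Mbar) *
              nrm4 R1 R2 R3 R4 ^ ((1:ℝ)/4) * nrm4 u v h g ^ ((3:ℝ)/4)
          + C₅ * ε ^ ((1:ℝ)/4) * Mbar ^ ((1:ℝ)/4) * (1 + Mbar ^ ((5:ℝ)/4)) *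
              nrm4 u v h g := by
  have hγb : 0 < γbar := hγ.trans_le hγγ
  have q1 : 0 < μ/κ := by positivity
  have q2 : 0 < κ/γ := by positivity
  have q3 : 0 < γbar^2 := by positivity
  have q4' : 2*κ/γ = 2*(κ/γ) := by ring
  obtain ⟨K, hKdef⟩ : ∃ K : ℝ, K = 1+μ+κ+(1+μ/κ)+γbar+γbar^2+2*γbar+C₀+(2+2*(κ/γ)) := ⟨_, rfl⟩
  obtain ⟨c₀, hc, hc1, hc2, hc3⟩ : ∃ c₀ : ℝ, 0 < c₀ ∧ c₀ ≤ μ ∧ c₀ ≤ κ*γ₀ ∧ c₀ ≤ γ₀ :=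
    ⟨min μ (min (κ*γ₀) γ₀), lt_min hμ (lt_min (by positivity) hγ₀), min_le_left _ _,
      (min_le_right _ _).trans (min_le_left _ _), (min_le_right _ _).trans (min_le_right _ _)⟩
  have k1 : μ ≤ K := by linarith
  have k2 : κ ≤ K := by linarith
  have k3 : 1+μ/κ ≤ K := by linarith
  have k4 : γbar ≤ K := by linarith
  have k5 : γbar^2 ≤ K := by linarith
  have k6 : 2*γbar ≤ K := by linarith
  have k7 : C₀ ≤ K := by linarith
  have k8 : 2+2*κ/γ ≤ K := by rw [q4']; linarith
  obtain ⟨C, hC, hmain⟩ := main_abs hc (hC₀.trans k7)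
  refine ⟨Real.exp (-1), Real.exp_pos _, fun η hη => ⟨6*C, by positivity, ?_⟩⟩
  intro ε ϱ n hε hε1 hϱ hn Us Hs hU hH _ hHs hG M hbd AU BU CU CH DU DH _ _ _ _ _ _ hAB hCC hDD
    Z hZ z1 z2 z3 z4 _ z6 _ z8 u v h g p R1 R2 R3 R4 cu cv ch cg cp m0 m1 _ l0 l1 _ lp mR E1 E2 E3 E4 dv u0 v0 h0 g0
  have hk : (n:ℝ)/ϱ ≠ 0 := div_ne_zero (Int.cast_ne_zero.2 hn) hϱ.ne'
  obtain ⟨⟨s, F1, F2, F3, F4, D⟩, hwe⟩ := mkDat hμ hκ hγ hγγ hγ₀ hC₀ k1 k2 k3 k4 k5 k6 k7 k8 hc hc1 hc2 hc3 hε.1 hε.2 hk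
    hU hH hHs hG hbd hAB hCC hDD hZ z1 z2 z3 z4 z6 z8 cu cv ch cg cp
    ⟨ML_memLp m0.1, ML_memLp m0.2.1, ML_memLp m0.2.2.1, ML_memLp m0.2.2.2⟩ ⟨ML_memLp m1.1, ML_memLp m1.2.2.1⟩ l0 l1 lp
    ⟨ML_memLp mR.1, ML_memLp mR.2.1, ML_memLp mR.2.2.1, ML_memLp mR.2.2.2⟩ E1 E2 E3 E4 dv u0 v0 h0 g0
  have hm := hmain hk D
  have hM := D.hM
  have hZ0 : ∀ y, 0 < y → 0 ≤ Z y := fun y hy => (z1 y hy.le).1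
  have hi : ∀ f : ℝ → ℝ, MemLp f 2 mI → Integrable (fun y => Z y * f y ^2) mI := fun f hf => (D.wz hf).1
  have hRm := (((ML_memLp mR.1).add (ML_memLp mR.2.1)).add (ML_memLp mR.2.2.1)).add (ML_memLp mR.2.2.2)
  have a1 := nrm_w hZ0 hi m0.1 m0.2.1 m0.2.2.1 m0.2.2.2 D.lw hwe
  have a2 := nrm_w hZ0 hi mR.1 mR.2.1 mR.2.2.1 mR.2.2.2 hRm (fun y _ => rfl)
  have a3 := nrm_1 m0.1 m0.2.1 m0.2.2.1 m0.2.2.2 D.lw hwe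
  have a4 := nrm_1 mR.1 mR.2.1 mR.2.2.1 mR.2.2.2 hRm (fun y _ => rfl)
  have hε0 : 0 < ε := hε.1
  have n4 : ∀ a b c d, 0 ≤ nrm4 a b c d := fun _ _ _ _ => Real.sqrt_nonneg _
  refine fin_cmp hC (Real.sqrt_pos.2 (abs_pos.2 hk)) (n4 _ _ _ _) (Real.sqrt_nonneg _) (Real.rpow_nonneg (abs_nonneg _) _)
    (Real.rpow_nonneg hε0.le _) (Real.sqrt_nonneg _) (Real.sqrt_nonneg _) (n4 _ _ _ _) (Real.sqrt_nonneg _) (n4 _ _ _ _)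
    (Real.rpow_nonneg hM _) (Real.rpow_nonneg hM _) (fin_log hε0 hε1.le hη) a2.2 a4 a3 ?_
    ((mul_le_mul_of_nonneg_left a1.1 (Real.sqrt_nonneg _)).trans hm)
  exact mul_nonneg (mul_nonneg (mul_nonneg (mul_nonneg (by positivity) (Real.rpow_nonneg hε0.le _)) (Real.sqrt_nonneg _))
    (Real.sqrt_nonneg _)) (Real.sqrt_nonneg _)
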